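/- arXiv:1007.3028 — 4 statements merged into one kernel-verified Lean document; each statement's English description precedes it below -/
import Mathlib

section
/- Let V ⊆ Sym₄(ℂ) be a 4-dimensional linear subspace satisfying assumptions (i) and (ii). Then there exist four singular points of Δ_V admitting linearly independent representatives in V, i.e., Δ_V has a quadruple of non-coplanar singular points. -/
open Matrix
open scoped LinearAlgebra.Projectivization

noncomputable section

namespace DetLinearSystem

/-- The matrix of the linear system corresponding to `x ∈ ℂ⁴`, for a chosen basis `b` of the
`4`-dimensional subspace `V ⊆ Sym₄(ℂ)`. -/
def mat (b : Fin 4 → Matrix (Fin 4) (Fin 4) ℂ) (x : Fin 4 → ℂ) : Matrix (Fin 4) (Fin 4) ℂ :=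
  ∑ i, x i • b i

/-- The restriction of `det` to `V`, in the coordinates given by the basis `b`. -/
def detV (b : Fin 4 → Matrix (Fin 4) (Fin 4) ℂ) (x : Fin 4 → ℂ) : ℂ := (mat b x).det

/-- `x` is a representative of a singular point of `Δ_V`: all partial derivatives of the
restricted determinant vanish. -/
def IsSingRep (b : Fin 4 → Matrix (Fin 4) (Fin 4) ℂ) (x : Fin 4 → ℂ) : Prop :=
  x ≠ 0 ∧ ∀ i, fderiv ℂ (detV b) x (Pi.single i 1) = 0

/-- The Hessian matrix of the restricted determinant at `x`. -/
def hessV (b : Fin 4 → Matrix (Fin 4) (Fin 4) ℂ) (x : Fin 4 → ℂ) :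
    Matrix (Fin 4) (Fin 4) ℂ :=
  Matrix.of fun i j =>
    fderiv ℂ (fun y => fderiv ℂ (detV b) y (Pi.single j 1)) x (Pi.single i 1)

/-- The set of singular points of `Δ_V` in `ℙ(V) ≅ ℂP³`. -/
def singPoints (b : Fin 4 → Matrix (Fin 4) (Fin 4) ℂ) : Set (ℙ ℂ (Fin 4 → ℂ)) :=
  {p | ∃ x, ∃ hx : x ≠ 0, p = Projectivization.mk ℂ x hx ∧ IsSingRep b x}

open MvPolynomial in
lemma hc_mul (p q : MvPolynomial (Fin 3) ℂ) (m n : ℕ) (hp : p.totalDegree ≤ m)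
    (hq : q.totalDegree ≤ n) :
    homogeneousComponent (m + n) (p * q) =
      homogeneousComponent m p * homogeneousComponent n q := by
  ext d
  by_cases hd : d.degree = m + n
  · rw [coeff_homogeneousComponent, if_pos hd, coeff_mul, coeff_mul]
    refine Finset.sum_congr rfl fun x hx => ?_
    rw [Finset.HasAntidiagonal.mem_antidiagonal] at hx
    have hx' : x.1.degree + x.2.degree = m + n := by rw [← hd, ← hx, map_add]
    rw [coeff_homogeneousComponent, coeff_homogeneousComponent]
    rcases lt_trichotomy x.1.degree m with h | h | h
    · have : coeff x.2 q = 0 := coeff_eq_zero_of_totalDegree_lt (by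
        have : n < x.2.degree := by omega
        exact lt_of_le_of_lt hq this)
      simp [this]
    · rw [if_pos h, if_pos (by omega)]
    · have : coeff x.1 p = 0 := coeff_eq_zero_of_totalDegree_lt (lt_of_le_of_lt hp h)
      simp [this]
  · rw [coeff_homogeneousComponent, if_neg hd]
    exact (((homogeneousComponent_isHomogeneous m p).mul
      (homogeneousComponent_isHomogeneous n q)).coeff_eq_zero hd).symm

open MvPolynomial in
/-- A nonconstant divisor of a nonzero form has a top form, which divides too. -/
lemma top_dvd {d h : MvPolynomial (Fin 3) ℂ} {n : ℕ} (hh : h.IsHomogeneous n) (h0 : h ≠ 0)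
    (hd : d ∣ h) : homogeneousComponent d.totalDegree d ∣ h := by
  obtain ⟨e, rfl⟩ := hd
  have hd0 := left_ne_zero_of_mul h0
  have he0 := right_ne_zero_of_mul h0
  have h1 := hh.totalDegree h0
  rw [totalDegree_mul_of_isDomain hd0 he0] at h1
  refine ⟨homogeneousComponent e.totalDegree e, ?_⟩
  rw [← hc_mul _ _ _ _ le_rfl le_rfl, h1, homogeneousComponent_eq_self hh]

open MvPolynomial in
lemma finrank_form (n : ℕ) :
    Module.finrank ℂ (homogeneousSubmodule (Fin 3) ℂ n) = (n + 2).choose n := by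
  rw [homogeneousSubmodule_eq_finsupp_supported]
  have hs : {d : Fin 3 →₀ ℕ | d.degree = n} = ((Finset.univ : Finset (Fin 3)).finsuppAntidiag n : Set _) := by
    ext d
    simp [Finsupp.degree_eq_sum]
  rw [hs, LinearEquiv.finrank_eq (AddMonoidAlgebra.supportedEquivFinsupp _)]
  rw [Module.finrank_finsupp_self]
  simp only [Finset.coe_sort_coe, Fintype.card_coe, Finset.card_finsuppAntidiag_nat_eq_choose]
  simp [show 3 + n - 1 = n + 2 by omega]

instance (n : ℕ) : Module.Finite ℂ (MvPolynomial.homogeneousSubmodule (Fin 3) ℂ n) :=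
  Module.Finite.iff_fg.mpr (MvPolynomial.homogeneousSubmodule_fg _ _ n)

open MvPolynomial in
/-- Linear form separating two independent vectors. -/
lemma exists_lin (a c : Fin 3 → ℂ) (h : LinearIndependent ℂ ![a, c]) :
    ∃ l : MvPolynomial (Fin 3) ℂ, l.IsHomogeneous 1 ∧ eval a l = 0 ∧ eval c l ≠ 0 := by
  have hc : c ∉ Submodule.span ℂ {a} := by
    intro hc
    obtain ⟨t, ht⟩ := Submodule.mem_span_singleton.mp hc
    have := LinearIndependent.pair_iff.mp h t (-1) (by simp [ht])
    simp at this
  obtain ⟨f, hf, hf'⟩ := Submodule.exists_le_ker_of_notMem hc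
  refine ⟨∑ i, C (f fun j => if i = j then 1 else 0) * X i, ?_, ?_, ?_⟩
  · exact IsHomogeneous.sum _ _ _ fun i _ => isHomogeneous_C_mul_X _ _
  · have : f a = 0 := hf' (Submodule.mem_span_singleton_self a)
    rw [LinearMap.pi_apply_eq_sum_univ f a] at this
    simpa [mul_comm] using this
  · have := hf
    rw [LinearMap.pi_apply_eq_sum_univ f c] at this
    simpa [mul_comm] using this

open MvPolynomial in
lemma bezout (f g : MvPolynomial (Fin 3) ℂ) (hf : f.IsHomogeneous 3) (hg : g.IsHomogeneous 3)
    (hg0 : g ≠ 0) (hfg : IsRelPrime f g) (v : Fin 10 → Fin 3 → ℂ)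
    (hv : ∀ i j, i ≠ j → LinearIndependent ℂ ![v i, v j])
    (hvf : ∀ j, eval (v j) f = 0) (hvg : ∀ j, eval (v j) g = 0) : False := by
  let R := fun n => homogeneousSubmodule (Fin 3) ℂ n
  let Ψ : (R 6 × R 6) →ₗ[ℂ] MvPolynomial (Fin 3) ℂ :=
    (LinearMap.mulLeft ℂ f ∘ₗ (R 6).subtype).coprod (LinearMap.mulLeft ℂ g ∘ₗ (R 6).subtype)
  let Φ : R 3 →ₗ[ℂ] (R 6 × R 6) :=
    LinearMap.prod
      (LinearMap.codRestrict (R 6) (LinearMap.mulLeft ℂ g ∘ₗ (R 3).subtype)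
        (fun c => hg.mul c.2))
      (LinearMap.codRestrict (R 6) (-(LinearMap.mulLeft ℂ f ∘ₗ (R 3).subtype))
        (fun c => (hf.mul c.2).neg))
  let E : R 9 →ₗ[ℂ] (Fin 10 → ℂ) := LinearMap.pi fun j => (aeval (v j)).toLinearMap ∘ₗ (R 9).subtype
  have hE : Function.Surjective E := by
    rw [← LinearMap.range_eq_top, eq_top_iff, ← (Pi.basisFun ℂ (Fin 10)).span_eq,
      Submodule.span_le]
    rintro _ ⟨j, rfl⟩
    have hl : ∀ i, ∃ l : MvPolynomial (Fin 3) ℂ, i ≠ j →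
        (l.IsHomogeneous 1 ∧ eval (v i) l = 0 ∧ eval (v j) l ≠ 0) := fun i => by
      by_cases hij : i = j
      · exact ⟨0, fun h => absurd hij h⟩
      · obtain ⟨l, hl⟩ := exists_lin _ _ (hv i j hij)
        exact ⟨l, fun _ => hl⟩
    choose l hl using hl
    let P := ∏ i ∈ Finset.univ.erase j, l i
    have hP : P.IsHomogeneous 9 := by
      have := IsHomogeneous.prod (Finset.univ.erase j) l (fun _ => 1)
        (fun i hi => (hl i (Finset.ne_of_mem_erase hi)).1)
      simpa using this
    have hPj : eval (v j) P ≠ 0 := by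
      rw [eval_prod]
      exact Finset.prod_ne_zero_iff.mpr fun i hi => (hl i (Finset.ne_of_mem_erase hi)).2.2
    have hPi : ∀ i, i ≠ j → eval (v i) P = 0 := fun i hi => by
      rw [eval_prod]
      exact Finset.prod_eq_zero (Finset.mem_erase.mpr ⟨hi, Finset.mem_univ i⟩) (hl i hi).2.1
    refine ⟨(eval (v j) P)⁻¹ • ⟨P, hP⟩, ?_⟩
    rw [map_smul]
    ext i
    by_cases hi : i = j
    · subst hi
      simp [E, hPj, aeval_eq_eval]
    · simp [E, hPi i hi, hi, aeval_eq_eval]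
  have hkerE : Module.finrank ℂ (LinearMap.ker E) = 45 := by
    have h1 := LinearMap.finrank_range_add_finrank_ker E
    rw [LinearMap.range_eq_top.mpr hE, finrank_top, finrank_form] at h1
    simp [Nat.choose] at h1
    omega
  have hle : LinearMap.ker Ψ ≤ LinearMap.range Φ := by
    rintro ⟨⟨a, ha⟩, ⟨c, hc⟩⟩ hac
    have hac : f * a + g * c = 0 := by simpa [Ψ] using hac
    have hga : g ∣ f * a := ⟨-c, by linear_combination hac⟩
    obtain ⟨k, rfl⟩ := hfg.symm.dvd_of_dvd_mul_left hga
    have hc' : c = - (f * k) := by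
      have : g * (c + f * k) = 0 := by linear_combination hac
      rcases mul_eq_zero.mp this with h | h
      · exact absurd h hg0
      · linear_combination h
    have hk : k.IsHomogeneous 3 := by
      by_cases hk0 : k = 0
      · rw [hk0]; exact isHomogeneous_zero _ _ _
      have h6 := IsHomogeneous.totalDegree ha (mul_ne_zero hg0 hk0)
      rw [totalDegree_mul_of_isDomain hg0 hk0, hg.totalDegree hg0] at h6
      have h3 : k.totalDegree = 3 := by omega
      have := hc_mul g k 3 3 (hg.totalDegree hg0).le h3.le
      rw [homogeneousComponent_eq_self ha, homogeneousComponent_eq_self hg] at this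
      rw [mul_left_cancel₀ hg0 this]
      exact homogeneousComponent_isHomogeneous _ _
    refine ⟨⟨k, hk⟩, ?_⟩
    subst hc'
    rfl
  have hkerΨ : Module.finrank ℂ (LinearMap.ker Ψ) ≤ 10 := by
    refine (Submodule.finrank_mono hle).trans ((LinearMap.finrank_range_le Φ).trans ?_)
    rw [finrank_form]
    simp [Nat.choose]
  have hrangeΨ : 46 ≤ Module.finrank ℂ (LinearMap.range Ψ) := by
    have h1 := LinearMap.finrank_range_add_finrank_ker Ψ
    rw [Module.finrank_prod, finrank_form] at h1
    simp [Nat.choose] at h1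
    omega
  have hsub : LinearMap.range Ψ ≤ (LinearMap.ker E).map (R 9).subtype := by
    rintro _ ⟨⟨⟨a, ha⟩, ⟨c, hc⟩⟩, rfl⟩
    refine ⟨⟨f * a + g * c, (hf.mul ha).add (hg.mul hc)⟩, ?_, rfl⟩
    change E _ = 0
    ext j
    simp [E, aeval_eq_eval, hvf, hvg]
  have := (Submodule.finrank_mono hsub).trans (Submodule.finrank_map_le _ _)
  omega

open MvPolynomial in
lemma eval_smul_form {p : MvPolynomial (Fin 3) ℂ} {n : ℕ} (hp : p.IsHomogeneous n) (s : ℂ)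
    (x : Fin 3 → ℂ) : eval (s • x) p = s ^ n * eval x p := by
  rw [eval_eq, eval_eq, Finset.mul_sum]
  refine Finset.sum_congr rfl fun d hd => ?_
  have h : ∑ i ∈ d.support, d i = n := (hp.degree_eq_sum_deg_support hd).symm
  simp only [Pi.smul_apply, smul_eq_mul, mul_pow, Finset.prod_mul_distrib,
    Finset.prod_pow_eq_pow_sum, h]
  ring

open MvPolynomial in
/-- Restriction of a form to the affine line `t ↦ t u + w`. -/
def lineP (u w : Fin 3 → ℂ) (p : MvPolynomial (Fin 3) ℂ) : Polynomial ℂ :=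
  aeval (fun i => Polynomial.C (u i) * Polynomial.X + Polynomial.C (w i)) p

open MvPolynomial in
lemma eval_lineP (u w : Fin 3 → ℂ) (p : MvPolynomial (Fin 3) ℂ) (t : ℂ) :
    (lineP u w p).eval t = eval (t • u + w) p := by
  unfold lineP
  rw [← Polynomial.coe_evalRingHom, aeval_def, hom_eval₂]
  have : (Polynomial.evalRingHom t).comp (algebraMap ℂ (Polynomial ℂ)) = RingHom.id ℂ := by
    ext; simp
  rw [this, ← eval₂_id]
  congr 1
  ext i
  simp only [Polynomial.coe_evalRingHom, Polynomial.eval_add, Polynomial.eval_mul,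
    Polynomial.eval_C, Polynomial.eval_X, Pi.add_apply, Pi.smul_apply, smul_eq_mul]
  ring

open MvPolynomial in
lemma lineP_ne_C (u w : Fin 3 → ℂ) {p : MvPolynomial (Fin 3) ℂ} {n : ℕ} (hp : p.IsHomogeneous n)
    (hn : n ≠ 0) (hu : eval u p ≠ 0) (c : ℂ) : lineP u w p ≠ Polynomial.C c := by
  intro h
  have key : lineP w u p = Polynomial.C c * Polynomial.X ^ n := by
    apply Polynomial.eq_of_infinite_eval_eq
    refine Set.Infinite.mono (s := {0}ᶜ) ?_ (Set.finite_singleton (0 : ℂ)).infinite_compl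
    intro s hs
    have hs : s ≠ 0 := hs
    have h1 := eval_lineP u w p s⁻¹
    rw [h, Polynomial.eval_C] at h1
    have h2 : s • w + u = s • (s⁻¹ • u + w) := by
      rw [smul_add, smul_smul, mul_inv_cancel₀ hs, one_smul, add_comm]
    change (lineP w u p).eval s = _
    rw [eval_lineP, h2, eval_smul_form hp, ← h1, Polynomial.eval_mul, Polynomial.eval_C,
      Polynomial.eval_pow, Polynomial.eval_X, mul_comm]
  have := congrArg (Polynomial.eval 0) key
  rw [eval_lineP] at this
  simp [hn] at this
  exact hu this

open MvPolynomial in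
lemma exists_line_zero (u w : Fin 3 → ℂ) {p : MvPolynomial (Fin 3) ℂ} {n : ℕ}
    (hp : p.IsHomogeneous n) (hn : n ≠ 0) (hu : eval u p ≠ 0) :
    ∃ t : ℂ, eval (t • u + w) p = 0 := by
  have hdeg : (lineP u w p).degree ≠ 0 := by
    intro h
    exact lineP_ne_C u w hp hn hu _ (Polynomial.eq_C_of_degree_eq_zero h)
  obtain ⟨t, ht⟩ := IsAlgClosed.exists_root _ hdeg
  exact ⟨t, by rw [← eval_lineP]; exact ht⟩

open MvPolynomial in
lemma core (C : Fin 4 → MvPolynomial (Fin 3) ℂ) (hC : ∀ i, (C i).IsHomogeneous 3)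
    (lam : (Fin 3 → ℂ) →ₗ[ℂ] ℂ)
    (hlam : ∀ u, u ≠ 0 → (∀ i, eval u (C i) = 0) → lam u ≠ 0)
    (v : Fin 10 → Fin 3 → ℂ)
    (hv : ∀ i j, i ≠ j → LinearIndependent ℂ ![v i, v j])
    (hz : ∀ i j, eval (v j) (C i) = 0) : False := by
  have hk : 1 < Module.finrank ℂ (LinearMap.ker lam) := by
    have h1 := LinearMap.finrank_range_add_finrank_ker lam
    have h2 : Module.finrank ℂ (LinearMap.range lam) ≤ 1 := by
      simpa using Submodule.finrank_le (LinearMap.range lam)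
    simp at h1
    omega
  have : Nontrivial (LinearMap.ker lam) := Module.nontrivial_of_finrank_pos (R := ℂ) (by omega)
  obtain ⟨⟨u, hu⟩, hu0⟩ := exists_ne (0 : LinearMap.ker lam)
  obtain ⟨⟨w, hw⟩, huw⟩ := exists_linearIndependent_pair_of_one_lt_finrank hk hu0
  have hu0' : u ≠ 0 := fun h => hu0 (by ext1; exact h)
  have hu1 : lam u = 0 := hu
  have hw1 : lam w = 0 := hw
  have hne : ∀ t : ℂ, t • u + w ≠ 0 := by
    intro t ht
    have := LinearIndependent.pair_iff.mp huw t 1 (by ext1; simpa using ht)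
    simp at this
  obtain ⟨i, hi⟩ : ∃ i, eval u (C i) ≠ 0 := by
    by_contra! h
    exact hlam u hu0' h hu1
  have hex : ∀ t : ℂ, ∃ j, eval (t • u + w) (C j) ≠ 0 := by
    intro t
    by_contra! h
    exact hlam _ (hne t) h (by simp [hu1, hw1])
  let P := lineP u w (C i)
  have hP0 : P ≠ 0 := by
    simpa using lineP_ne_C u w (hC i) (by norm_num) hi 0
  let F : P.roots.toFinset → Module.Dual ℂ (Fin 4 → ℂ) := fun t =>
    ∑ j, eval (t.1 • u + w) (C j) • LinearMap.proj j
  obtain ⟨c, hc⟩ := Module.Dual.exists_forall_ne_zero_of_forall_exists F (by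
    intro t
    obtain ⟨j, hj⟩ := hex t.1
    refine ⟨Pi.single j 1, ?_⟩
    simpa [F, Pi.single_apply] using hj)
  let q : MvPolynomial (Fin 3) ℂ := ∑ j, MvPolynomial.C (c j) * C j
  have hq : q.IsHomogeneous 3 := IsHomogeneous.sum _ _ _ fun j _ => (hC j).C_mul _
  have hqt : ∀ t : ℂ, eval (t • u + w) (C i) = 0 → eval (t • u + w) q ≠ 0 := by
    intro t ht
    have hroot : t ∈ P.roots.toFinset := by
      rw [Multiset.mem_toFinset, Polynomial.mem_roots hP0]
      change P.eval t = 0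
      rw [eval_lineP, ht]
    have := hc ⟨t, hroot⟩
    simpa [F, q, mul_comm] using this
  have hCi0 : C i ≠ 0 := fun h => hi (by rw [h, map_zero])
  have hq0 : q ≠ 0 := by
    intro h
    obtain ⟨t, ht⟩ := exists_line_zero u w (hC i) (by norm_num) hi
    exact hqt t ht (by rw [h, map_zero])
  have hrel : IsRelPrime (C i) q := by
    intro d hd1 hd2
    by_contra hunit
    have hd0 : d ≠ 0 := fun h => hCi0 (by rw [h] at hd1; exact zero_dvd_iff.mp hd1)
    have hdeg : d.totalDegree ≠ 0 := by
      intro h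
      rw [totalDegree_eq_zero_iff_eq_C] at h
      apply hunit
      rw [h]
      refine IsUnit.map MvPolynomial.C (isUnit_iff_ne_zero.mpr fun h0 => hd0 ?_)
      rw [h, h0, map_zero]
    obtain ⟨e1, he1⟩ := top_dvd (hC i) hCi0 hd1
    obtain ⟨e2, he2⟩ := top_dvd hq hq0 hd2
    have hDu : eval u (homogeneousComponent d.totalDegree d) ≠ 0 := by
      intro h
      apply hi
      rw [he1, map_mul, h, zero_mul]
    obtain ⟨t, ht⟩ := exists_line_zero u w (homogeneousComponent_isHomogeneous _ d) hdeg hDu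
    refine hqt t ?_ ?_
    · rw [he1, map_mul, ht, zero_mul]
    · rw [he2, map_mul, ht, zero_mul]
  refine bezout (C i) q (hC i) hq hq0 hrel v hv (hz i) ?_
  intro j
  simp [q, hz]

open MvPolynomial in
lemma hasFDerivAt_eval (p : MvPolynomial (Fin 4) ℂ) (x : Fin 4 → ℂ) :
    HasFDerivAt (fun y : Fin 4 → ℂ => eval y p)
      (∑ j, eval x (pderiv j p) • (ContinuousLinearMap.proj j : (Fin 4 → ℂ) →L[ℂ] ℂ)) x := by
  induction p using MvPolynomial.induction_on with
  | C a =>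
    have h : HasFDerivAt (fun _ : Fin 4 → ℂ => a) (0 : (Fin 4 → ℂ) →L[ℂ] ℂ) x :=
      hasFDerivAt_const a x
    convert! h using 1
    · ext y; simp
    · ext k
      simp
  | add p q hp hq =>
    have h := hp.add hq
    convert! h using 1
    · ext y; simp
    · ext k
      simp [add_mul, Finset.sum_add_distrib]
  | mul_X p i hp =>
    have h1 : HasFDerivAt (fun y : Fin 4 → ℂ => y i)
      (ContinuousLinearMap.proj i : (Fin 4 → ℂ) →L[ℂ] ℂ) x := hasFDerivAt_apply i x
    have h2 := hp.mul h1
    simp only [map_mul, eval_X]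
    convert! h2 using 1
    ext k
    simp [pderiv_X, Pi.single_apply, Finset.sum_add_distrib, add_mul, Finset.mul_sum,
      mul_assoc, apply_ite, ite_mul]

open MvPolynomial in
/-- The restricted determinant as a polynomial. -/
def detP (b : Fin 4 → Matrix (Fin 4) (Fin 4) ℂ) : MvPolynomial (Fin 4) ℂ :=
  Matrix.det (Matrix.of fun r s => ∑ i, C (b i r s) * X i)

open MvPolynomial in
lemma detP_hom (b : Fin 4 → Matrix (Fin 4) (Fin 4) ℂ) : (detP b).IsHomogeneous 4 := by
  unfold detP
  rw [Matrix.det_apply']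
  refine IsHomogeneous.sum _ _ _ fun σ _ => ?_
  have h : (∏ i : Fin 4, (Matrix.of fun r s => ∑ i, C (b i r s) * X i :
      Matrix (Fin 4) (Fin 4) (MvPolynomial (Fin 4) ℂ)) (σ i) i).IsHomogeneous 4 := by
    have := IsHomogeneous.prod Finset.univ (fun i : Fin 4 =>
      (Matrix.of fun r s => ∑ i, C (b i r s) * X i :
        Matrix (Fin 4) (Fin 4) (MvPolynomial (Fin 4) ℂ)) (σ i) i) (fun _ => 1)
      (fun i _ => IsHomogeneous.sum Finset.univ (fun j => C (b j (σ i) i) * X j) 1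
        fun j _ => isHomogeneous_C_mul_X _ _)
    simpa using this
  have := h.C_mul ((Equiv.Perm.sign σ : ℤ) : ℂ)
  simpa using this

open MvPolynomial in
lemma detV_eq (b : Fin 4 → Matrix (Fin 4) (Fin 4) ℂ) : detV b = fun x => eval x (detP b) := by
  ext x
  unfold detV detP mat
  rw [RingHom.map_det]
  congr 1
  ext r s
  simp [Matrix.sum_apply, mul_comm]

open MvPolynomial in
lemma isSingRep_iff (b : Fin 4 → Matrix (Fin 4) (Fin 4) ℂ) (x : Fin 4 → ℂ) :
    IsSingRep b x ↔ x ≠ 0 ∧ ∀ i, eval x (pderiv i (detP b)) = 0 := by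
  unfold IsSingRep
  rw [detV_eq, (hasFDerivAt_eval (detP b) x).fderiv]
  simp [Pi.single_apply]

/-- A transversal linear determinantal quartic whose singular points are exactly the classes
of rank-`2` matrices in `V` has four singular points with linearly independent
representatives, i.e. a quadruple of non-coplanar singular points. -/
theorem exists_four_noncoplanar_singular_points
    (b : Fin 4 → Matrix (Fin 4) (Fin 4) ℂ)
    (hli : LinearIndependent ℂ b) (hsym : ∀ i, (b i).IsSymm)
    (hdet : ∃ x, detV b x ≠ 0)
    -- (i): exactly ten singular points, all of them nodes
    (h_ten : (singPoints b).Finite ∧ (singPoints b).ncard = 10)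
    (h_nodes : ∀ x : Fin 4 → ℂ, IsSingRep b x → (hessV b x).rank = 3)
    -- (ii): singular points are exactly the classes of matrices of rank at most 2,
    -- and each such matrix has rank exactly 2
    (h_rank_iff : ∀ x : Fin 4 → ℂ, x ≠ 0 → (IsSingRep b x ↔ (mat b x).rank ≤ 2))
    (h_rank_eq : ∀ x : Fin 4 → ℂ, x ≠ 0 → IsSingRep b x → (mat b x).rank = 2) :
    ∃ v : Fin 4 → (Fin 4 → ℂ), LinearIndependent ℂ v ∧ ∀ j, IsSingRep b (v j) := by
  by_contra hcon
  have hspan : Submodule.span ℂ {x | IsSingRep b x} < ⊤ := by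
    rw [lt_top_iff_ne_top]
    intro htop
    obtain ⟨f, hf1, hf2, hf3⟩ := Submodule.exists_fun_fin_finrank_span_eq ℂ {x | IsSingRep b x}
    have h4 : Module.finrank ℂ (Submodule.span ℂ {x | IsSingRep b x}) = 4 := by
      rw [htop]; simp
    refine hcon ⟨f ∘ Fin.cast h4.symm, hf3.comp _ (Fin.cast_injective _), fun j => hf1 _⟩
  obtain ⟨mu, hmu0, hmu⟩ := Submodule.exists_le_ker_of_lt_top _ hspan
  have hfr : Module.finrank ℂ (Fin 3 → ℂ) = Module.finrank ℂ (LinearMap.ker mu) := by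
    have := Module.Dual.finrank_ker_add_one_of_ne_zero hmu0
    simp at this ⊢
    omega
  let phiE := LinearEquiv.ofFinrankEq _ _ hfr
  let φ : (Fin 3 → ℂ) →ₗ[ℂ] (Fin 4 → ℂ) := (LinearMap.ker mu).subtype ∘ₗ phiE.toLinearMap
  have hφ : Function.Injective φ := (Submodule.injective_subtype _).comp phiE.injective
  let L : Fin 4 → MvPolynomial (Fin 3) ℂ := fun k =>
    ∑ j, MvPolynomial.C (φ (fun l => if j = l then 1 else 0) k) * MvPolynomial.X j
  have hL : ∀ k u, MvPolynomial.eval u (L k) = φ u k := by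
    intro k u
    conv_rhs => rw [LinearMap.pi_apply_eq_sum_univ φ u]
    simp [L, mul_comm]
  let Q : Fin 4 → MvPolynomial (Fin 3) ℂ := fun i =>
    MvPolynomial.aeval L (MvPolynomial.pderiv i (detP b))
  have hQe : ∀ i u, MvPolynomial.eval u (Q i) =
      MvPolynomial.eval (φ u) (MvPolynomial.pderiv i (detP b)) := by
    intro i u
    simp only [Q, MvPolynomial.aeval_def, MvPolynomial.hom_eval₂]
    have : (MvPolynomial.eval u).comp (algebraMap ℂ (MvPolynomial (Fin 3) ℂ)) = RingHom.id ℂ := by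
      ext; simp
    rw [this, ← MvPolynomial.eval₂_id]
    congr 1
    ext k
    exact hL k u
  have hQ : ∀ i, (Q i).IsHomogeneous 3 := by
    intro i
    have := (detP_hom b).pderiv (i := i) |>.aeval L (n := 1)
      (fun k => MvPolynomial.IsHomogeneous.sum _ _ _ fun j _ =>
        MvPolynomial.isHomogeneous_C_mul_X _ _)
    exact this
  obtain ⟨hfin, hcard⟩ := h_ten
  have : Finite (singPoints b) := hfin
  obtain ⟨lam, hlam⟩ := Module.exists_dual_forall_apply_ne_zero (K := ℂ)
    (fun p : singPoints b => p.1.rep) (fun p => p.1.rep_nonzero)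
  have e : Fin 10 ≃ singPoints b := by
    refine (Finite.equivFinOfCardEq ?_).symm
    rw [Nat.card_coe_set_eq, hcard]
  have hrep : ∀ j : Fin 10, ∃ u : Fin 3 → ℂ, ∃ hu : φ u ≠ 0,
      (e j).1 = Projectivization.mk ℂ (φ u) hu ∧ IsSingRep b (φ u) := by
    intro j
    obtain ⟨x, hx, hp, hs⟩ := (e j).2
    have hxk : x ∈ LinearMap.ker mu := hmu (Submodule.subset_span hs)
    have hφx : φ (phiE.symm ⟨x, hxk⟩) = x := by simp [φ]
    refine ⟨phiE.symm ⟨x, hxk⟩, by rw [hφx]; exact hx, ?_, by rw [hφx]; exact hs⟩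
    rw [hp]
    congr 1
    exact hφx.symm
  choose v hv0 hv hvs using hrep
  refine core Q hQ (lam ∘ₗ φ) ?_ v ?_ ?_
  · intro u hu hz hl
    have hφu : φ u ≠ 0 := fun h => hu (hφ (by rw [h, map_zero]))
    have hs : IsSingRep b (φ u) := (isSingRep_iff b _).mpr ⟨hφu, fun i => by rw [← hQe, hz]⟩
    let p : singPoints b := ⟨Projectivization.mk ℂ (φ u) hφu, φ u, hφu, rfl, hs⟩
    obtain ⟨a, ha⟩ := Projectivization.exists_smul_eq_mk_rep ℂ (φ u) hφu
    have h1 := hlam p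
    apply h1
    change lam (Projectivization.mk ℂ (φ u) hφu).rep = 0
    rw [← ha]
    have hl : lam (φ u) = 0 := hl
    rw [Units.smul_def, map_smul, hl, smul_zero]
  · intro i j hij
    have hvi : v i ≠ 0 := fun h => hv0 i (by rw [h, map_zero])
    rw [LinearIndependent.pair_iff' hvi]
    intro a ha
    apply hij
    apply e.injective
    apply Subtype.ext
    rw [hv i, hv j]
    symm
    rw [Projectivization.mk_eq_mk_iff']
    exact ⟨a, by rw [← ha, map_smul]⟩
  · intro i j
    rw [hQe]
    exact ((isSingRep_iff b _).mp (hvs j)).2 i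

end DetLinearSystem
end
end

section
/- Let V ⊆ Sym₄(ℂ) be a 4-dimensional linear subspace satisfying assumptions (i) and (ii). Then every 3-dimensional linear subspace W ⊆ V contains representatives of at most six singular points of Δ_V; equivalently, no plane in ℙ(V) contains seven or more singular points of Δ_V. -/
open Matrix
open scoped LinearAlgebra.Projectivization

noncomputable section

namespace DetLinearSystem

set_option linter.unusedSectionVars false

/-- Forms of degree `n`: span of products of `n` linear functionals. -/
def PF (E : Type*) [AddCommGroup E] [Module ℂ E] (n : ℕ) : Submodule ℂ (E → ℂ) :=
  Submodule.span ℂ (Set.range fun (l : Fin n → Module.Dual ℂ E) (v : E) => ∏ i, l i v)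

/-- explicit ternary cubic -/
def q3 (c : Fin 10 → ℂ) (x y z : ℂ) : ℂ :=
  c 0 * x^3 + c 1 * x^2*y + c 2 * x^2*z + c 3 * x*y^2 + c 4 * x*y*z + c 5 * x*z^2 + c 6 * y^3
    + c 7 * y^2*z + c 8 * y*z^2 + c 9 * z^3

/-- explicit ternary quartic -/
def q4 (a : Fin 15 → ℂ) (x y z : ℂ) : ℂ :=
  a 0 * x^4 + a 1 * x^3*y + a 2 * x^3*z + a 3 * x^2*y^2 + a 4 * x^2*y*z + a 5 * x^2*z^2
    + a 6 * x*y^3 + a 7 * x*y^2*z + a 8 * x*y*z^2 + a 9 * x*z^3 + a 10 * y^4 + a 11 * y^3*z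
    + a 12 * y^2*z^2 + a 13 * y*z^3 + a 14 * z^4

section forms

variable {E : Type*} [NormedAddCommGroup E] [NormedSpace ℂ E] [FiniteDimensional ℂ E]

lemma lin_exp (B : Module.Basis (Fin 3) ℂ E) (l : Module.Dual ℂ E) (v : E) :
    l v = l (B 0) * B.coord 0 v + l (B 1) * B.coord 1 v + l (B 2) * B.coord 2 v := by
  conv_lhs => rw [← B.sum_repr v]
  simp only [Fin.sum_univ_three, map_add, map_smul, smul_eq_mul, Module.Basis.coord_apply]
  ring

lemma exp3 (B : Module.Basis (Fin 3) ℂ E) {C : E → ℂ} (hC : C ∈ PF E 3) :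
    ∃ c, ∀ v, C v = q3 c (B.coord 0 v) (B.coord 1 v) (B.coord 2 v) := by
  refine Submodule.span_induction ?_ ?_ ?_ ?_ hC
  · rintro _ ⟨l, rfl⟩
    have h : ∀ α β γ α' β' γ' α'' β'' γ'' : ℂ, ∃ c, ∀ x y z : ℂ, (α*x+β*y+γ*z)*(α'*x+β'*y+γ'*z)*
        (α''*x+β''*y+γ''*z) = q3 c x y z := by
      intro α β γ α' β' γ' α'' β'' γ''
      refine ⟨![α*α'*α'', α*α'*β''+α*β'*α''+β*α'*α'', α*α'*γ''+α*γ'*α''+γ*α'*α'',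
        α*β'*β''+β*α'*β''+β*β'*α'',
        α*β'*γ''+α*γ'*β''+β*α'*γ''+β*γ'*α''+γ*α'*β''+γ*β'*α'',
        α*γ'*γ''+γ*α'*γ''+γ*γ'*α'', β*β'*β'', β*β'*γ''+β*γ'*β''+γ*β'*β'',
        β*γ'*γ''+γ*β'*γ''+γ*γ'*β'', γ*γ'*γ''], ?_⟩
      intro x y z
      simp [q3]
      ring
    obtain ⟨c, hc⟩ := h (l 0 (B 0)) (l 0 (B 1)) (l 0 (B 2)) (l 1 (B 0)) (l 1 (B 1)) (l 1 (B 2))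
      (l 2 (B 0)) (l 2 (B 1)) (l 2 (B 2))
    refine ⟨c, fun v => ?_⟩
    rw [← hc]
    simp only [Fin.prod_univ_three, ← lin_exp B]
  · exact ⟨0, fun v => by simp [q3]⟩
  · rintro f g _ _ ⟨c, hc⟩ ⟨d, hd⟩
    refine ⟨c + d, fun v => ?_⟩
    simp only [Pi.add_apply, hc, hd, q3]
    ring
  · rintro r f _ ⟨c, hc⟩
    refine ⟨r • c, fun v => ?_⟩
    simp only [Pi.smul_apply, smul_eq_mul, hc, q3]
    ring

lemma exp4 (B : Module.Basis (Fin 3) ℂ E) {F : E → ℂ} (hF : F ∈ PF E 4) :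
    ∃ a, ∀ v, F v = q4 a (B.coord 0 v) (B.coord 1 v) (B.coord 2 v) := by
  refine Submodule.span_induction ?_ ?_ ?_ ?_ hF
  · rintro _ ⟨l, rfl⟩
    have h : ∀ (α β γ : ℂ) (c : Fin 10 → ℂ), ∃ a, ∀ x y z : ℂ, q3 c x y z * (α*x+β*y+γ*z)
         = q4 a x y z := by
      intro α β γ c
      refine ⟨![c 0*α, c 0*β+c 1*α, c 0*γ+c 2*α, c 1*β+c 3*α, c 1*γ+c 2*β+c 4*α, c 2*γ+c 5*α,
        c 3*β+c 6*α, c 3*γ+c 4*β+c 7*α, c 4*γ+c 5*β+c 8*α, c 5*γ+c 9*α, c 6*β, c 6*γ+c 7*β,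
        c 7*γ+c 8*β, c 8*γ+c 9*β, c 9*γ], ?_⟩
      intro x y z
      simp [q3, q4]
      ring
    obtain ⟨c, hc⟩ := exp3 B (C := fun v => ∏ i : Fin 3, l i.castSucc v)
      (Submodule.subset_span ⟨fun i => l i.castSucc, rfl⟩)
    obtain ⟨a, ha⟩ := h (l (Fin.last 3) (B 0)) (l (Fin.last 3) (B 1)) (l (Fin.last 3) (B 2)) c
    refine ⟨a, fun v => ?_⟩
    rw [← ha, ← hc, ← lin_exp B]
    exact Fin.prod_univ_castSucc (n := 3) _
  · exact ⟨0, fun v => by simp [q4]⟩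
  · rintro f g _ _ ⟨c, hc⟩ ⟨d, hd⟩
    refine ⟨c + d, fun v => ?_⟩
    simp only [Pi.add_apply, hc, hd, q4]
    ring
  · rintro r f _ ⟨c, hc⟩
    refine ⟨r • c, fun v => ?_⟩
    simp only [Pi.smul_apply, smul_eq_mul, hc, q4]
    ring

lemma q3_mem (B : Module.Basis (Fin 3) ℂ E) (c : Fin 10 → ℂ) :
    (fun v => q3 c (B.coord 0 v) (B.coord 1 v) (B.coord 2 v)) ∈ PF E 3 := by
  have h : ∀ i j k : Fin 3, (fun v => B.coord i v * B.coord j v * B.coord k v) ∈ PF E 3 := by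
    intro i j k
    refine Submodule.subset_span ⟨![B.coord i, B.coord j, B.coord k], ?_⟩
    funext v
    simp [Fin.prod_univ_three]
  have key : (fun v => q3 c (B.coord 0 v) (B.coord 1 v) (B.coord 2 v)) =
    c 0 • (fun v => B.coord 0 v * B.coord 0 v * B.coord 0 v)
    + c 1 • (fun v => B.coord 0 v * B.coord 0 v * B.coord 1 v)
    + c 2 • (fun v => B.coord 0 v * B.coord 0 v * B.coord 2 v)
    + c 3 • (fun v => B.coord 0 v * B.coord 1 v * B.coord 1 v)
    + c 4 • (fun v => B.coord 0 v * B.coord 1 v * B.coord 2 v)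
    + c 5 • (fun v => B.coord 0 v * B.coord 2 v * B.coord 2 v)
    + c 6 • (fun v => B.coord 1 v * B.coord 1 v * B.coord 1 v)
    + c 7 • (fun v => B.coord 1 v * B.coord 1 v * B.coord 2 v)
    + c 8 • (fun v => B.coord 1 v * B.coord 2 v * B.coord 2 v)
    + c 9 • (fun v => B.coord 2 v * B.coord 2 v * B.coord 2 v) := by
    funext v
    simp only [q3, Pi.add_apply, Pi.smul_apply, smul_eq_mul]
    ring
  rw [key]
  have hs : ∀ (r : ℂ) (i j k : Fin 3),
    r • (fun v => B.coord i v * B.coord j v * B.coord k v) ∈ PF E 3 :=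
    fun r i j k => Submodule.smul_mem _ _ (h i j k)
  repeat' apply Submodule.add_mem
  all_goals apply hs

lemma coord_hasFDerivAt (B : Module.Basis (Fin 3) ℂ E) (i : Fin 3) (p : E) :
    HasFDerivAt (fun v => B.coord i v) (LinearMap.toContinuousLinearMap (B.coord i)) p :=
  (LinearMap.toContinuousLinearMap (B.coord i)).hasFDerivAt

lemma mono_hasFDerivAt (B : Module.Basis (Fin 3) ℂ E) (p : E) (c : ℂ) (i j k : ℕ) :
    ∃ L : E →L[ℂ] ℂ, HasFDerivAt
      (fun v => c * (B.coord 0 v)^i * (B.coord 1 v)^j * (B.coord 2 v)^k) L p ∧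
      ∀ v, L v = c * (i * (B.coord 0 p)^(i-1)) * (B.coord 1 p)^j * (B.coord 2 p)^k * B.coord 0 v
        + c * (B.coord 0 p)^i * (j * (B.coord 1 p)^(j-1)) * (B.coord 2 p)^k * B.coord 1 v
        + c * (B.coord 0 p)^i * (B.coord 1 p)^j * (k * (B.coord 2 p)^(k-1)) * B.coord 2 v := by
  refine ⟨_, ((((coord_hasFDerivAt B 0 p).pow i).const_mul c).mul
    ((coord_hasFDerivAt B 1 p).pow j)).mul ((coord_hasFDerivAt B 2 p).pow k), ?_⟩
  intro v
  simp
  ring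

lemma grad4 (B : Module.Basis (Fin 3) ℂ E) (a : Fin 15 → ℂ) {F : E → ℂ} (p : E)
    (hF : ∀ v, F v = q4 a (B.coord 0 v) (B.coord 1 v) (B.coord 2 v)) (x y z : ℂ)
    (hx : B.coord 0 p = x) (hy : B.coord 1 p = y) (hz : B.coord 2 p = z) :
    HasFDerivAt F (0 : E →L[ℂ] ℂ) p ↔
      4 * a 0 * x^3 + 3 * a 1 * x^2*y + 3 * a 2 * x^2*z + 2 * a 3 * x*y^2 + 2 * a 4 * x*y*z
        + 2 * a 5 * x*z^2 + a 6 * y^3 + a 7 * y^2*z + a 8 * y*z^2 + a 9 * z^3 = 0 ∧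
      a 1 * x^3 + 2 * a 3 * x^2*y + a 4 * x^2*z + 3 * a 6 * x*y^2 + 2 * a 7 * x*y*z
        + a 8 * x*z^2 + 4 * a 10 * y^3 + 3 * a 11 * y^2*z + 2 * a 12 * y*z^2 + a 13 * z^3 = 0 ∧
      a 2 * x^3 + a 4 * x^2*y + 2 * a 5 * x^2*z + a 7 * x*y^2 + 2 * a 8 * x*y*z
        + 3 * a 9 * x*z^2 + a 11 * y^3 + 2 * a 12 * y^2*z + 3 * a 13 * y*z^2
        + 4 * a 14 * z^3 = 0 := by
  obtain ⟨L0, h0, e0⟩ := mono_hasFDerivAt B p (a 0) 4 0 0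
  obtain ⟨L1, h1, e1⟩ := mono_hasFDerivAt B p (a 1) 3 1 0
  obtain ⟨L2, h2, e2⟩ := mono_hasFDerivAt B p (a 2) 3 0 1
  obtain ⟨L3, h3, e3⟩ := mono_hasFDerivAt B p (a 3) 2 2 0
  obtain ⟨L4, h4, e4⟩ := mono_hasFDerivAt B p (a 4) 2 1 1
  obtain ⟨L5, h5, e5⟩ := mono_hasFDerivAt B p (a 5) 2 0 2
  obtain ⟨L6, h6, e6⟩ := mono_hasFDerivAt B p (a 6) 1 3 0
  obtain ⟨L7, h7, e7⟩ := mono_hasFDerivAt B p (a 7) 1 2 1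
  obtain ⟨L8, h8, e8⟩ := mono_hasFDerivAt B p (a 8) 1 1 2
  obtain ⟨L9, h9, e9⟩ := mono_hasFDerivAt B p (a 9) 1 0 3
  obtain ⟨L10, h10, e10⟩ := mono_hasFDerivAt B p (a 10) 0 4 0
  obtain ⟨L11, h11, e11⟩ := mono_hasFDerivAt B p (a 11) 0 3 1
  obtain ⟨L12, h12, e12⟩ := mono_hasFDerivAt B p (a 12) 0 2 2
  obtain ⟨L13, h13, e13⟩ := mono_hasFDerivAt B p (a 13) 0 1 3
  obtain ⟨L14, h14, e14⟩ := mono_hasFDerivAt B p (a 14) 0 0 4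
  have H := ((((((((((((((h0.add h1).add h2).add h3).add h4).add h5).add h6).add h7).add h8).add
    h9).add h10).add h11).add h12).add h13).add h14)
  set L := L0 + L1 + L2 + L3 + L4 + L5 + L6 + L7 + L8 + L9 + L10 + L11 + L12 + L13 + L14 with hL
  have H' : HasFDerivAt F L p := by
    refine H.congr_of_eventuallyEq (Filter.Eventually.of_forall fun v => ?_)
    simp only [hF, q4, Pi.add_apply]
    ring
  have hLv : ∀ v, L v = _ := fun v => by
    simp only [hL, _root_.add_apply, e0, e1, e2, e3, e4, e5, e6, e7, e8, e9, e10,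
      e11, e12, e13, e14, hx, hy, hz]
    exact rfl
  clear_value L
  have hiff : HasFDerivAt F (0 : E →L[ℂ] ℂ) p ↔ L = 0 :=
    ⟨fun h => H'.unique h, fun h => h ▸ H'⟩
  rw [hiff]
  constructor
  · intro h
    have t0 := hLv (B 0)
    have t1 := hLv (B 1)
    have t2 := hLv (B 2)
    simp [h] at t0 t1 t2
    refine ⟨?_, ?_, ?_⟩
    · linear_combination -t0
    · linear_combination -t1
    · linear_combination -t2
  · rintro ⟨h0, h1, h2⟩
    ext v
    rw [hLv]
    simp
    linear_combination B.repr v 0 * h0 + B.repr v 1 * h1 + B.repr v 2 * h2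

lemma grad3 (B : Module.Basis (Fin 3) ℂ E) (a : Fin 10 → ℂ) {F : E → ℂ} (p : E)
    (hF : ∀ v, F v = q3 a (B.coord 0 v) (B.coord 1 v) (B.coord 2 v)) (x y z : ℂ)
    (hx : B.coord 0 p = x) (hy : B.coord 1 p = y) (hz : B.coord 2 p = z)
    (hs : HasFDerivAt F (0 : E →L[ℂ] ℂ) p) :
      3 * a 0 * x^2 + 2 * a 1 * x*y + 2 * a 2 * x*z + a 3 * y^2 + a 4 * y*z + a 5 * z^2 = 0 ∧
      a 1 * x^2 + 2 * a 3 * x*y + a 4 * x*z + 3 * a 6 * y^2 + 2 * a 7 * y*z + a 8 * z^2 = 0 ∧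
      a 2 * x^2 + a 4 * x*y + 2 * a 5 * x*z + a 7 * y^2 + 2 * a 8 * y*z + 3 * a 9 * z^2 = 0 := by
  obtain ⟨L0, h0, e0⟩ := mono_hasFDerivAt B p (a 0) 3 0 0
  obtain ⟨L1, h1, e1⟩ := mono_hasFDerivAt B p (a 1) 2 1 0
  obtain ⟨L2, h2, e2⟩ := mono_hasFDerivAt B p (a 2) 2 0 1
  obtain ⟨L3, h3, e3⟩ := mono_hasFDerivAt B p (a 3) 1 2 0
  obtain ⟨L4, h4, e4⟩ := mono_hasFDerivAt B p (a 4) 1 1 1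
  obtain ⟨L5, h5, e5⟩ := mono_hasFDerivAt B p (a 5) 1 0 2
  obtain ⟨L6, h6, e6⟩ := mono_hasFDerivAt B p (a 6) 0 3 0
  obtain ⟨L7, h7, e7⟩ := mono_hasFDerivAt B p (a 7) 0 2 1
  obtain ⟨L8, h8, e8⟩ := mono_hasFDerivAt B p (a 8) 0 1 2
  obtain ⟨L9, h9, e9⟩ := mono_hasFDerivAt B p (a 9) 0 0 3
  have H := (((((((((h0.add h1).add h2).add h3).add h4).add h5).add h6).add h7).add h8).add h9)
  set L := L0 + L1 + L2 + L3 + L4 + L5 + L6 + L7 + L8 + L9 with hL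
  have H' : HasFDerivAt F L p := by
    refine H.congr_of_eventuallyEq (Filter.Eventually.of_forall fun v => ?_)
    simp only [hF, q3, Pi.add_apply]
    ring
  have hLv : ∀ v, L v = _ := fun v => by
    simp only [hL, _root_.add_apply, e0, e1, e2, e3, e4, e5, e6, e7, e8, e9,
      hx, hy, hz]
    exact rfl
  clear_value L
  have h : L = 0 := H'.unique hs
  have t0 := hLv (B 0)
  have t1 := hLv (B 1)
  have t2 := hLv (B 2)
  simp [h] at t0 t1 t2
  refine ⟨?_, ?_, ?_⟩
  · linear_combination -t0
  · linear_combination -t1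
  · linear_combination -t2

/-- non-proportionality -/
def NP (a b : E) : Prop := LinearIndependent ℂ ![a, b]

/-- the points of the plane which are singular on the threefold -/
def Sg (F C : E → ℂ) : Set E := {p | p ≠ 0 ∧ HasFDerivAt F (0 : E →L[ℂ] ℂ) p ∧ C p = 0}

/-- there is no infinite family of pairwise non-proportional elements -/
def NoInf (S : Set E) : Prop := ∀ I : Set ℂ, I.Infinite → ∀ γ : ℂ → E, (∀ t ∈ I, γ t ∈ S) →
  ¬ (∀ s ∈ I, ∀ t ∈ I, s ≠ t → NP (γ s) (γ t))

lemma NP.symm {a b : E} (h : NP a b) : NP b a := by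
  unfold NP at *
  rw [LinearIndependent.pair_iff] at *
  intro s t hst
  have := h t s (by rw [add_comm]; exact hst)
  exact ⟨this.2, this.1⟩

lemma coord_ext (B : Module.Basis (Fin 3) ℂ E) {u v : E} (h0 : B.coord 0 u = B.coord 0 v)
    (h1 : B.coord 1 u = B.coord 1 v) (h2 : B.coord 2 u = B.coord 2 v) : u = v := by
  apply B.ext_elem
  intro i
  fin_cases i
  · exact h0
  · exact h1
  · exact h2

lemma np_iff (B : Module.Basis (Fin 3) ℂ E) (a b : E) : NP a b ↔
    ¬ (B.coord 0 a * B.coord 1 b - B.coord 1 a * B.coord 0 b = 0 ∧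
      B.coord 0 a * B.coord 2 b - B.coord 2 a * B.coord 0 b = 0 ∧
      B.coord 1 a * B.coord 2 b - B.coord 2 a * B.coord 1 b = 0) := by
  constructor
  · rintro h ⟨h1, h2, h3⟩
    have ha : a ≠ 0 := by
      have := h.ne_zero 0
      simpa using this
    unfold NP at h
    rw [LinearIndependent.pair_iff] at h
    apply ha
    apply coord_ext B
    · have := (h (B.coord 0 b) (-B.coord 0 a) (by
        apply coord_ext B <;> simp only [map_add, map_smul, smul_eq_mul, map_zero]
        · linear_combination 0 * h1
        · linear_combination -h1
        · linear_combination -h2)).2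
      simpa using this
    · have := (h (B.coord 1 b) (-B.coord 1 a) (by
        apply coord_ext B <;> simp only [map_add, map_smul, smul_eq_mul, map_zero]
        · linear_combination h1
        · linear_combination 0 * h1
        · linear_combination -h3)).2
      simpa using this
    · have := (h (B.coord 2 b) (-B.coord 2 a) (by
        apply coord_ext B <;> simp only [map_add, map_smul, smul_eq_mul, map_zero]
        · linear_combination h2
        · linear_combination h3
        · linear_combination 0 * h1)).2
      simpa using this
  · intro h
    unfold NP
    rw [LinearIndependent.pair_iff]
    intro s t hst
    have e0 := congrArg (B.coord 0) hst
    have e1 := congrArg (B.coord 1) hst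
    have e2 := congrArg (B.coord 2) hst
    simp only [map_add, map_smul, smul_eq_mul, map_zero] at e0 e1 e2
    by_contra hc
    apply h
    have : s ≠ 0 ∨ t ≠ 0 := by
      by_contra h'; push Not at h'; exact hc h'
    rcases this with hs | ht
    · refine ⟨?_, ?_, ?_⟩ <;> apply mul_left_cancel₀ hs
      · linear_combination B.coord 1 b * e0 - B.coord 0 b * e1
      · linear_combination B.coord 2 b * e0 - B.coord 0 b * e2
      · linear_combination B.coord 2 b * e1 - B.coord 1 b * e2
    · refine ⟨?_, ?_, ?_⟩ <;> apply mul_left_cancel₀ ht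
      · linear_combination B.coord 0 a * e1 - B.coord 1 a * e0
      · linear_combination B.coord 0 a * e2 - B.coord 2 a * e0
      · linear_combination B.coord 1 a * e2 - B.coord 2 a * e1

lemma ex_basis (hE : Module.finrank ℂ E = 3) {a b c : E} (hab : NP a b)
    (hc : c ∉ Submodule.span ℂ {a, b}) :
    ∃ B : Module.Basis (Fin 3) ℂ E, B 0 = a ∧ B 1 = b ∧ B 2 = c := by
  have h : LinearIndependent ℂ ![a, b, c] := by
    have := linearIndependent_finSnoc.2 ⟨hab, (by simpa [Set.pair_comm b a] using hc :
      c ∉ Submodule.span ℂ (Set.range ![a, b]))⟩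
    have e : (Fin.snoc ![a, b] c : Fin 3 → E) = ![a, b, c] := by
      funext i
      fin_cases i <;> rfl
    rw [← e]
    exact this
  refine ⟨basisOfLinearIndependentOfCardEqFinrank h (by simp [hE]), ?_, ?_, ?_⟩ <;> simp

lemma ex_third (hE : Module.finrank ℂ E = 3) {a b : E} (hab : NP a b) :
    ∃ c, c ∉ Submodule.span ℂ {a, b} := by
  obtain ⟨c, hc⟩ := exists_linearIndependent_snoc_of_lt_finrank hab (by omega)
  refine ⟨c, ?_⟩
  have := (linearIndependent_finSnoc.1 hc).2
  simpa [Set.pair_comm b a] using this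

lemma mem_span_iff (B : Module.Basis (Fin 3) ℂ E) (v : E) :
    v ∈ Submodule.span ℂ {B 0, B 1} ↔ B.coord 2 v = 0 := by
  rw [Submodule.mem_span_pair]
  constructor
  · rintro ⟨s, t, rfl⟩
    simp
  · intro h
    refine ⟨B.coord 0 v, B.coord 1 v, ?_⟩
    apply coord_ext B
    · simp
    · simp
    · simpa using h.symm

lemma no_zero (hE : Module.finrank ℂ E = 3) {F C : E → ℂ} (hC : C ∈ PF E 3)
    (hinf : NoInf (Sg F C)) (hF : ∀ v, F v = 0) : False := by
  have hF' : ∀ p, HasFDerivAt F (0 : E →L[ℂ] ℂ) p := by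
    intro p
    have : F = fun _ => 0 := funext hF
    rw [this]
    exact hasFDerivAt_const _ _
  by_cases hz : ∀ v, C v = 0
  · have B : Module.Basis (Fin 3) ℂ E := (Module.finBasisOfFinrankEq ℂ E hE)
    refine hinf Set.univ Set.infinite_univ (fun t => B 0 + t • B 1) ?_ ?_
    · intro t _
      refine ⟨?_, hF' _, hz _⟩
      intro h
      have := congrArg (B.coord 0) h
      simp at this
    · intro s _ t _ hst
      rw [np_iff B]
      rintro ⟨h, -, -⟩
      simp at h
      exact hst (by linear_combination -h)
  · push Not at hz
    obtain ⟨q, hq⟩ := hz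
    have hB : ∃ B : Module.Basis (Fin 3) ℂ E, B 0 = q := by
      have hq0 : q ≠ 0 := by
        rintro rfl
        obtain ⟨c, hc⟩ := exp3 (Module.finBasisOfFinrankEq ℂ E hE) hC
        apply hq
        rw [hc]
        simp [q3]
      obtain ⟨w, hw⟩ := exists_linearIndependent_pair_of_one_lt_finrank (R := ℂ)
        (by omega) hq0
      obtain ⟨c, hc⟩ := ex_third hE hw
      obtain ⟨B, h0, -, -⟩ := ex_basis hE hw hc
      exact ⟨B, h0⟩
    obtain ⟨B, rfl⟩ := hB
    obtain ⟨c, hc⟩ := exp3 B hC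
    have hc0 : c 0 ≠ 0 := by
      intro h
      apply hq
      rw [hc]
      simp [q3, h]
    have hroot : ∀ t : ℂ, ∃ s : ℂ, q3 c s 1 t = 0 := by
      intro t
      obtain ⟨s, hs⟩ := IsAlgClosed.exists_root
        (Polynomial.C (c 0) * Polynomial.X ^ 3 + Polynomial.C (c 1 + c 2 * t) * Polynomial.X ^ 2
          + Polynomial.C (c 3 + c 4 * t + c 5 * t^2) * Polynomial.X
          + Polynomial.C (c 6 + c 7 * t + c 8 * t^2 + c 9 * t^3)) (by
            rw [Polynomial.degree_cubic hc0]; norm_num)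
      refine ⟨s, ?_⟩
      simp only [Polynomial.IsRoot, Polynomial.eval_add, Polynomial.eval_mul, Polynomial.eval_C,
        Polynomial.eval_pow, Polynomial.eval_X] at hs
      unfold q3
      linear_combination hs
    choose σ hσ using hroot
    refine hinf Set.univ Set.infinite_univ (fun t => σ t • B 0 + B 1 + t • B 2) ?_ ?_
    · intro t _
      refine ⟨?_, hF' _, ?_⟩
      · intro h
        have := congrArg (B.coord 1) h
        simp at this
      · rw [hc, ← hσ t]
        simp
    · intro s _ t _ hst
      rw [np_iff B]
      rintro ⟨-, -, h⟩
      simp at h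
      exact hst (by linear_combination -h)

/-- three collinear points -/
lemma three_col (hE : Module.finrank ℂ E = 3) {F C : E → ℂ} (hF : F ∈ PF E 4) (hC : C ∈ PF E 3)
    {a b c : E} (ha : a ∈ Sg F C) (hb : b ∈ Sg F C) (hc : c ∈ Sg F C)
    (hab : NP a b) (hac : NP a c) (hbc : NP b c) (hspan : c ∈ Submodule.span ℂ {a, b}) :
    ∃ B : Module.Basis (Fin 3) ℂ E, B 0 = a ∧ B 1 = b ∧ ∃ k l : Fin 10 → ℂ,
      (∀ v, F v = B.coord 2 v * q3 k (B.coord 0 v) (B.coord 1 v) (B.coord 2 v)) ∧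
      (∀ v, C v = q3 l (B.coord 0 v) (B.coord 1 v) (B.coord 2 v)) ∧
      k 0 = 0 ∧ k 6 = 0 ∧ l 0 = 0 ∧ l 6 = 0 ∧
      k 1 * B.coord 0 c + k 3 * B.coord 1 c = 0 ∧ l 1 * B.coord 0 c + l 3 * B.coord 1 c = 0 := by
  obtain ⟨d, hd⟩ := ex_third hE hab
  obtain ⟨B, rfl, rfl, rfl⟩ := ex_basis hE hab hd
  obtain ⟨α, hα⟩ := exp4 B hF
  obtain ⟨l, hl⟩ := exp3 B hC
  have hzc := (mem_span_iff B c).1 hspan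
  have g0 := (grad4 B α _ hα 1 0 0 (by simp) (by simp) (by simp)).1 ha.2.1
  have g1 := (grad4 B α _ hα 0 1 0 (by simp) (by simp) (by simp)).1 hb.2.1
  have g2 := (grad4 B α _ hα _ _ _ rfl rfl hzc).1 hc.2.1
  have c0 := ha.2.2
  have c1 := hb.2.2
  have c2 := hc.2.2
  rw [np_iff B] at hac hbc
  rw [hl] at c0 c1 c2
  set x := B.coord 0 c
  set y := B.coord 1 c
  have hy : y ≠ 0 := by
    intro h
    apply hac
    simp only [hzc, h]
    simp
  have hx : x ≠ 0 := by
    intro h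
    apply hbc
    simp only [hzc, h]
    simp
  simp [q3] at g0 g1 c0 c1
  obtain ⟨g00, g01, g02⟩ := g0
  obtain ⟨g10, g11, g12⟩ := g1
  simp only [g00, g01, g02, g10, g11, g12] at g2
  have h3 : α 3 = 0 := by
    have : α 3 * (2 * x * y^2) = 0 := by linear_combination g2.1
    simpa [hx, hy] using this
  refine ⟨B, rfl, rfl, ![α 2, α 4, α 5, α 7, α 8, α 9, α 11, α 12, α 13, α 14], l, ?_, hl, ?_⟩
  · intro v
    rw [hα]
    simp [q3, q4, g00, g01, g10, g11, h3]
    ring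
  · refine ⟨by simpa using g02, by simpa using g12, c0, c1, ?_, ?_⟩
    · have : (α 4 * x + α 7 * y) * (x * y) = 0 := by linear_combination g2.2.2
      exact (mul_eq_zero.1 this).resolve_right (mul_ne_zero hx hy)
    · rw [hzc] at c2
      have : (l 1 * x + l 3 * y) * (x * y) = 0 := by
        simp only [q3, c0, c1] at c2
        linear_combination c2
      exact (mul_eq_zero.1 this).resolve_right (mul_ne_zero hx hy)

/-- four collinear points are impossible -/
lemma four_col (hE : Module.finrank ℂ E = 3) {F C : E → ℂ} (hF : F ∈ PF E 4) (hC : C ∈ PF E 3)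
    (hinf : NoInf (Sg F C))
    {a b c d : E} (ha : a ∈ Sg F C) (hb : b ∈ Sg F C) (hc : c ∈ Sg F C) (hd : d ∈ Sg F C)
    (hab : NP a b) (hac : NP a c) (hbc : NP b c) (had : NP a d) (hbd : NP b d) (hcd : NP c d)
    (hspan : c ∈ Submodule.span ℂ {a, b}) (hspan' : d ∈ Submodule.span ℂ {a, b}) : False := by
  obtain ⟨B, rfl, rfl, k, l, hk, hl, k0, k6, l0, l6, k1, l1⟩ :=
    three_col hE hF hC ha hb hc hab hac hbc hspan
  have hzc := (mem_span_iff B c).1 hspan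
  have hzd := (mem_span_iff B d).1 hspan'
  rw [np_iff B] at had hbd hcd
  rw [hzc, hzd] at hcd
  rw [hzd] at had hbd
  have hx : B.coord 0 d ≠ 0 := by
    intro h; apply hbd; simp at h; simp [h]
  have hy : B.coord 1 d ≠ 0 := by
    intro h; apply had; simp at h; simp [h]
  -- the explicit quartic
  have hα : ∀ v, F v = q4 ![0, 0, k 0, 0, k 1, k 2, 0, k 3, k 4, k 5, 0, k 6, k 7, k 8, k 9]
      (B.coord 0 v) (B.coord 1 v) (B.coord 2 v) := by
    intro v; rw [hk]; simp [q3, q4]; ring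
  have g := (grad4 B _ _ hα _ _ _ rfl rfl hzd).1 hd.2.1
  have c2 := hd.2.2
  rw [hl, hzd] at c2
  simp only [q3, l0, l6] at c2
  have g3 := g.2.2
  simp [k0, k6] at g3
  simp only [Module.Basis.coord_apply] at *
  set x := B.repr d 0
  set y := B.repr d 1
  set x' := B.repr c 0
  set y' := B.repr c 1
  have hm : x' * y - y' * x ≠ 0 := by
    intro h; apply hcd; simp [h]
  have k2 : k 1 * x + k 3 * y = 0 := by
    have : (k 1 * x + k 3 * y) * (x * y) = 0 := by linear_combination g3
    simpa [hx, hy] using this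
  have l2 : l 1 * x + l 3 * y = 0 := by
    have : (l 1 * x + l 3 * y) * (x * y) = 0 := by linear_combination c2
    simpa [hx, hy] using this
  have s1 : k 1 = 0 := by
    apply mul_right_cancel₀ hm; linear_combination y * k1 - y' * k2
  have s3 : k 3 = 0 := by
    apply mul_right_cancel₀ hm; linear_combination -x * k1 + x' * k2
  have r1 : l 1 = 0 := by
    apply mul_right_cancel₀ hm; linear_combination y * l1 - y' * l2
  have r3 : l 3 = 0 := by
    apply mul_right_cancel₀ hm; linear_combination -x * l1 + x' * l2
  refine hinf Set.univ Set.infinite_univ (fun t => B 0 + t • B 1) ?_ ?_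
  · intro t _
    refine ⟨?_, ?_, ?_⟩
    · intro h
      have := congrArg (B.coord 0) h
      simp at this
    · rw [grad4 B _ _ hα 1 t 0 (by simp) (by simp) (by simp)]
      simp [k0, k6, s1, s3]
    · rw [hl]
      simp [q3, l0, l6, r1, r3]
  · intro s _ t _ hst
    rw [np_iff B]
    rintro ⟨h, -, -⟩
    simp at h
    exact hst (by linear_combination -h)

/-- a cubic singular at four non-collinear points vanishes (first three independent) -/
lemma cubic_sing' (hE : Module.finrank ℂ E = 3) {K : E → ℂ} (hK : K ∈ PF E 3)
    {a b c d : E} (ha : HasFDerivAt K (0 : E →L[ℂ] ℂ) a) (hb : HasFDerivAt K (0 : E →L[ℂ] ℂ) b)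
    (hc : HasFDerivAt K (0 : E →L[ℂ] ℂ) c) (hd : HasFDerivAt K (0 : E →L[ℂ] ℂ) d)
    (hab : NP a b) (had : NP a d) (hbd : NP b d) (hcd : NP c d)
    (hspan : c ∉ Submodule.span ℂ {a, b}) : ∀ v, K v = 0 := by
  obtain ⟨B, rfl, rfl, rfl⟩ := ex_basis hE hab hspan
  obtain ⟨k, hk⟩ := exp3 B hK
  have g0 := (grad3 B k _ hk 1 0 0 (by simp) (by simp) (by simp)) ha
  have g1 := (grad3 B k _ hk 0 1 0 (by simp) (by simp) (by simp)) hb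
  have g2 := (grad3 B k _ hk 0 0 1 (by simp) (by simp) (by simp)) hc
  have g3 := (grad3 B k _ hk _ _ _ rfl rfl rfl) hd
  simp at g0 g1 g2
  rw [np_iff B] at had hbd hcd
  simp [g0, g1, g2] at g3 had hbd hcd
  have h4 : k 4 = 0 := by
    grind
  intro v
  rw [hk]
  simp [q3, g0, g1, g2, h4]

lemma cubic_sing (hE : Module.finrank ℂ E = 3) {K : E → ℂ} (hK : K ∈ PF E 3)
    {a b c d : E} (ha : HasFDerivAt K (0 : E →L[ℂ] ℂ) a) (hb : HasFDerivAt K (0 : E →L[ℂ] ℂ) b)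
    (hc : HasFDerivAt K (0 : E →L[ℂ] ℂ) c) (hd : HasFDerivAt K (0 : E →L[ℂ] ℂ) d)
    (hab : NP a b) (hac : NP a c) (hbc : NP b c) (had : NP a d) (hbd : NP b d) (hcd : NP c d)
    (hspan : ¬ (c ∈ Submodule.span ℂ {a, b} ∧ d ∈ Submodule.span ℂ {a, b})) : ∀ v, K v = 0 := by
  by_cases h : c ∈ Submodule.span ℂ {a, b}
  · exact cubic_sing' hE hK ha hb hd hc hab hac hbc hcd.symm (fun h' => hspan ⟨h, h'⟩)
  · exact cubic_sing' hE hK ha hb hc hd hab had hbd hcd h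

/-- case of three collinear points among seven -/
lemma case_col (hE : Module.finrank ℂ E = 3) {F C : E → ℂ} (hF : F ∈ PF E 4) (hC : C ∈ PF E 3)
    (hinf : NoInf (Sg F C)) {a b c : E} (ha : a ∈ Sg F C) (hb : b ∈ Sg F C) (hc : c ∈ Sg F C)
    (hab : NP a b) (hac : NP a c) (hbc : NP b c) (hspan : c ∈ Submodule.span ℂ {a, b})
    (q : Fin 4 → E) (hq : ∀ i, q i ∈ Sg F C) (hqq : ∀ i j, i ≠ j → NP (q i) (q j))
    (hqa : ∀ i, NP a (q i)) (hqb : ∀ i, NP b (q i)) (hqc : ∀ i, NP c (q i)) : False := by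
  have hns : ∀ i, q i ∉ Submodule.span ℂ {a, b} := fun i h =>
    four_col hE hF hC hinf ha hb hc (hq i) hab hac hbc (hqa i) (hqb i) (hqc i) hspan h
  have hns' : ¬ (q 2 ∈ Submodule.span ℂ {q 0, q 1} ∧ q 3 ∈ Submodule.span ℂ {q 0, q 1}) := fun h =>
    four_col hE hF hC hinf (hq 0) (hq 1) (hq 2) (hq 3) (hqq _ _ (by decide)) (hqq _ _ (by decide))
      (hqq _ _ (by decide)) (hqq _ _ (by decide)) (hqq _ _ (by decide)) (hqq _ _ (by decide))
      h.1 h.2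
  obtain ⟨B, rfl, rfl, k, -, hk, -⟩ := three_col hE hF hC ha hb hc hab hac hbc hspan
  obtain ⟨α, hα⟩ := exp4 B hF
  set K : E → ℂ := fun v => q3 k (B.coord 0 v) (B.coord 1 v) (B.coord 2 v) with hKdef
  have hKm : K ∈ PF E 3 := q3_mem B k
  have hKd : ∀ p, DifferentiableAt ℂ K p := by
    intro p
    have h0 := (coord_hasFDerivAt B 0 p).differentiableAt
    have h1 := (coord_hasFDerivAt B 1 p).differentiableAt
    have h2 := (coord_hasFDerivAt B 2 p).differentiableAt
    simp only [hKdef, q3]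
    fun_prop
  have hs : ∀ i, HasFDerivAt K (0 : E →L[ℂ] ℂ) (q i) := by
    intro i
    have hz : B.coord 2 (q i) ≠ 0 := fun h => hns i ((mem_span_iff B _).2 h)
    have hF0 : F (q i) = 0 := by
      have g := (grad4 B α _ hα _ _ _ rfl rfl rfl).1 (hq i).2.1
      rw [hα]
      obtain ⟨g0, g1, g2⟩ := g
      unfold q4
      linear_combination (B.coord 0 (q i) * g0 + B.coord 1 (q i) * g1 + B.coord 2 (q i) * g2) / 4
    have hK0 : K (q i) = 0 := by
      rw [hk] at hF0
      exact (mul_eq_zero.1 hF0).resolve_left hz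
    have h1 := (coord_hasFDerivAt B 2 (q i)).mul (hKd (q i)).hasFDerivAt
    have h2 : HasFDerivAt F _ (q i) :=
      h1.congr_of_eventuallyEq (Filter.Eventually.of_forall fun v => hk v)
    have h3 := h2.unique (hq i).2.1
    have h4 : fderiv ℂ K (q i) = 0 := by
      ext v
      have h5 := congrArg (fun L : E →L[ℂ] ℂ => L v) h3
      simp only [hK0, _root_.add_apply, _root_.smul_apply, smul_eq_mul,
        zero_mul, add_zero, _root_.zero_apply] at h5
      exact (mul_eq_zero.1 h5).resolve_left hz
    rw [← h4]
    exact (hKd (q i)).hasFDerivAt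
  have hKz := cubic_sing hE hKm (hs 0) (hs 1) (hs 2) (hs 3) (hqq _ _ (by decide))
    (hqq _ _ (by decide)) (hqq _ _ (by decide)) (hqq _ _ (by decide)) (hqq _ _ (by decide))
    (hqq _ _ (by decide)) hns'
  refine no_zero hE hC hinf fun v => ?_
  rw [hk]
  exact mul_eq_zero_of_right _ (hKz v)

lemma cramer3 {r0 r1 r2 u4 v4 w4 u5 v5 w5 u6 v6 w6 : ℂ}
    (h4 : r0*u4 + r1*v4 + r2*w4 = 0) (h5 : r0*u5 + r1*v5 + r2*w5 = 0)
    (h6 : r0*u6 + r1*v6 + r2*w6 = 0)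
    (hd : u4*(v5*w6-w5*v6) - v4*(u5*w6-w5*u6) + w4*(u5*v6-v5*u6) ≠ 0) :
    r0 = 0 ∧ r1 = 0 ∧ r2 = 0 := by
  refine ⟨?_, ?_, ?_⟩ <;> apply mul_right_cancel₀ hd
  · linear_combination (v5*w6-w5*v6)*h4 - (v4*w6-w4*v6)*h5 + (v4*w5-w4*v5)*h6
  · linear_combination -(u5*w6-w5*u6)*h4 + (u4*w6-w4*u6)*h5 - (u4*w5-w4*u5)*h6
  · linear_combination (u5*v6-v5*u6)*h4 - (u4*v6-v4*u6)*h5 + (u4*v5-v4*u5)*h6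

lemma span3 {u4 v4 w4 u5 v5 w5 u6 v6 w6 : ℂ}
    (hd : u4*(v5*w6-w5*v6) - v4*(u5*w6-w5*u6) + w4*(u5*v6-v5*u6) = 0)
    (hn : ¬ (u4*v5-v4*u5 = 0 ∧ u4*w5-w4*u5 = 0 ∧ v4*w5-w4*v5 = 0)) :
    ∃ α β : ℂ, u6 = α*u4+β*u5 ∧ v6 = α*v4+β*v5 ∧ w6 = α*w4+β*w5 := by
  by_cases h1 : u4*v5-v4*u5 = 0
  · by_cases h2 : u4*w5-w4*u5 = 0
    · have h3 : v4*w5-w4*v5 ≠ 0 := fun h3 => hn ⟨h1, h2, h3⟩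
      refine ⟨(v6*w5-w6*v5)/(v4*w5-w4*v5), (v4*w6-w4*v6)/(v4*w5-w4*v5), ?_, ?_, ?_⟩ <;>
        apply mul_right_cancel₀ h3 <;> field_simp
      · linear_combination hd
      · ring
      · ring
    · refine ⟨(u6*w5-w6*u5)/(u4*w5-w4*u5), (u4*w6-w4*u6)/(u4*w5-w4*u5), ?_, ?_, ?_⟩ <;>
        apply mul_right_cancel₀ h2 <;> field_simp
      · ring
      · linear_combination -hd
      · ring
  · refine ⟨(u6*v5-v6*u5)/(u4*v5-v4*u5), (u4*v6-v4*u6)/(u4*v5-v4*u5), ?_, ?_, ?_⟩ <;>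
        apply mul_right_cancel₀ h1 <;> field_simp
    · ring
    · ring
    · linear_combination hd

/-- the cubic obtained from a cubic through the base points by the Cremona transformation -/
def HH (c : Fin 10 → ℂ) (u v w : ℂ) : ℂ :=
  c 1*v*w^2+c 2*v^2*w+c 3*u*w^2+c 4*u*v*w+c 5*u*v^2+c 7*u^2*w+c 8*u^2*v

lemma HH_line (c : Fin 10 → ℂ) (u v w u' v' w' : ℂ) : ∃ h1 h2 : ℂ, ∀ s t : ℂ,
    HH c (s*u+t*u') (s*v+t*v') (s*w+t*w') =
      s^3 * HH c u v w + s^2*t*h1 + s*t^2*h2 + t^3 * HH c u' v' w' := by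
  refine ⟨c 1*(v'*w^2+2*v*w*w')+c 2*(2*v*v'*w+v^2*w')+c 3*(u'*w^2+2*u*w*w')
      +c 4*(u'*v*w+u*v'*w+u*v*w')+c 5*(u'*v^2+2*u*v*v')+c 7*(2*u*u'*w+u^2*w')
      +c 8*(2*u*u'*v+u^2*v'),
    c 1*(v*w'^2+2*v'*w*w')+c 2*(2*v*v'*w'+v'^2*w)+c 3*(u*w'^2+2*u'*w*w')
      +c 4*(u*v'*w'+u'*v*w'+u'*v'*w)+c 5*(u*v'^2+2*u'*v*v')+c 7*(2*u*u'*w'+u'^2*w)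
      +c 8*(2*u*u'*v'+u'^2*v), ?_⟩
  intro s t
  unfold HH
  ring

lemma HH_zero (c : Fin 10 → ℂ) {u v w u' v' w' : ℂ} (h : HH c u v w = 0) (h' : HH c u' v' w' = 0)
    {s t s' t' : ℂ} (hs : s ≠ 0) (ht : t ≠ 0) (hs' : s' ≠ 0) (ht' : t' ≠ 0)
    (hm : s*t'-t*s' ≠ 0)
    (h1 : HH c (s*u+t*u') (s*v+t*v') (s*w+t*w') = 0)
    (h2 : HH c (s'*u+t'*u') (s'*v+t'*v') (s'*w+t'*w') = 0) (x y : ℂ) :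
    HH c (x*u+y*u') (x*v+y*v') (x*w+y*w') = 0 := by
  obtain ⟨k1, k2, hk⟩ := HH_line c u v w u' v' w'
  rw [hk, h, h'] at h1 h2
  have e1 : s*k1+t*k2 = 0 := by
    apply mul_right_cancel₀ (mul_ne_zero hs ht); linear_combination h1
  have e2 : s'*k1+t'*k2 = 0 := by
    apply mul_right_cancel₀ (mul_ne_zero hs' ht'); linear_combination h2
  have z1 : k1 = 0 := by
    apply mul_right_cancel₀ hm; linear_combination t' * e1 - t * e2
  have z2 : k2 = 0 := by
    apply mul_right_cancel₀ hm; linear_combination -s' * e1 + s * e2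
  rw [hk, h, h', z1, z2]
  ring

/-- general position case, in coordinates -/
lemma case_gen (hE : Module.finrank ℂ E = 3) {F C : E → ℂ} (hF : F ∈ PF E 4) (hC : C ∈ PF E 3)
    (hinf : NoInf (Sg F C)) (B : Module.Basis (Fin 3) ℂ E) (hB : ∀ i, B i ∈ Sg F C)
    (q : Fin 4 → E) (hq : ∀ i, q i ∈ Sg F C) (hqq : ∀ i j, i ≠ j → NP (q i) (q j))
    (hne : ∀ i j, B.coord j (q i) ≠ 0) : False := by
  obtain ⟨a, ha⟩ := exp4 B hF
  obtain ⟨c, hc⟩ := exp3 B hC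
  have g0 := (grad4 B a _ ha 1 0 0 (by simp) (by simp) (by simp)).1 (hB 0).2.1
  have g1 := (grad4 B a _ ha 0 1 0 (by simp) (by simp) (by simp)).1 (hB 1).2.1
  have g2 := (grad4 B a _ ha 0 0 1 (by simp) (by simp) (by simp)).1 (hB 2).2.1
  have c0 := (hB 0).2.2
  have c6 := (hB 1).2.2
  have c9 := (hB 2).2.2
  rw [hc] at c0 c6 c9
  simp [q3] at g0 g1 g2 c0 c6 c9
  obtain ⟨a0, a1, a2⟩ := g0
  obtain ⟨a6, a10, a11⟩ := g1
  obtain ⟨a9, a13, a14⟩ := g2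
  -- Cremona images
  set x : Fin 4 → ℂ := fun i => B.coord 0 (q i) with hx
  set y : Fin 4 → ℂ := fun i => B.coord 1 (q i) with hy
  set z : Fin 4 → ℂ := fun i => B.coord 2 (q i) with hz
  have x0 : ∀ i, x i ≠ 0 := fun i => hne i 0
  have y0 : ∀ i, y i ≠ 0 := fun i => hne i 1
  have z0 : ∀ i, z i ≠ 0 := fun i => hne i 2
  obtain ⟨u, hu⟩ : ∃ u : Fin 4 → ℂ, ∀ i, u i = y i * z i := ⟨_, fun i => rfl⟩
  obtain ⟨v, hv⟩ : ∃ v : Fin 4 → ℂ, ∀ i, v i = x i * z i := ⟨_, fun i => rfl⟩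
  obtain ⟨w, hw⟩ : ∃ w : Fin 4 → ℂ, ∀ i, w i = x i * y i := ⟨_, fun i => rfl⟩
  have u0 : ∀ i, u i ≠ 0 := fun i => by rw [hu]; exact mul_ne_zero (y0 i) (z0 i)
  have v0 : ∀ i, v i ≠ 0 := fun i => by rw [hv]; exact mul_ne_zero (x0 i) (z0 i)
  have w0 : ∀ i, w i ≠ 0 := fun i => by rw [hw]; exact mul_ne_zero (x0 i) (y0 i)
  have hG : ∀ i, 2*a 12*u i + a 8*v i + a 7*w i = 0 ∧ a 8*u i + 2*a 5*v i + a 4*w i = 0 ∧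
      a 7*u i + a 4*v i + 2*a 3*w i = 0 := by
    intro i
    obtain ⟨gx, gy, gz⟩ := (grad4 B a _ ha (x i) (y i) (z i) rfl rfl rfl).1 (hq i).2.1
    simp only [a0, a1, a2, a6, a10, a11, a9, a13, a14] at gx gy gz
    rw [hu, hv, hw]
    have X := x0 i
    have Y := y0 i
    have Z := z0 i
    generalize x i = x at *
    generalize y i = y at *
    generalize z i = z at *
    refine ⟨?_, ?_, ?_⟩
    · apply mul_right_cancel₀ (mul_ne_zero Y Z)
      linear_combination (y * gy + z * gz - x * gx)/2
    · apply mul_right_cancel₀ (mul_ne_zero X Z)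
      linear_combination (x * gx + z * gz - y * gy)/2
    · apply mul_right_cancel₀ (mul_ne_zero X Y)
      linear_combination (x * gx + y * gy - z * gz)/2
  have hH : ∀ i, HH c (u i) (v i) (w i) = 0 := by
    intro i
    have h := (hq i).2.2
    rw [hc] at h
    change q3 c (x i) (y i) (z i) = 0 at h
    simp only [q3, c0, c6, c9] at h
    rw [hu, hv, hw]
    unfold HH
    linear_combination (x i * y i * z i) * h
  have hnp : ∀ i j, i ≠ j → ¬ (u i*v j-v i*u j = 0 ∧ u i*w j-w i*u j = 0 ∧
      v i*w j-w i*v j = 0) := by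
    rintro i j hij ⟨h1, h2, h3⟩
    have := hqq i j hij
    rw [np_iff B] at this
    apply this
    change x i * y j - y i * x j = 0 ∧ x i * z j - z i * x j = 0 ∧ y i * z j - z i * y j = 0
    rw [hu, hv, hu, hv] at h1
    rw [hu, hw, hu, hw] at h2
    rw [hv, hw, hv, hw] at h3
    refine ⟨?_, ?_, ?_⟩
    · apply mul_right_cancel₀ (mul_ne_zero (z0 i) (z0 j)); linear_combination -h1
    · apply mul_right_cancel₀ (mul_ne_zero (y0 i) (y0 j)); linear_combination -h2
    · apply mul_right_cancel₀ (mul_ne_zero (x0 i) (x0 j)); linear_combination -h3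
  have hsp : ∀ i, ∃ α β : ℂ, u i = α*u 0+β*u 1 ∧ v i = α*v 0+β*v 1 ∧ w i = α*w 0+β*w 1 := by
    intro i
    apply span3 _ (hnp 0 1 (by decide))
    by_contra hd
    obtain ⟨m1, m2, m3⟩ := cramer3 (hG 0).1 (hG 1).1 (hG i).1 hd
    obtain ⟨m4, m5, m6⟩ := cramer3 (hG 0).2.1 (hG 1).2.1 (hG i).2.1 hd
    obtain ⟨m7, m8, m9⟩ := cramer3 (hG 0).2.2 (hG 1).2.2 (hG i).2.2 hd
    simp at m1 m5 m9
    refine no_zero hE hC hinf fun p => ?_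
    rw [ha]
    simp [q4, a0, a1, a2, a6, a10, a11, a9, a13, a14, m1, m2, m3, m5, m6, m9]
  obtain ⟨α, β, e1, e2, e3⟩ := hsp 2
  obtain ⟨α', β', f1, f2, f3⟩ := hsp 3
  have hn02 := hnp 0 2 (by decide)
  have hn12 := hnp 1 2 (by decide)
  have hn03 := hnp 0 3 (by decide)
  have hn13 := hnp 1 3 (by decide)
  have hn23 := hnp 2 3 (by decide)
  have hβ : β ≠ 0 := by
    rintro rfl; apply hn02; rw [e1, e2, e3]; refine ⟨?_, ?_, ?_⟩ <;> ring
  have hα : α ≠ 0 := by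
    rintro rfl; apply hn12; rw [e1, e2, e3]; refine ⟨?_, ?_, ?_⟩ <;> ring
  have hβ' : β' ≠ 0 := by
    rintro rfl; apply hn03; rw [f1, f2, f3]; refine ⟨?_, ?_, ?_⟩ <;> ring
  have hα' : α' ≠ 0 := by
    rintro rfl; apply hn13; rw [f1, f2, f3]; refine ⟨?_, ?_, ?_⟩ <;> ring
  have hm : α*β'-β*α' ≠ 0 := by
    intro h
    apply hn23
    rw [e1, e2, e3, f1, f2, f3]
    refine ⟨?_, ?_, ?_⟩
    · linear_combination (u 0 * v 1 - v 0 * u 1) * h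
    · linear_combination (u 0 * w 1 - w 0 * u 1) * h
    · linear_combination (v 0 * w 1 - w 0 * v 1) * h
  have h2 := hH 2
  have h3 := hH 3
  rw [e1, e2, e3] at h2
  rw [f1, f2, f3] at h3
  have hline := HH_zero c (hH 0) (hH 1) hα hβ hα' hβ' hm h2 h3
  -- the family
  let U : ℂ → ℂ := fun t => u 0 + t * u 1
  let V : ℂ → ℂ := fun t => v 0 + t * v 1
  let W : ℂ → ℂ := fun t => w 0 + t * w 1
  have hI : ({t | U t ≠ 0 ∧ V t ≠ 0 ∧ W t ≠ 0} : Set ℂ).Infinite := by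
    have : ({-(u 0)/u 1, -(v 0)/v 1, -(w 0)/w 1} : Set ℂ).Finite := Set.toFinite _
    refine this.infinite_compl.mono ?_
    intro t ht
    simp only [Set.mem_compl_iff, Set.mem_insert_iff, Set.mem_singleton_iff, not_or] at ht
    have hk : ∀ r s : ℂ, s ≠ 0 → ¬ (t = -r/s) → r + t * s ≠ 0 := by
      intro r s hs h h'
      apply h
      rw [eq_div_iff hs]
      linear_combination h'
    exact ⟨hk _ _ (u0 1) ht.1, hk _ _ (v0 1) ht.2.1, hk _ _ (w0 1) ht.2.2⟩
  have hUH : ∀ t, HH c (U t) (V t) (W t) = 0 := by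
    intro t
    have := hline 1 t
    simpa only [one_mul] using this
  have hUG : ∀ t, 2*a 12*U t + a 8*V t + a 7*W t = 0 ∧ a 8*U t + 2*a 5*V t + a 4*W t = 0 ∧
      a 7*U t + a 4*V t + 2*a 3*W t = 0 := by
    intro t
    refine ⟨?_, ?_, ?_⟩ <;> simp only [U, V, W]
    · linear_combination (hG 0).1 + t * (hG 1).1
    · linear_combination (hG 0).2.1 + t * (hG 1).2.1
    · linear_combination (hG 0).2.2 + t * (hG 1).2.2
  have hnp01 := hnp 0 1 (by decide)
  refine hinf _ hI (fun t => (V t * W t) • B 0 + (U t * W t) • B 1 + (U t * V t) • B 2) ?_ ?_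
  · rintro t ⟨hU, hV, hW⟩
    refine ⟨?_, ?_, ?_⟩
    · intro h
      have := congrArg (B.coord 0) h
      simp [hV, hW] at this
    · rw [grad4 B a _ ha (V t * W t) (U t * W t) (U t * V t) (by simp) (by simp) (by simp)]
      have hg := hUG t
      have hh := hUH t
      generalize U t = u at *
      generalize V t = v at *
      generalize W t = w at *
      simp only [a0, a1, a2, a6, a10, a11, a9, a13, a14]
      obtain ⟨k1, k2, k3⟩ := hg
      refine ⟨?_, ?_, ?_⟩
      · linear_combination (u*v*w*u*v) * k2 + (u*v*w*u*w) * k3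
      · linear_combination (u*v*w*u*v) * k1 + (u*v*w*v*w) * k3
      · linear_combination (u*v*w*u*w) * k1 + (u*v*w*v*w) * k2
    · rw [hc]
      have hh := hUH t
      simp
      generalize U t = u at *
      generalize V t = v at *
      generalize W t = w at *
      unfold HH at hh
      simp only [q3, c0, c6, c9]
      linear_combination (u * v * w) * hh
  · rintro s ⟨hU, hV, hW⟩ t ⟨hU', hV', hW'⟩ hst
    rw [np_iff B]
    rintro ⟨h1, h2, h3⟩
    simp at h1 h2 h3
    have hst' : t - s ≠ 0 := sub_ne_zero.2 (Ne.symm hst)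
    apply hnp01
    refine ⟨?_, ?_, ?_⟩ <;> apply mul_right_cancel₀ hst'
    · apply mul_right_cancel₀ (mul_ne_zero hW hW')
      simp only [U, V, W] at *
      linear_combination -h1
    · apply mul_right_cancel₀ (mul_ne_zero hV hV')
      simp only [U, V, W] at *
      linear_combination -h2
    · apply mul_right_cancel₀ (mul_ne_zero hU hU')
      simp only [U, V, W] at *
      linear_combination -h3

lemma core_s6 (hE : Module.finrank ℂ E = 3) {F C : E → ℂ} (hF : F ∈ PF E 4) (hC : C ∈ PF E 3)
    (hinf : NoInf (Sg F C)) (p : Fin 7 → E) (hp : ∀ i, p i ∈ Sg F C)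
    (hpp : ∀ i j, i ≠ j → NP (p i) (p j)) : False := by
  by_cases hcol : ∃ i j k, i ≠ j ∧ i ≠ k ∧ j ≠ k ∧ p k ∈ Submodule.span ℂ {p i, p j}
  · obtain ⟨i, j, k, hij, hik, hjk, hs⟩ := hcol
    have hcard : (({i, j, k} : Finset (Fin 7))ᶜ).card = 4 := by
      rw [Finset.card_compl, Finset.card_eq_three.2 ⟨i, j, k, hij, hik, hjk, rfl⟩]
      rfl
    let m := (({i, j, k} : Finset (Fin 7))ᶜ).orderEmbOfFin hcard
    have hm : ∀ l, i ≠ m l ∧ j ≠ m l ∧ k ≠ m l := by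
      intro l
      have := Finset.orderEmbOfFin_mem _ hcard l
      simp only [Finset.mem_compl, Finset.mem_insert, Finset.mem_singleton, not_or] at this
      exact ⟨Ne.symm this.1, Ne.symm this.2.1, Ne.symm this.2.2⟩
    exact case_col hE hF hC hinf (hp i) (hp j) (hp k) (hpp _ _ hij) (hpp _ _ hik) (hpp _ _ hjk) hs
      (fun l => p (m l)) (fun l => hp _) (fun a b hab => hpp _ _ (fun h => hab (m.injective h)))
      (fun l => hpp _ _ (hm l).1) (fun l => hpp _ _ (hm l).2.1) (fun l => hpp _ _ (hm l).2.2)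
  · push Not at hcol
    obtain ⟨B, h0, h1, h2⟩ := ex_basis hE (hpp 0 1 (by decide))
      (hcol 0 1 2 (by decide) (by decide) (by decide))
    let m : Fin 4 → Fin 7 := ![3, 4, 5, 6]
    have hm : Function.Injective m := by decide
    refine case_gen hE hF hC hinf B ?_ (fun l => p (m l)) (fun l => hp _)
      (fun a b hab => hpp _ _ (fun h => hab (hm h))) ?_
    · intro i
      fin_cases i
      · simpa [h0] using hp 0
      · simpa [h1] using hp 1
      · simpa [h2] using hp 2
    · have e01 : ∀ l : Fin 4, p (m l) ∉ Submodule.span ℂ {p 0, p 1} := fun l =>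
        hcol 0 1 (m l) (by decide) (by revert l; decide) (by revert l; decide)
      have e02 : ∀ l : Fin 4, p (m l) ∉ Submodule.span ℂ {p 0, p 2} := fun l =>
        hcol 0 2 (m l) (by decide) (by revert l; decide) (by revert l; decide)
      have e12 : ∀ l : Fin 4, p (m l) ∉ Submodule.span ℂ {p 1, p 2} := fun l =>
        hcol 1 2 (m l) (by decide) (by revert l; decide) (by revert l; decide)
      intro l j hz
      fin_cases j
      · apply e12 l
        rw [Submodule.mem_span_pair]
        refine ⟨B.coord 1 (p (m l)), B.coord 2 (p (m l)), ?_⟩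
        rw [← h1, ← h2]
        apply coord_ext B
        · simpa using hz.symm
        · simp
        · simp
      · apply e02 l
        rw [Submodule.mem_span_pair]
        refine ⟨B.coord 0 (p (m l)), B.coord 2 (p (m l)), ?_⟩
        rw [← h0, ← h2]
        apply coord_ext B
        · simp
        · simpa using hz.symm
        · simp
      · apply e01 l
        rw [← h0, ← h1]
        exact (mem_span_iff B _).2 hz

lemma PF_comp {E' : Type*} [AddCommGroup E'] [Module ℂ E'] (n : ℕ) {f : E' → ℂ} (hf : f ∈ PF E' n)
    (L : E →ₗ[ℂ] E') : (fun v => f (L v)) ∈ PF E n := by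
  refine Submodule.span_induction (p := fun f _ => (fun v => f (L v)) ∈ PF E n) ?_ ?_ ?_ ?_ hf
  · rintro _ ⟨l, rfl⟩
    exact Submodule.subset_span ⟨fun i => (l i).comp L, rfl⟩
  · exact Submodule.zero_mem _
  · intro f g _ _ h1 h2
    exact Submodule.add_mem _ h1 h2
  · intro r f _ h1
    exact Submodule.smul_mem _ r h1

lemma PF_deriv {f : E → ℂ} (hf : f ∈ PF E 4) (u : E) :
    Differentiable ℂ f ∧ (fun w => fderiv ℂ f w u) ∈ PF E 3 := by
  refine Submodule.span_induction (p := fun f _ => Differentiable ℂ f ∧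
    (fun w => fderiv ℂ f w u) ∈ PF E 3) ?_ ?_ ?_ ?_ hf
  · rintro _ ⟨l, rfl⟩
    have hl : ∀ i p, HasFDerivAt (fun v => l i v) (LinearMap.toContinuousLinearMap (l i)) p :=
      fun i p => (LinearMap.toContinuousLinearMap (l i)).hasFDerivAt
    have h : ∀ p, HasFDerivAt (fun v => ∏ i, l i v) _ p := fun p => by
      simp only [Fin.prod_univ_four]
      exact (((hl 0 p).mul (hl 1 p)).mul (hl 2 p)).mul (hl 3 p)
    refine ⟨fun p => (h p).differentiableAt, ?_⟩
    have e : (fun w => fderiv ℂ (fun v => ∏ i, l i v) w u) =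
      l 0 u • (fun w => ∏ i, (![l 1, l 2, l 3] : Fin 3 → Module.Dual ℂ E) i w)
      + l 1 u • (fun w => ∏ i, (![l 0, l 2, l 3] : Fin 3 → Module.Dual ℂ E) i w)
      + l 2 u • (fun w => ∏ i, (![l 0, l 1, l 3] : Fin 3 → Module.Dual ℂ E) i w)
      + l 3 u • (fun w => ∏ i, (![l 0, l 1, l 2] : Fin 3 → Module.Dual ℂ E) i w) := by
      funext w
      rw [(h w).fderiv]
      simp [Fin.prod_univ_three]
      ring
    rw [e]
    refine Submodule.add_mem _ (Submodule.add_mem _ (Submodule.add_mem _ ?_ ?_) ?_) ?_ <;>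
      exact Submodule.smul_mem _ _ (Submodule.subset_span ⟨_, rfl⟩)
  · refine ⟨differentiable_const _, ?_⟩
    have : (fun w : E => fderiv ℂ (0 : E → ℂ) w u) = 0 := by
      funext w; simp
    rw [this]
    exact Submodule.zero_mem _
  · rintro f g _ _ ⟨d1, h1⟩ ⟨d2, h2⟩
    refine ⟨d1.add d2, ?_⟩
    have : (fun w : E => fderiv ℂ (f + g) w u)
        = (fun w => fderiv ℂ f w u) + (fun w => fderiv ℂ g w u) := by
      funext w
      rw [fderiv_add (d1 w) (d2 w)]
      rfl
    rw [this]
    exact Submodule.add_mem _ h1 h2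
  · rintro r f _ ⟨d1, h1⟩
    refine ⟨d1.const_smul r, ?_⟩
    have : (fun w : E => fderiv ℂ (r • f) w u) = r • (fun w => fderiv ℂ f w u) := by
      funext w
      rw [fderiv_const_smul (d1 w)]
      rfl
    rw [this]
    exact Submodule.smul_mem _ _ h1

end forms

lemma detV_mem (b : Fin 4 → Matrix (Fin 4) (Fin 4) ℂ) : detV b ∈ PF (Fin 4 → ℂ) 4 := by
  let l : Fin 4 → Fin 4 → Module.Dual ℂ (Fin 4 → ℂ) := fun i j =>
    ∑ k, (b k i j) • LinearMap.proj k
  have hl : ∀ i j x, mat b x i j = l i j x := by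
    intro i j x
    simp [mat, l, Matrix.sum_apply, mul_comm]
  have : detV b = ∑ σ : Equiv.Perm (Fin 4), ((Equiv.Perm.sign σ : ℤ) : ℂ) •
      (fun x => ∏ i, l (σ i) i x) := by
    funext x
    simp [detV, Matrix.det_apply', hl]
  rw [this]
  exact Submodule.sum_mem _ fun σ _ => Submodule.smul_mem _ _
    (Submodule.subset_span ⟨fun i => l (σ i) i, rfl⟩)

lemma singRep_iff (b : Fin 4 → Matrix (Fin 4) (Fin 4) ℂ) (x : Fin 4 → ℂ) :
    IsSingRep b x ↔ x ≠ 0 ∧ fderiv ℂ (detV b) x = 0 := by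
  unfold IsSingRep
  refine and_congr_right fun _ => ⟨fun h => ?_, fun h i => by simp [h]⟩
  apply ContinuousLinearMap.coe_injective
  refine (Pi.basisFun ℂ (Fin 4)).ext fun i => ?_
  simpa using h i

lemma sg_iff (b : Fin 4 → Matrix (Fin 4) (Fin 4) ℂ) (W : Submodule ℂ (Fin 4 → ℂ))
    (u : Fin 4 → ℂ) (hu : W ⊔ Submodule.span ℂ {u} = ⊤) (x : W) :
    x ∈ Sg (fun w : W => detV b w) (fun w : W => fderiv ℂ (detV b) w u) ↔
      IsSingRep b (x : Fin 4 → ℂ) := by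
  have hd : HasFDerivAt (fun w : W => detV b w) ((fderiv ℂ (detV b) x).comp W.subtypeL) x :=
    HasFDerivAt.comp x ((PF_deriv (detV_mem b) 0).1 (x : Fin 4 → ℂ)).hasFDerivAt
      W.subtypeL.hasFDerivAt
  rw [singRep_iff]
  unfold Sg
  simp only [Set.mem_ofPred_eq]
  constructor
  · rintro ⟨h0, h1, h2⟩
    refine ⟨fun h => h0 (by ext1; exact h), ?_⟩
    have h3 := hd.unique h1
    ext1 v
    have hv : v ∈ W ⊔ Submodule.span ℂ {u} := by rw [hu]; trivial
    obtain ⟨w, hw, y, hy, rfl⟩ := Submodule.mem_sup.1 hv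
    obtain ⟨c, rfl⟩ := Submodule.mem_span_singleton.1 hy
    have h4 := congrArg (fun L : W →L[ℂ] ℂ => L ⟨w, hw⟩) h3
    simp at h4
    rw [map_add, map_smul, h2, h4]
    simp
  · rintro ⟨h0, h1⟩
    refine ⟨fun h => h0 (by rw [h]; rfl), ?_, by rw [h1]; rfl⟩
    rw [h1] at hd
    simpa using hd

lemma np_mk {V : Type*} [AddCommGroup V] [Module ℂ V] {a b : V} (ha : a ≠ 0) (hb : b ≠ 0) :
    Projectivization.mk ℂ a ha ≠ Projectivization.mk ℂ b hb ↔ LinearIndependent ℂ ![a, b] := by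
  rw [Ne, Projectivization.mk_eq_mk_iff', LinearIndependent.pair_iff' ha]
  constructor
  · intro h c hc
    have hc0 : c ≠ 0 := by
      rintro rfl; exact hb (by rw [← hc, zero_smul])
    exact h ⟨c⁻¹, by rw [← hc, smul_smul, inv_mul_cancel₀ hc0, one_smul]⟩
  · rintro h ⟨c, hc⟩
    have hc0 : c ≠ 0 := by
      rintro rfl; exact ha (by rw [← hc, zero_smul])
    exact h c⁻¹ (by rw [← hc, smul_smul, inv_mul_cancel₀ hc0, one_smul])

lemma np_coe {W : Submodule ℂ (Fin 4 → ℂ)} {a b : W} :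
    NP a b ↔ LinearIndependent ℂ ![(a : Fin 4 → ℂ), (b : Fin 4 → ℂ)] := by
  unfold NP
  rw [LinearIndependent.pair_iff, LinearIndependent.pair_iff]
  refine forall_congr' fun s => forall_congr' fun t => ?_
  rw [← Submodule.coe_smul, ← Submodule.coe_smul, ← Submodule.coe_add, Submodule.coe_eq_zero]

/-- For a transversal linear determinantal quartic whose singular points are exactly the
classes of rank-`2` matrices in `V`, no `3`-dimensional linear subspace `W ⊆ V` (i.e. no
plane in `ℙ(V)`) contains representatives of seven or more singular points: each plane
contains at most six singular points of `Δ_V`. -/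
theorem plane_contains_at_most_six_singular_points
    (b : Fin 4 → Matrix (Fin 4) (Fin 4) ℂ)
    (hli : LinearIndependent ℂ b) (hsym : ∀ i, (b i).IsSymm)
    (hdet : ∃ x, detV b x ≠ 0)
    -- (i): exactly ten singular points, all of them nodes
    (h_ten : (singPoints b).Finite ∧ (singPoints b).ncard = 10)
    (h_nodes : ∀ x : Fin 4 → ℂ, IsSingRep b x → (hessV b x).rank = 3)
    -- (ii): singular points are exactly the classes of matrices of rank at most 2,
    -- and each such matrix has rank exactly 2
    (h_rank_iff : ∀ x : Fin 4 → ℂ, x ≠ 0 → (IsSingRep b x ↔ (mat b x).rank ≤ 2))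
    (h_rank_eq : ∀ x : Fin 4 → ℂ, x ≠ 0 → IsSingRep b x → (mat b x).rank = 2) :
    ∀ W : Submodule ℂ (Fin 4 → ℂ), Module.finrank ℂ W = 3 →
      ∃ T : Finset (ℙ ℂ (Fin 4 → ℂ)), T.card ≤ 6 ∧
        {p : ℙ ℂ (Fin 4 → ℂ) | ∃ x, ∃ hx : x ≠ 0, p = Projectivization.mk ℂ x hx ∧
          x ∈ W ∧ IsSingRep b x} ⊆ ↑T := by
  intro W hW
  set P : Set (ℙ ℂ (Fin 4 → ℂ)) := {p : ℙ ℂ (Fin 4 → ℂ) | ∃ x, ∃ hx : x ≠ 0,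
    p = Projectivization.mk ℂ x hx ∧ x ∈ W ∧ IsSingRep b x} with hP
  have hPfin : P.Finite := h_ten.1.subset (by
    rintro p ⟨x, hx, h1, -, h2⟩
    exact ⟨x, hx, h1, h2⟩)
  refine ⟨hPfin.toFinset, ?_, by simp⟩
  by_contra hcard
  push Not at hcard
  -- a complement of W
  obtain ⟨u, hu⟩ : ∃ u, u ∉ W := by
    by_contra h
    push Not at h
    have : W = ⊤ := by
      ext v
      simp [h v]
    rw [this] at hW
    simp at hW
  have htop : W ⊔ Submodule.span ℂ {u} = ⊤ := by
    apply Submodule.eq_top_of_finrank_eq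
    have h1 : W < W ⊔ Submodule.span ℂ {u} := by
      refine lt_of_le_of_ne le_sup_left fun h => hu ?_
      rw [h]
      exact Submodule.mem_sup_right (Submodule.mem_span_singleton_self u)
    have h2 := Submodule.finrank_lt_finrank_of_lt h1
    have h3 := Submodule.finrank_le (W ⊔ Submodule.span ℂ {u})
    simp only [Module.finrank_fin_fun] at h3 ⊢
    omega
  -- seven points
  obtain ⟨T, hT, hT7⟩ := Finset.exists_subset_card_eq (show 7 ≤ hPfin.toFinset.card from hcard)
  let e : Fin 7 ≃ T := (T.equivFinOfCardEq hT7).symm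
  have hex : ∀ i : Fin 7, ∃ x : W, ∃ hx : (x : Fin 4 → ℂ) ≠ 0,
      (e i : ℙ ℂ (Fin 4 → ℂ)) = Projectivization.mk ℂ (x : Fin 4 → ℂ) hx ∧ IsSingRep b x := by
    intro i
    have := hT (e i).2
    rw [Set.Finite.mem_toFinset] at this
    obtain ⟨x, hx, h1, h2, h3⟩ := this
    exact ⟨⟨x, h2⟩, hx, h1, h3⟩
  choose p hp0 hp1 hp2 using hex
  have hFm : (fun w : W => detV b w) ∈ PF W 4 := PF_comp 4 (detV_mem b) W.subtype
  have hCm : (fun w : W => fderiv ℂ (detV b) w u) ∈ PF W 3 :=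
    PF_comp 3 (PF_deriv (detV_mem b) u).2 W.subtype
  refine core_s6 hW hFm hCm ?_ p (fun i => (sg_iff b W u htop _).2 (hp2 i)) ?_
  · intro I hI γ hγ hnp
    have hγ' : ∀ t ∈ I, IsSingRep b (γ t) := fun t ht => (sg_iff b W u htop _).1 (hγ t ht)
    classical
    let φ : ℂ → ℙ ℂ (Fin 4 → ℂ) := fun t =>
      if h : (γ t : Fin 4 → ℂ) ≠ 0 then Projectivization.mk ℂ (γ t : Fin 4 → ℂ) h else e 0
    have hφ : ∀ t (ht : t ∈ I), φ t = Projectivization.mk ℂ (γ t : Fin 4 → ℂ) (hγ' t ht).1 :=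
      fun t ht => dif_pos (hγ' t ht).1
    refine Set.infinite_of_injOn_mapsTo (f := φ) (t := singPoints b) ?_ ?_ hI h_ten.1
    · intro s hs t ht hst
      by_contra hne
      rw [hφ s hs, hφ t ht] at hst
      exact (np_mk _ _).2 (np_coe.1 (hnp s hs t ht hne)) hst
    · intro t ht
      rw [hφ t ht]
      exact ⟨_, (hγ' t ht).1, rfl, hγ' t ht⟩
  · intro i j hij
    rw [np_coe, ← np_mk (hp0 i) (hp0 j), ← hp1, ← hp1]
    intro h
    exact hij (e.injective (Subtype.ext h))

end DetLinearSystem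
end
end

section
/- The space Δ° = {A ∈ Sym₄(ℂ) : rank A = 3}/ℂˣ of corank-1 quadrics in ℂP³ is path-connected and its fundamental group at any basepoint is trivial. -/
open Matrix

/-- The setoid identifying proportional matrices (quotient by the scaling action of `ℂˣ`)
on the subtype of matrices satisfying a property `P`. -/
def scalingSetoid (N : ℕ) (P : Matrix (Fin N) (Fin N) ℂ → Prop) :
    Setoid {A : Matrix (Fin N) (Fin N) ℂ // P A} where
  r A B := ∃ c : ℂˣ, (B : Matrix (Fin N) (Fin N) ℂ) = (c : ℂ) • (A : Matrix (Fin N) (Fin N) ℂ)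
  iseqv := by
    constructor
    · intro A; exact ⟨1, by simp⟩
    · rintro A B ⟨c, h⟩
      refine ⟨c⁻¹, ?_⟩
      rw [h, smul_smul]
      norm_cast
      simp
    · rintro A B C ⟨c, h⟩ ⟨d, h'⟩
      refine ⟨d * c, ?_⟩
      rw [h', h, smul_smul]
      norm_cast

/-- The quotient (with the quotient topology) of the space of matrices satisfying `P`
by the scaling action of `ℂˣ`. -/
abbrev MatQuot (N : ℕ) (P : Matrix (Fin N) (Fin N) ℂ → Prop) : Type :=
  Quotient (scalingSetoid N P)

open scoped unitInterval


/-- A path in the base lifts up to homotopy, with prescribed endpoints. -/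
def LiftGood {X Y : Type*} [TopologicalSpace X] [TopologicalSpace Y] (f : C(X, Y))
    {y0 y1 : Y} (γ : Path y0 y1) : Prop :=
  ∀ (x0 x1 : X) (h0 : y0 = f x0) (h1 : y1 = f x1),
    ∃ p : Path x0 x1, ((p.map f.continuous).cast h0 h1).Homotopic γ

lemma LiftGood.congr {X Y : Type*} [TopologicalSpace X] [TopologicalSpace Y] {f : C(X, Y)}
    {y0 y1 : Y} {γ γ' : Path y0 y1} (h : LiftGood f γ) (hh : γ.Homotopic γ') : LiftGood f γ' := by
  intro x0 x1 h0 h1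
  obtain ⟨p, hp⟩ := h x0 x1 h0 h1
  exact ⟨p, hp.trans hh⟩

lemma LiftGood.trans {X Y : Type*} [TopologicalSpace X] [TopologicalSpace Y] {f : C(X, Y)}
    (hf : Function.Surjective f)
    {y0 y1 y2 : Y} {γ : Path y0 y1} {γ' : Path y1 y2} (h : LiftGood f γ) (h' : LiftGood f γ') :
    LiftGood f (γ.trans γ') := by
  intro x0 x2 h0 h2
  obtain ⟨x1, h1⟩ := hf y1
  obtain ⟨p, hp⟩ := h x0 x1 h0 h1.symm
  obtain ⟨q, hq⟩ := h' x1 x2 h1.symm h2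
  refine ⟨p.trans q, ?_⟩
  subst h0 h1 h2
  simpa using hp.hcomp hq

lemma LiftGood.of_section {X Y : Type*} [TopologicalSpace X] [TopologicalSpace Y] {f : C(X, Y)}
    (hfib : ∀ x x', f x = f x' → ∃ p : Path x x', ∀ t, f (p t) = f x)
    {y0 y1 : Y} (γ : Path y0 y1) (U : Set Y) (s : Y → X) (hs : ContinuousOn s U)
    (hfs : ∀ y ∈ U, f (s y) = y) (hγ : ∀ t, γ t ∈ U) : LiftGood f γ := by
  intro x0 x1 h0 h1
  have m0 : y0 ∈ U := by simpa using hγ 0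
  have m1 : y1 ∈ U := by simpa using hγ 1
  obtain ⟨p, hp⟩ := hfib x0 (s y0) (by rw [hfs _ m0, h0])
  obtain ⟨q, hq⟩ := hfib (s y1) x1 (by rw [hfs _ m1, h1])
  let r : Path (s y0) (s y1) :=
    { toFun := fun t => s (γ t)
      continuous_toFun := hs.comp_continuous γ.continuous hγ
      source' := by simp
      target' := by simp }
  refine ⟨(p.trans r).trans q, ?_⟩
  have e : (((p.trans r).trans q).map f.continuous).cast h0 h1 =
      ((Path.refl y0).trans γ).trans (Path.refl y1) := by
    ext t
    simp only [Path.cast_coe, Path.map_coe, Function.comp, Path.trans_apply]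
    split_ifs
    · rw [hp]; simp [h0]
    · exact hfs _ (hγ _)
    · rw [hq, hfs _ m1]; simp
  rw [e]
  exact ⟨(Path.Homotopy.transRefl _).trans (Path.Homotopy.reflTrans _)⟩

lemma LiftGood.of_cast {X Y : Type*} [TopologicalSpace X] [TopologicalSpace Y] {f : C(X, Y)}
    {a b a' b' : Y} (γ : Path a b) (h : a' = a) (h' : b' = b) (hg : LiftGood f (γ.cast h h')) :
    LiftGood f γ := by
  subst h h'
  exact hg

lemma liftGood_all {X Y : Type*} [TopologicalSpace X] [TopologicalSpace Y] {f : C(X, Y)}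
    (hfib : ∀ x x', f x = f x' → ∃ p : Path x x', ∀ t, f (p t) = f x)
    (hsec : ∀ y, ∃ U : Set Y, IsOpen U ∧ y ∈ U ∧ ∃ s : Y → X, ContinuousOn s U ∧
      ∀ y ∈ U, f (s y) = y)
    {y0 y1 : Y} (γ : Path y0 y1) : LiftGood f γ := by
  have hsurj : Function.Surjective f := fun y => by
    obtain ⟨U, -, hy, s, -, hs⟩ := hsec y
    exact ⟨s y, hs y hy⟩
  choose U hUo hyU s hs hfs using hsec
  obtain ⟨t, ht0, hmono, ⟨n, hn⟩, hsub⟩ := exists_monotone_Icc_subset_open_cover_unitInterval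
    (c := fun y => γ ⁻¹' U y) (fun y => (hUo y).preimage γ.continuous)
    (fun u _ => Set.mem_iUnion.2 ⟨γ u, hyU _⟩)
  have key : ∀ k, LiftGood f (γ.subpath (t 0) (t k)) := by
    intro k
    induction k with
    | zero =>
      exact LiftGood.of_section hfib _ (U (γ (t 0))) (s _) (hs _) (hfs _)
        (fun u => by simpa using hyU (γ (t 0)))
    | succ k ih =>
      refine LiftGood.congr (LiftGood.trans hsurj ih ?_)
        ⟨Path.Homotopy.subpathTransSubpath γ (t 0) (t k) (t (k+1))⟩
      obtain ⟨y, hy⟩ := hsub k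
      refine LiftGood.of_section hfib _ (U y) (s _) (hs _) (hfs _) (fun u => ?_)
      have : (γ.subpath (t k) (t (k+1))) u ∈ Set.range (γ.subpath (t k) (t (k+1))) := ⟨u, rfl⟩
      rw [Path.range_subpath_of_le _ _ _ (hmono (Nat.le_succ k))] at this
      obtain ⟨v, hv, e⟩ := this
      rw [← e]
      exact hy hv
  have h1 := key n
  rw [ht0, hn n le_rfl] at h1
  rw [Path.subpath_zero_one] at h1
  exact LiftGood.of_cast γ _ _ h1

theorem simplyConnected_of_fibers {X Y : Type*} [TopologicalSpace X] [TopologicalSpace Y]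
    [SimplyConnectedSpace X] (f : C(X, Y))
    (hfib : ∀ x x', f x = f x' → ∃ p : Path x x', ∀ t, f (p t) = f x)
    (hsec : ∀ y, ∃ U : Set Y, IsOpen U ∧ y ∈ U ∧ ∃ s : Y → X, ContinuousOn s U ∧
      ∀ y ∈ U, f (s y) = y) : SimplyConnectedSpace Y := by
  have hsurj : Function.Surjective f := fun y => by
    obtain ⟨U, -, hy, s, -, hs⟩ := hsec y
    exact ⟨s y, hs y hy⟩
  rw [simply_connected_iff_loops_nullhomotopic]
  refine ⟨hsurj.pathConnectedSpace f.continuous, fun y γ => ?_⟩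
  obtain ⟨x, rfl⟩ := hsurj y
  obtain ⟨p, hp⟩ := liftGood_all hfib hsec γ x x rfl rfl
  refine hp.symm.trans ?_
  have := (SimplyConnectedSpace.paths_homotopic p (Path.refl x)).map f
  have e : (Path.refl x).map f.continuous = Path.refl (f x) := by ext; simp
  rw [e] at this
  exact this


/-- Triples of linearly independent vectors in `ℂ⁴`. -/
def VV : Set (Fin 3 → Fin 4 → ℂ) := {M | LinearIndependent ℂ M}

lemma isOpen_VV : IsOpen VV := isOpen_setOfPred_linearIndependent

/-- Parametrization of dependent triples, coned off along a path `p`. -/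
noncomputable def badMap (p : ℝ → Fin 3 → Fin 4 → ℂ) (i : Fin 3)
    (x : (Fin 2 → Fin 4 → ℂ) × (Fin 2 → ℂ) × ℝ × ℝ) : Fin 3 → Fin 4 → ℂ :=
  (i.insertNth (α := fun _ => Fin 4 → ℂ) (∑ j, x.2.1 j • x.1 j) x.1 : Fin 3 → Fin 4 → ℂ) +
    x.2.2.1 • p x.2.2.2

lemma contDiff_badMap (p : ℝ → Fin 3 → Fin 4 → ℂ) (hp : ContDiff ℝ 1 p) (i : Fin 3) :
    ContDiff ℝ 1 (badMap p i) := by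
  unfold badMap
  refine ContDiff.add ?_ (by fun_prop)
  rw [contDiff_pi]
  intro k
  obtain rfl | ⟨j, rfl⟩ := i.eq_self_or_eq_succAbove k
  · simp only [Fin.insertNth_apply_same]
    fun_prop
  · simp only [Fin.insertNth_apply_succAbove]
    fun_prop

lemma exists_cone_point (p : ℝ → Fin 3 → Fin 4 → ℂ) (hp : ContDiff ℝ 1 p) :
    ∃ c : Fin 3 → Fin 4 → ℂ, ∀ u : ℝ, p u ∈ VV → ∀ s : ℝ, (1 - s) • p u + s • c ∈ VV := by
  have hd : dimH (⋃ i, Set.range (badMap p i)) < Module.finrank ℝ (Fin 3 → Fin 4 → ℂ) := by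
    rw [dimH_iUnion]
    have : (⨆ i, dimH (Set.range (badMap p i))) ≤
        (Module.finrank ℝ ((Fin 2 → Fin 4 → ℂ) × (Fin 2 → ℂ) × ℝ × ℝ) : ENNReal) :=
      iSup_le fun i => (contDiff_badMap p hp i).dimH_range_le
    refine this.trans_lt ?_
    norm_cast
    simp [Module.finrank_prod, Module.finrank_pi_fintype, Complex.finrank_real_complex]
  obtain ⟨c, hc⟩ := (dense_compl_of_dimH_lt_finrank hd).nonempty
  refine ⟨c, fun u hu s => ?_⟩
  by_contra hn
  apply hc
  have hs : s ≠ 0 := by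
    rintro rfl
    apply hn
    simpa using hu
  simp only [VV, Set.mem_ofPred_eq] at hn
  rw [Fintype.not_linearIndependent_iff] at hn
  obtain ⟨g, hg, i, hi⟩ := hn
  set z := (1 - s) • p u + s • c with hz
  rw [Set.mem_iUnion]
  refine ⟨i, (fun j => (s⁻¹ : ℝ) • z (i.succAbove j), fun j => - g (i.succAbove j) / g i, -((1 - s) / s), u), ?_⟩
  have hc' : c = (s⁻¹ : ℝ) • z + (-((1 - s) / s)) • p u := by
    rw [hz, smul_add, smul_smul, smul_smul, inv_mul_cancel₀ hs, one_smul, add_right_comm, ← add_smul]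
    have : s⁻¹ * (1 - s) + -((1 - s) / s) = 0 := by field_simp; ring
    rw [this]; simp
  conv_rhs => rw [hc']
  unfold badMap
  congr 1
  rw [Fin.sum_univ_succAbove _ i] at hg
  funext k
  obtain rfl | ⟨j, rfl⟩ := i.eq_self_or_eq_succAbove k
  · simp only [Fin.insertNth_apply_same, Pi.smul_apply]
    have h2 : z k = ∑ j, (- g (k.succAbove j) / g k) • z (k.succAbove j) := by
      have : g k • z k = - ∑ j, g (k.succAbove j) • z (k.succAbove j) := eq_neg_of_add_eq_zero_left hg
      have h3 : z k = (g k)⁻¹ • (g k • z k) := by rw [smul_smul, inv_mul_cancel₀ hi, one_smul]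
      rw [h3, this, ← Finset.sum_neg_distrib, Finset.smul_sum]
      refine Finset.sum_congr rfl fun j _ => ?_
      rw [← neg_smul, smul_smul]
      congr 1
      ring
    conv_rhs => rw [h2, Finset.smul_sum]
    refine Finset.sum_congr rfl fun j _ => ?_
    rw [smul_comm]
  · simp only [Fin.insertNth_apply_succAbove, Pi.smul_apply]

lemma nonempty_VV : ∃ M, M ∈ VV := by
  refine ⟨fun i => Pi.single (Fin.castSucc i) 1, ?_⟩
  exact (Pi.linearIndependent_single_one (Fin 4) ℂ).comp _ (Fin.castSucc_injective 3)

instance : PathConnectedSpace VV := by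
  rw [← isPathConnected_iff_pathConnectedSpace, isPathConnected_iff]
  refine ⟨nonempty_VV, fun a ha b hb => ?_⟩
  obtain ⟨c, hc⟩ := exists_cone_point (fun u => a + u • (b - a)) (by fun_prop)
  have h1 : ∀ x ∈ VV, (∀ s : ℝ, (1 - s) • x + s • c ∈ VV) → JoinedIn VV x c := by
    intro x hx h
    refine JoinedIn.of_segment_subset ?_
    rw [segment_eq_image]
    rintro _ ⟨s, -, rfl⟩
    exact h s
  refine (h1 a ha ?_).trans (h1 b hb ?_).symm
  · simpa [ha] using hc 0
  · simpa [hb] using hc 1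

lemma homotopic_cast {X : Type*} [TopologicalSpace X] {a b a' b' : X} {p q : Path a b}
    (ha : a' = a) (hb : b' = b) (h : p.Homotopic q) :
    (p.cast ha hb).Homotopic (q.cast ha hb) := by
  subst ha hb
  exact h

lemma null_of_cone {x : VV} (p : Path x x) (c : Fin 3 → Fin 4 → ℂ)
    (hc : ∀ (t s : I), (1 - (s : ℝ)) • (p t : Fin 3 → Fin 4 → ℂ) + (s : ℝ) • c ∈ VV) :
    p.Homotopic (Path.refl x) := by
  let F : C(I × I, VV) := ⟨fun z => ⟨_, hc z.2 z.1⟩, by fun_prop⟩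
  have F0 : ∀ t, F (0, t) = p t := fun t => by ext : 1; simp [F]
  have hF0 : ∀ s, F (s, 0) = F (s, 1) := fun t => by simp [F]
  have hF1 : ∀ t, F (1, t) = F (1, 0) := fun t => by simp [F]
  let a : Path ((0 : I), (0 : I)) (0, 1) := ⟨⟨fun t => (0, t), by fun_prop⟩, rfl, rfl⟩
  let d : Path ((0 : I), (0 : I)) (1, 0) := ⟨⟨fun t => (t, 0), by fun_prop⟩, rfl, rfl⟩
  let e : Path ((1 : I), (0 : I)) (1, 1) := ⟨⟨fun t => (1, t), by fun_prop⟩, rfl, rfl⟩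
  let d' : Path ((0 : I), (1 : I)) (1, 1) := ⟨⟨fun t => (t, 1), by fun_prop⟩, rfl, rfl⟩
  have : ContractibleSpace I :=
    (convex_Icc (0 : ℝ) 1).contractibleSpace ⟨0, by simp⟩
  have : SimplyConnectedSpace (I × I) := inferInstance
  have h := (SimplyConnectedSpace.paths_homotopic a ((d.trans e).trans d'.symm)).map F
  have hx0 : x = F (0, 0) := by rw [F0]; simp
  have hx1 : x = F (0, 1) := by rw [F0]; simp
  let D : Path x (F (1, 0)) := (d.map F.continuous).cast hx0 rfl
  have hp : p = (a.map F.continuous).cast hx0 hx1 := by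
    ext t : 2
    simp only [Path.cast_coe, Path.map_coe, Function.comp]
    exact (F0 t).symm
  have h2 : ((((d.trans e).trans d'.symm).map F.continuous).cast hx0 hx1) =
      (D.trans (Path.refl _)).trans D.symm := by
    ext t : 2
    simp only [Path.cast_coe, Path.map_coe, Function.comp, Path.trans_apply]
    split_ifs
    · rfl
    · exact hF1 _
    · exact (hF0 _).symm
  have h3 : p.Homotopic ((D.trans (Path.refl _)).trans D.symm) := by
    rw [hp, ← h2]
    exact homotopic_cast hx0 hx1 h
  refine h3.trans ?_
  refine Path.Homotopic.trans (Path.Homotopic.hcomp ⟨Path.Homotopy.transRefl D⟩ (Path.Homotopic.refl _)) ?_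
  exact ⟨(Path.Homotopy.reflTransSymm D).symm⟩

instance : SimplyConnectedSpace VV := by
  rw [simply_connected_iff_loops_nullhomotopic]
  refine ⟨inferInstance, fun x γ => ?_⟩
  let g : C(I, Fin 3 → Fin 4 → ℂ) := ⟨fun t => γ t, by fun_prop⟩
  have hK : IsCompact (Set.range g) := isCompact_range g.continuous
  obtain ⟨δ, hδ, hsub⟩ := hK.exists_thickening_subset_open isOpen_VV
    (by rintro _ ⟨t, rfl⟩; exact (γ t).2)
  have hlim := bernsteinApproximation_uniform g
  rw [Metric.tendsto_nhds] at hlim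
  obtain ⟨n, hn, hn0⟩ := ((hlim δ hδ).and (Filter.eventually_ne_atTop 0)).exists
  have hseg : ∀ (t s : I), (1 - (s : ℝ)) • g t + (s : ℝ) • bernsteinApproximation n g t ∈ VV := by
    intro t s
    apply hsub
    rw [Metric.mem_thickening_iff]
    refine ⟨g t, ⟨t, rfl⟩, ?_⟩
    have h1 : dist (bernsteinApproximation n g t) (g t) < δ :=
      (ContinuousMap.dist_apply_le_dist t).trans_lt hn
    exact (convex_ball (g t) δ) (Metric.mem_ball_self hδ) h1 (sub_nonneg.2 s.2.2) s.2.1 (by ring)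
  let p : Path x x :=
    { toFun := fun t => ⟨bernsteinApproximation n g t, by simpa using hseg t 1⟩
      continuous_toFun := by fun_prop
      source' := by ext : 1; simp [g]
      target' := by ext : 1; simp [g, hn0] }
  have h1 : γ.Homotopic p := by
    refine ⟨{ toFun := fun z => ⟨_, hseg z.2 z.1⟩
              continuous_toFun := by fun_prop
              map_zero_left := fun t => by ext : 1; simp [g]
              map_one_left := fun t => by ext : 1; simp [p]
              prop' := ?_ }⟩
    rintro s t (rfl | rfl)
    · ext : 1
      simp [g, ← add_smul]
    · ext : 1
      simp [g, hn0, ← add_smul]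
  refine h1.trans ?_
  let P : ℝ → Fin 3 → Fin 4 → ℂ := fun u =>
    ∑ k : Fin (n + 1), ((n.choose k : ℝ) * u ^ (k : ℕ) * (1 - u) ^ (n - k)) • g (bernstein.z k)
  have hP : ∀ t : I, P t = p t := fun t => by
    simp [P, p, bernsteinApproximation.apply, bernstein_apply]
  obtain ⟨c, hc⟩ := exists_cone_point P (by fun_prop)
  refine null_of_cone p c fun t s => ?_
  rw [← hP]
  apply hc
  rw [hP]
  exact (p t).2


/-- Conformal complex orthogonal matrices. -/
def CO : Set (Matrix (Fin 3) (Fin 3) ℂ) := {G | ∃ c : ℂ, c ≠ 0 ∧ Gᵀ * G = c • (1 : Matrix (Fin 3) (Fin 3) ℂ)}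

lemma CO.mul {G H : Matrix (Fin 3) (Fin 3) ℂ} (hG : G ∈ CO) (hH : H ∈ CO) : G * H ∈ CO := by
  obtain ⟨c, hc, h⟩ := hG
  obtain ⟨d, hd, h'⟩ := hH
  refine ⟨c * d, mul_ne_zero hc hd, ?_⟩
  rw [transpose_mul, Matrix.mul_assoc, ← Matrix.mul_assoc Gᵀ, h]
  simp [h', smul_smul]

lemma JoinedIn.map_of {X Y : Type*} [TopologicalSpace X] [TopologicalSpace Y] {S : Set X} {T : Set Y}
    {a b : X} (h : JoinedIn S a b) (f : X → Y) (hf : Continuous f) (hm : ∀ x ∈ S, f x ∈ T) :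
    JoinedIn T (f a) (f b) := by
  obtain ⟨p, hp⟩ := h
  exact ⟨p.map hf, fun t => hm _ (hp t)⟩

lemma CO.joined_mul {G H : Matrix (Fin 3) (Fin 3) ℂ} (hG : JoinedIn CO 1 G) (hH : JoinedIn CO 1 H) :
    JoinedIn CO 1 (G * H) := by
  refine hG.trans ?_
  have := hH.map_of (T := CO) (fun X => G * X) (by fun_prop) (fun x hx => CO.mul hG.target_mem hx)
  simpa using this

lemma CO.joined_scalar (c : ℂ) (hc : c ≠ 0) :
    JoinedIn CO 1 (c • (1 : Matrix (Fin 3) (Fin 3) ℂ)) := by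
  have h : IsPathConnected ({0}ᶜ : Set ℂ) := isPathConnected_compl_singleton_of_one_lt_rank (by simp) 0
  have := (h.joinedIn 1 (by simp) c (by simpa using hc)).map_of (T := CO)
    (fun z => z • (1 : Matrix (Fin 3) (Fin 3) ℂ)) (by fun_prop)
    (fun z hz => ⟨z * z, mul_self_ne_zero.2 (by simpa using hz), by simp [smul_smul]⟩)
  simpa using this

lemma finite_zeros (G : Matrix (Fin 3) (Fin 3) ℂ) : {a : ℂ | (1 + a • G).det = 0}.Finite := by
  let P : Polynomial ℂ := (1 + (Polynomial.X : Polynomial ℂ) • G.map Polynomial.C).det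
  have hP : ∀ a, P.eval a = (1 + a • G).det := by
    intro a
    have := (Polynomial.evalRingHom a).map_det (1 + (Polynomial.X : Polynomial ℂ) • G.map Polynomial.C)
    rw [Polynomial.coe_evalRingHom] at this
    rw [this]
    congr 1
    ext i j
    simp [Matrix.one_apply]
    split_ifs <;> simp [mul_comm]
  have hne : P ≠ 0 := by
    intro h
    have := hP 0
    rw [h] at this
    simp at this
  refine (P.roots.toFinset.finite_toSet).subset fun a ha => ?_
  simpa [hne, hP] using ha

lemma CO.joined_cayley (G : Matrix (Fin 3) (Fin 3) ℂ) (hG : Gᵀ * G = 1) (hd : (1 + G).det ≠ 0) :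
    JoinedIn CO 1 G := by
  have hpc : IsPathConnected ({a : ℂ | (1 + a • G).det = 0}ᶜ) :=
    (finite_zeros G).countable.isPathConnected_compl_of_one_lt_rank (by simp)
  have h := (hpc.joinedIn 1 (by simpa using hd) 0 (by simp)).map_of (T := CO)
    (fun a => (a • 1 + G) * adjugate (1 + a • G)) (by fun_prop) (fun a ha => by
      refine ⟨(1 + a • G).det * (1 + a • G).det, mul_self_ne_zero.2 ha, ?_⟩
      have e : (a • 1 + G)ᵀ * (a • 1 + G) = (1 + a • G)ᵀ * (1 + a • G) := by
        simp only [transpose_add, transpose_smul, transpose_one, add_mul, mul_add, hG, smul_mul_assoc,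
          mul_smul_comm, one_mul, mul_one, smul_add]
        abel
      calc ((a • 1 + G) * adjugate (1 + a • G))ᵀ * ((a • 1 + G) * adjugate (1 + a • G))
          = (adjugate (1 + a • G))ᵀ * ((a • 1 + G)ᵀ * (a • 1 + G)) * adjugate (1 + a • G) := by
            rw [transpose_mul]; simp only [Matrix.mul_assoc]
        _ = ((1 + a • G) * adjugate (1 + a • G))ᵀ * ((1 + a • G) * adjugate (1 + a • G)) := by
            rw [e, transpose_mul]; simp only [Matrix.mul_assoc]
        _ = _ := by
            rw [mul_adjugate]; simp [smul_smul])
  have h2 := CO.joined_scalar _ hd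
  refine h2.trans ?_
  simpa [mul_adjugate] using h

lemma CO.exists_sign (G : Matrix (Fin 3) (Fin 3) ℂ) : ∃ a b c : ℂ, (a = 1 ∨ a = -1) ∧
    (b = 1 ∨ b = -1) ∧ (c = 1 ∨ c = -1) ∧ (diagonal ![a, b, c] + G).det ≠ 0 := by
  by_contra! h
  have key : ∀ a b c : ℂ, (diagonal ![a, b, c] + G).det =
      (a + G 0 0) * (b + G 1 1) * (c + G 2 2) - (a + G 0 0) * G 1 2 * G 2 1
      - G 0 1 * G 1 0 * (c + G 2 2) + G 0 1 * G 1 2 * G 2 0 + G 0 2 * G 1 0 * G 2 1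
      - G 0 2 * (b + G 1 1) * G 2 0 := by
    intro a b c
    simp [det_fin_three, diagonal]
  have h1 := h 1 1 1 (by simp) (by simp) (by simp)
  have h2 := h 1 1 (-1) (by simp) (by simp) (by simp)
  have h3 := h 1 (-1) 1 (by simp) (by simp) (by simp)
  have h4 := h 1 (-1) (-1) (by simp) (by simp) (by simp)
  have h5 := h (-1) 1 1 (by simp) (by simp) (by simp)
  have h6 := h (-1) 1 (-1) (by simp) (by simp) (by simp)
  have h7 := h (-1) (-1) 1 (by simp) (by simp) (by simp)
  have h8 := h (-1) (-1) (-1) (by simp) (by simp) (by simp)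
  rw [key] at h1 h2 h3 h4 h5 h6 h7 h8
  have : (8 : ℂ) = 0 := by
    linear_combination h1 - h2 - h3 + h4 - h5 + h6 + h7 - h8
  norm_num at this

lemma CO.joined_diag {a b c : ℂ} (ha : a = 1 ∨ a = -1) (hb : b = 1 ∨ b = -1) (hc : c = 1 ∨ c = -1) :
    JoinedIn CO 1 (diagonal ![a, b, c]) := by
  have k1 : JoinedIn CO 1 (diagonal ![1, -1, -1] : Matrix (Fin 3) (Fin 3) ℂ) := by
    have h := CO.joined_cayley !![1, 0, 0; 0, 0, -1; 0, 1, 0]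
      (by ext i j; fin_cases i <;> fin_cases j <;> simp [Matrix.mul_apply, Fin.sum_univ_three])
      (by simp [det_fin_three]; norm_num)
    convert CO.joined_mul h h using 1
    ext i j; fin_cases i <;> fin_cases j <;> simp [Matrix.mul_apply, Fin.sum_univ_three]
  have k2 : JoinedIn CO 1 (diagonal ![-1, 1, -1] : Matrix (Fin 3) (Fin 3) ℂ) := by
    have h := CO.joined_cayley !![0, 0, -1; 0, 1, 0; 1, 0, 0]
      (by ext i j; fin_cases i <;> fin_cases j <;> simp [Matrix.mul_apply, Fin.sum_univ_three])
      (by simp [det_fin_three]; norm_num)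
    convert CO.joined_mul h h using 1
    ext i j; fin_cases i <;> fin_cases j <;> simp [Matrix.mul_apply, Fin.sum_univ_three]
  have m1 := CO.joined_scalar (-1) (by simp)
  have one : JoinedIn CO 1 (1 : Matrix (Fin 3) (Fin 3) ℂ) := by
    simpa using CO.joined_scalar 1 (by simp)
  rcases ha with rfl | rfl <;> rcases hb with rfl | rfl <;> rcases hc with rfl | rfl
  · convert one using 1
    ext i j; fin_cases i <;> fin_cases j <;> simp
  · convert CO.joined_mul m1 (CO.joined_mul k1 k2) using 1
    ext i j; fin_cases i <;> fin_cases j <;> simp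
  · convert CO.joined_mul m1 k2 using 1
    ext i j; fin_cases i <;> fin_cases j <;> simp
  · exact k1
  · convert CO.joined_mul m1 k1 using 1
    ext i j; fin_cases i <;> fin_cases j <;> simp
  · exact k2
  · convert CO.joined_mul k1 k2 using 1
    ext i j; fin_cases i <;> fin_cases j <;> simp
  · convert m1 using 1
    ext i j; fin_cases i <;> fin_cases j <;> simp

lemma CO.joined_of_orth (G : Matrix (Fin 3) (Fin 3) ℂ) (hG : Gᵀ * G = 1) : JoinedIn CO 1 G := by
  obtain ⟨a, b, c, ha, hb, hc, hd⟩ := CO.exists_sign G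
  have hj := CO.joined_diag ha hb hc
  set D : Matrix (Fin 3) (Fin 3) ℂ := diagonal ![a, b, c] with hD
  have hDD : D * D = 1 := by
    rw [hD, diagonal_mul_diagonal, ← diagonal_one]
    congr 1
    funext i
    fin_cases i
    · rcases ha with rfl | rfl <;> simp
    · rcases hb with rfl | rfl <;> simp
    · rcases hc with rfl | rfl <;> simp
  have hDT : Dᵀ = D := by rw [hD, diagonal_transpose]
  have h1 : JoinedIn CO 1 (G * D) := by
    refine CO.joined_cayley _ ?_ ?_
    · rw [transpose_mul, Matrix.mul_assoc, ← Matrix.mul_assoc Gᵀ, hG, Matrix.one_mul, hDT, hDD]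
    · have : 1 + G * D = (D + G) * D := by rw [Matrix.add_mul, hDD]
      rw [this, det_mul]
      refine mul_ne_zero hd fun h0 => ?_
      have := congrArg det hDD
      rw [det_mul, h0] at this
      simp at this
  have := CO.joined_mul h1 hj
  rwa [Matrix.mul_assoc, hDD, Matrix.mul_one] at this

lemma CO.joined (G : Matrix (Fin 3) (Fin 3) ℂ) (hG : G ∈ CO) : JoinedIn CO 1 G := by
  obtain ⟨c, hc, h⟩ := hG
  obtain ⟨d, hd⟩ := IsAlgClosed.exists_pow_nat_eq c (n := 2) (by norm_num)
  have hd0 : d ≠ 0 := by rintro rfl; apply hc; rw [← hd]; simp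
  have h1 := CO.joined_of_orth (d⁻¹ • G) (by
    rw [transpose_smul, smul_mul_assoc, mul_smul_comm, h, ← hd, smul_smul, smul_smul]
    have : d⁻¹ * d⁻¹ * d ^ 2 = 1 := by field_simp
    rw [this, one_smul])
  have := CO.joined_mul (CO.joined_scalar d hd0) h1
  simpa [smul_smul, hd0] using this


/-- One step of symmetric Gaussian elimination. -/
noncomputable def redStep (v : Fin 4 → ℂ) (A : Matrix (Fin 4) (Fin 4) ℂ) : Matrix (Fin 4) (Fin 4) ℂ :=
  A - (v ⬝ᵥ A *ᵥ v)⁻¹ • vecMulVec (A *ᵥ v) (A *ᵥ v)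

lemma redStep_symm (v : Fin 4 → ℂ) {A : Matrix (Fin 4) (Fin 4) ℂ} (hA : A.IsSymm) :
    (redStep v A).IsSymm := by
  unfold redStep
  refine hA.sub ?_
  refine IsSymm.smul ?_ _
  ext i j
  simp [vecMulVec_apply, mul_comm]

lemma redStep_rank (v : Fin 4 → ℂ) {A : Matrix (Fin 4) (Fin 4) ℂ} (hA : A.IsSymm)
    (hq : v ⬝ᵥ A *ᵥ v ≠ 0) : (redStep v A).rank < A.rank := by
  unfold Matrix.rank
  have hmv : ∀ x, redStep v A *ᵥ x = A *ᵥ x - ((v ⬝ᵥ A *ᵥ v)⁻¹ * ((A *ᵥ v) ⬝ᵥ x)) • (A *ᵥ v) := by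
    intro x
    unfold redStep
    rw [sub_mulVec, smul_mulVec, vecMulVec_mulVec]
    congr 1
    ext i
    simp; ring
  have hsym : ∀ x, v ⬝ᵥ A *ᵥ x = (A *ᵥ v) ⬝ᵥ x := by
    intro x
    rw [dotProduct_mulVec, ← mulVec_transpose, hA.eq]
  apply Submodule.finrank_lt_finrank_of_lt
  refine lt_of_le_of_ne ?_ ?_
  · rintro _ ⟨x, rfl⟩
    simp only [mulVecLin_apply]
    rw [hmv]
    refine ⟨x - ((v ⬝ᵥ A *ᵥ v)⁻¹ * ((A *ᵥ v) ⬝ᵥ x)) • v, ?_⟩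
    simp [mulVec_sub, mulVec_smul]
  · intro h
    have hm : A *ᵥ v ∈ LinearMap.range (redStep v A).mulVecLin := by
      rw [h]; exact ⟨v, rfl⟩
    obtain ⟨x, hx⟩ := hm
    apply hq
    rw [← hx, mulVecLin_apply, hmv, dotProduct_sub, dotProduct_smul, hsym x, smul_eq_mul]
    field_simp
    ring

lemma mat_rank_add_le (A B : Matrix (Fin 4) (Fin 4) ℂ) : (A + B).rank ≤ A.rank + B.rank := by
  unfold Matrix.rank
  refine le_trans (Submodule.finrank_mono (t := LinearMap.range A.mulVecLin ⊔ LinearMap.range B.mulVecLin) ?_)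
    (Submodule.finrank_add_le_finrank_add_finrank _ _)
  rintro _ ⟨x, rfl⟩
  rw [mulVecLin_apply, add_mulVec]
  exact Submodule.add_mem_sup ⟨x, rfl⟩ ⟨x, rfl⟩

lemma redStep_rank_ge (v : Fin 4 → ℂ) (A : Matrix (Fin 4) (Fin 4) ℂ) :
    A.rank ≤ (redStep v A).rank + 1 := by
  have h : A = redStep v A + vecMulVec ((v ⬝ᵥ A *ᵥ v)⁻¹ • (A *ᵥ v)) (A *ᵥ v) := by
    unfold redStep
    rw [smul_vecMulVec]
    simp
  calc A.rank = (redStep v A + vecMulVec ((v ⬝ᵥ A *ᵥ v)⁻¹ • (A *ᵥ v)) (A *ᵥ v)).rank := by rw [← h]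
    _ ≤ _ := (mat_rank_add_le _ _).trans (Nat.add_le_add_left (rank_vecMulVec_le _ _) _)

lemma exists_nonisotropic {A : Matrix (Fin 4) (Fin 4) ℂ} (hA : A.IsSymm) (h0 : A ≠ 0) :
    ∃ v : Fin 4 → ℂ, v ⬝ᵥ A *ᵥ v ≠ 0 := by
  by_contra! h
  apply h0
  ext i j
  have h1 := h (Pi.single i 1)
  have h2 := h (Pi.single j 1)
  have h3 := h (Pi.single i 1 + Pi.single j 1)
  have hs : A j i = A i j := hA.apply i j
  simp [mulVec_add, add_dotProduct, dotProduct_add] at h1 h2 h3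
  rw [h1, h2, hs] at h3
  simp only [Matrix.zero_apply]
  linear_combination h3 / 2

lemma local_factor (r : ℕ) : ∀ A₀ : Matrix (Fin 4) (Fin 4) ℂ, A₀.IsSymm → A₀.rank = r →
    ∃ U : Set (Matrix (Fin 4) (Fin 4) ℂ), IsOpen U ∧ A₀ ∈ U ∧
      ∃ s : Matrix (Fin 4) (Fin 4) ℂ → Matrix (Fin r) (Fin 4) ℂ, ContinuousOn s U ∧
        ∀ A ∈ U, A.IsSymm → A.rank ≤ r → (s A)ᵀ * s A = A := by
  induction r with
  | zero =>
    intro A₀ _ _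
    refine ⟨Set.univ, isOpen_univ, trivial, fun _ => 0, continuousOn_const, fun A _ _ h => ?_⟩
    have h0 : A.rank = 0 := by omega
    unfold Matrix.rank at h0
    rw [Submodule.finrank_eq_zero, LinearMap.range_eq_bot] at h0
    ext i j
    have := congrFun (LinearMap.congr_fun h0 (Pi.single j 1)) i
    simp at this
    simp [this]
  | succ r ih =>
    intro A₀ hA hr
    obtain ⟨v, hv⟩ := exists_nonisotropic hA (by rintro rfl; simp at hr)
    obtain ⟨U', hU', hm', s', hs', hfac⟩ := ih (redStep v A₀) (redStep_symm v hA) (by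
      have h1 := redStep_rank v hA hv
      have h2 := redStep_rank_ge v A₀
      omega)
    set c₀ := v ⬝ᵥ A₀ *ᵥ v with hc₀
    obtain ⟨w, hw⟩ := IsAlgClosed.exists_pow_nat_eq c₀ (n := 2) (by norm_num)
    have hw0 : w ≠ 0 := by rintro rfl; apply hv; rw [← hw]; simp
    have hqc : Continuous fun A : Matrix (Fin 4) (Fin 4) ℂ => v ⬝ᵥ A *ᵥ v := by fun_prop
    let U1 : Set (Matrix (Fin 4) (Fin 4) ℂ) := {A | (v ⬝ᵥ A *ᵥ v) / c₀ ∈ Complex.slitPlane}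
    have hU1 : IsOpen U1 := Complex.isOpen_slitPlane.preimage (hqc.div_const c₀)
    have hne : ∀ A ∈ U1, v ⬝ᵥ A *ᵥ v ≠ 0 := by
      intro A hA h
      have := Complex.slitPlane_ne_zero hA
      simp [h] at this
    have hred : ContinuousOn (redStep v) U1 := by
      unfold redStep
      refine ContinuousOn.sub continuousOn_id ?_
      refine ContinuousOn.smul (hqc.continuousOn.inv₀ hne) ?_
      apply Continuous.continuousOn
      fun_prop
    let rt : Matrix (Fin 4) (Fin 4) ℂ → ℂ := fun A => w * ((v ⬝ᵥ A *ᵥ v) / c₀) ^ ((2 : ℕ) : ℂ)⁻¹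
    have hrt : ContinuousOn rt U1 := by
      refine continuousOn_const.mul ?_
      intro A hA
      refine ContinuousAt.continuousWithinAt ?_
      exact ContinuousAt.comp (f := fun A : Matrix (Fin 4) (Fin 4) ℂ => (v ⬝ᵥ A *ᵥ v) / c₀)
        (g := fun z : ℂ => z ^ ((2 : ℕ) : ℂ)⁻¹)
        (continuousAt_cpow_const hA) (hqc.div_const c₀).continuousAt
    have hrt2 : ∀ A, rt A ^ 2 = v ⬝ᵥ A *ᵥ v := by
      intro A
      simp only [rt]
      rw [mul_pow, Complex.cpow_nat_inv_pow _ (by norm_num), hw]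
      field_simp
    have hrt0 : ∀ A ∈ U1, rt A ≠ 0 := by
      intro A hA h
      apply hne A hA
      rw [← hrt2, h]; simp
    refine ⟨U1 ∩ redStep v ⁻¹' U', hred.isOpen_inter_preimage hU1 hU', ⟨?_, hm'⟩,
      fun A => Matrix.of (Fin.cons (α := fun _ => Fin 4 → ℂ) ((rt A)⁻¹ • (A *ᵥ v)) (s' (redStep v A))), ?_, ?_⟩
    · change c₀ / c₀ ∈ Complex.slitPlane
      rw [div_self hv]
      simp
    · have hs1 : ContinuousOn (fun A => s' (redStep v A)) (U1 ∩ redStep v ⁻¹' U') :=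
        hs'.comp (hred.mono Set.inter_subset_left) (fun A hA => hA.2)
      have hs2 : ContinuousOn (fun A => (rt A)⁻¹ • (A *ᵥ v)) (U1 ∩ redStep v ⁻¹' U') := by
        refine ContinuousOn.smul ((hrt.mono Set.inter_subset_left).inv₀ (fun A hA => hrt0 A hA.1)) ?_
        apply Continuous.continuousOn
        fun_prop
      refine continuousOn_pi.2 fun k => ?_
      refine Fin.cases ?_ (fun j => ?_) k
      · exact hs2
      · exact continuousOn_pi.1 hs1 j
    · rintro A ⟨hA1, hA2⟩ hAs hAr
      have h1 := hfac _ hA2 (redStep_symm v hAs) (by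
        have := redStep_rank v hAs (hne A hA1)
        omega)
      ext i j
      have h2 := congrFun (congrFun h1 i) j
      rw [Matrix.mul_apply] at h2 ⊢
      rw [Fin.sum_univ_succ]
      simp only [transpose_apply] at h2
      change (rt A)⁻¹ * (A *ᵥ v) i * ((rt A)⁻¹ * (A *ᵥ v) j) +
        ∑ k, s' (redStep v A) k i * s' (redStep v A) k j = A i j
      rw [h2]
      simp only [redStep, Matrix.sub_apply, Matrix.smul_apply, vecMulVec_apply, smul_eq_mul]
      rw [← hrt2]
      have := hrt0 A hA1
      field_simp
      ring

lemma VV.rank_of_mem {M : Fin 3 → Fin 4 → ℂ} (hM : M ∈ VV) : (Matrix.of M).rank = 3 := by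
  have := LinearIndependent.rank_matrix (M := Matrix.of M) hM
  simpa using this

lemma VV.exists_right_inv {M : Fin 3 → Fin 4 → ℂ} (hM : M ∈ VV) :
    ∃ R : Matrix (Fin 4) (Fin 3) ℂ, Matrix.of M * R = 1 := by
  rw [← mulVec_surjective_iff_exists_right_inverse]
  have h := VV.rank_of_mem hM
  unfold Matrix.rank at h
  have : LinearMap.range (Matrix.of M).mulVecLin = ⊤ :=
    Submodule.eq_top_of_finrank_eq (by rw [h]; simp)
  rw [LinearMap.range_eq_top] at this
  exact this

lemma VV.mem_of_rank {M : Fin 3 → Fin 4 → ℂ} (hM : 3 ≤ (Matrix.of M).rank) : M ∈ VV := by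
  have h := rank_eq_finrank_span_row (Matrix.of M)
  have h2 := rank_le_height (Matrix.of M)
  change LinearIndependent ℂ M
  rw [linearIndependent_iff_card_eq_finrank_span, Fintype.card_fin]
  have h3 : (Matrix.of M).rank = 3 := le_antisymm h2 hM
  rw [h3] at h
  exact h

lemma VV.mem_of_right_inv {M : Fin 3 → Fin 4 → ℂ} {R : Matrix (Fin 4) (Fin 3) ℂ}
    (h : Matrix.of M * R = 1) : M ∈ VV := by
  apply VV.mem_of_rank
  have := rank_mul_le_left (Matrix.of M) R
  rw [h, rank_one] at this
  simpa using this

lemma VV.rank_gram {M : Fin 3 → Fin 4 → ℂ} (hM : M ∈ VV) :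
    ((Matrix.of M)ᵀ * Matrix.of M).rank = 3 := by
  obtain ⟨R, hR⟩ := VV.exists_right_inv hM
  apply le_antisymm
  · exact (rank_mul_le_right _ _).trans_eq (VV.rank_of_mem hM)
  · have h : Rᵀ * ((Matrix.of M)ᵀ * Matrix.of M) = Matrix.of M := by
      rw [← Matrix.mul_assoc, ← transpose_mul, hR, transpose_one, Matrix.one_mul]
    have h2 := rank_mul_le_right Rᵀ ((Matrix.of M)ᵀ * Matrix.of M)
    rw [h, VV.rank_of_mem hM] at h2
    exact h2

/-- The space of corank one quadrics. -/
abbrev QQ : Type := MatQuot 4 (fun A => A.IsSymm ∧ A.rank = 3)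

/-- The Gram matrix as a rank three symmetric matrix. -/
def gram (M : VV) : {A : Matrix (Fin 4) (Fin 4) ℂ // A.IsSymm ∧ A.rank = 3} :=
  ⟨(Matrix.of M.1)ᵀ * Matrix.of M.1, by rw [Matrix.IsSymm, transpose_mul, transpose_transpose],
    VV.rank_gram M.2⟩

lemma continuous_gram : Continuous gram := by
  refine Continuous.subtype_mk ?_ _
  have : Continuous fun M : VV => (Matrix.of M.1 : Matrix (Fin 3) (Fin 4) ℂ) := continuous_subtype_val
  exact this.matrix_transpose.matrix_mul this

/-- The quotient map from frames to quadrics. -/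
def toQQ : C(VV, QQ) :=
  ⟨fun M => Quotient.mk (scalingSetoid 4 (fun A => A.IsSymm ∧ A.rank = 3)) (gram M),
    continuous_quotient_mk'.comp continuous_gram⟩

lemma toQQ_fiber (x x' : VV) (h : toQQ x = toQQ x') :
    ∃ p : Path x x', ∀ t, toQQ (p t) = toQQ x := by
  obtain ⟨c, hc⟩ : ∃ c : ℂˣ, (gram x' : Matrix (Fin 4) (Fin 4) ℂ) = (c : ℂ) • (gram x).1 :=
    Quotient.exact h
  obtain ⟨R, hR⟩ := VV.exists_right_inv x.2
  obtain ⟨R', hR'⟩ := VV.exists_right_inv x'.2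
  set M := Matrix.of x.1 with hM
  set M' := Matrix.of x'.1 with hM'
  replace hc : M'ᵀ * M' = (c : ℂ) • (Mᵀ * M) := hc
  have hRt : R'ᵀ * M'ᵀ = 1 := by rw [← transpose_mul, hR', transpose_one]
  have hG : M' * R * M = M' := by
    have e : M'ᵀ * (M' * R * M) = M'ᵀ * M' := by
      rw [Matrix.mul_assoc M', ← Matrix.mul_assoc M'ᵀ, hc, Matrix.smul_mul, Matrix.mul_assoc,
        ← Matrix.mul_assoc M R, hR, Matrix.one_mul]
    have e2 := congrArg (fun X => R'ᵀ * X) e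
    simpa only [← Matrix.mul_assoc, hRt, Matrix.one_mul] using e2
  have hGO : M' * R ∈ CO := by
    refine ⟨c, c.ne_zero, ?_⟩
    rw [transpose_mul, Matrix.mul_assoc, ← Matrix.mul_assoc M'ᵀ, hc, Matrix.smul_mul, Matrix.mul_smul,
      Matrix.mul_assoc, hR, Matrix.mul_one, ← transpose_mul, hR, transpose_one]
  obtain ⟨p, hp⟩ := CO.joined _ hGO
  have hmem : ∀ t, (fun i j => (p t * M) i j) ∈ VV := by
    intro t
    obtain ⟨d, hd, h⟩ := hp t
    have h1 : (d⁻¹ • (p t)ᵀ) * p t = 1 := by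
      rw [Matrix.smul_mul, h, smul_smul, inv_mul_cancel₀ hd, one_smul]
    have h2 := mul_eq_one_comm.1 h1
    refine VV.mem_of_right_inv (R := R * (d⁻¹ • (p t)ᵀ)) ?_
    change (p t * M) * _ = 1
    rw [Matrix.mul_assoc, ← Matrix.mul_assoc M, hR, Matrix.one_mul, h2]
  have hcont : Continuous fun t => p t * M := p.continuous.matrix_mul continuous_const
  refine ⟨{ toFun := fun t => ⟨fun i j => (p t * M) i j, hmem t⟩
            continuous_toFun := Continuous.subtype_mk hcont _
            source' := ?_
            target' := ?_ }, fun t => ?_⟩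
  · ext i j
    simp [hM]
  · ext i j
    simp only [Path.target, hG]
    rfl
  · obtain ⟨d, hd, h⟩ := hp t
    refine (Quotient.sound ?_).symm
    refine ⟨Units.mk0 d hd, ?_⟩
    change (p t * M)ᵀ * (p t * M) = d • (Mᵀ * M)
    rw [transpose_mul, Matrix.mul_assoc, ← Matrix.mul_assoc (p t)ᵀ, h, Matrix.smul_mul, Matrix.mul_smul,
      Matrix.one_mul]

/-- Normalization of a class of matrices by an entry. -/
noncomputable def normEntry (i j : Fin 4) : QQ → Matrix (Fin 4) (Fin 4) ℂ :=
  Quotient.lift (fun A => (A.1 i j)⁻¹ • A.1) (by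
    rintro A B ⟨c, hc⟩
    dsimp only
    rw [hc, smul_smul, Matrix.smul_apply, smul_eq_mul, mul_inv]
    congr 1
    have := c.ne_zero
    field_simp)

lemma toQQ_section (y : QQ) : ∃ U : Set QQ, IsOpen U ∧ y ∈ U ∧ ∃ s : QQ → VV, ContinuousOn s U ∧
      ∀ y ∈ U, toQQ (s y) = y := by
  induction y using Quotient.inductionOn with | h A₀ => ?_
  obtain ⟨i, j, hij⟩ : ∃ i j, A₀.1 i j ≠ 0 := by
    by_contra! h
    have h0 : A₀.1 = 0 := by ext i j; exact h i j
    have := A₀.2.2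
    rw [h0] at this
    simp at this
  have hrk : ∀ A : {A : Matrix (Fin 4) (Fin 4) ℂ // A.IsSymm ∧ A.rank = 3}, A.1 i j ≠ 0 →
      ((A.1 i j)⁻¹ • A.1).rank = 3 := fun A hA => by
    rw [rank_smul_of_mem_nonZeroDivisors _ (mem_nonZeroDivisors_of_ne_zero (inv_ne_zero hA)), A.2.2]
  obtain ⟨U, hU, hAU, s, hs, hfac⟩ := local_factor 3 ((A₀.1 i j)⁻¹ • A₀.1) (A₀.2.1.smul _) (hrk A₀ hij)
  let mk : {A : Matrix (Fin 4) (Fin 4) ℂ // A.IsSymm ∧ A.rank = 3} → QQ :=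
    Quotient.mk (scalingSetoid 4 (fun A => A.IsSymm ∧ A.rank = 3))
  have hmk : Topology.IsQuotientMap mk := isQuotientMap_quotient_mk'
  let W : Set QQ := {y | normEntry i j y i j ≠ 0 ∧ normEntry i j y ∈ U}
  have hpre : mk ⁻¹' W = {A | A.1 i j ≠ 0} ∩ (fun A => (A.1 i j)⁻¹ • A.1) ⁻¹' U := by
    ext A
    change ((A.1 i j)⁻¹ • A.1) i j ≠ 0 ∧ (A.1 i j)⁻¹ • A.1 ∈ U ↔ A.1 i j ≠ 0 ∧ (A.1 i j)⁻¹ • A.1 ∈ U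
    simp
  have hentry : Continuous fun A : {A : Matrix (Fin 4) (Fin 4) ℂ // A.IsSymm ∧ A.rank = 3} => A.1 i j :=
    continuous_subtype_val.matrix_elem i j
  have hco : ContinuousOn (fun A : {A : Matrix (Fin 4) (Fin 4) ℂ // A.IsSymm ∧ A.rank = 3} =>
      (A.1 i j)⁻¹ • A.1) {A | A.1 i j ≠ 0} :=
    ContinuousOn.smul (hentry.continuousOn.inv₀ fun A hA => hA) continuous_subtype_val.continuousOn
  have hopen0 : IsOpen {A : {A : Matrix (Fin 4) (Fin 4) ℂ // A.IsSymm ∧ A.rank = 3} | A.1 i j ≠ 0} :=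
    isOpen_ne_fun hentry continuous_const
  have hW : IsOpen W := by
    rw [← hmk.isOpen_preimage, hpre]
    exact hco.isOpen_inter_preimage hopen0 hU
  have hN : ContinuousOn (normEntry i j) W := by
    rw [hmk.continuousOn_isOpen_iff hW, hpre]
    exact hco.mono Set.inter_subset_left
  have hfacW : ∀ y ∈ W, (s (normEntry i j y))ᵀ * s (normEntry i j y) = normEntry i j y ∧
      (normEntry i j y).rank = 3 := by
    intro y hy
    induction y using Quotient.inductionOn with | h A => ?_
    have hA : A ∈ mk ⁻¹' W := hy
    rw [hpre] at hA
    have hr : (normEntry i j (mk A)).rank = 3 := hrk A hA.1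
    exact ⟨hfac _ hA.2 (A.2.1.smul _) hr.le, hr⟩
  have hmem : ∀ y ∈ W, (fun a b => s (normEntry i j y) a b) ∈ VV := by
    intro y hy
    obtain ⟨h1, h2⟩ := hfacW y hy
    apply VV.mem_of_rank
    change 3 ≤ (s (normEntry i j y)).rank
    refine h2.symm.le.trans ?_
    conv_lhs => rw [← h1]
    exact rank_mul_le_right _ _
  classical
  obtain ⟨M₀, hM₀⟩ := nonempty_VV
  let sec : QQ → VV := fun y => if h : y ∈ W then ⟨_, hmem y h⟩ else ⟨M₀, hM₀⟩
  have hsec : ∀ y, ∀ h : y ∈ W, sec y = ⟨_, hmem y h⟩ := fun y h => dif_pos h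
  refine ⟨W, hW, ?_, sec, ?_, ?_⟩
  · change A₀ ∈ mk ⁻¹' W
    rw [hpre]
    exact ⟨hij, hAU⟩
  · rw [Topology.IsInducing.subtypeVal.continuousOn_iff]
    have hc : ContinuousOn (fun y => s (normEntry i j y)) W := hs.comp hN (fun y hy => hy.2)
    refine ContinuousOn.congr (f := fun y => (fun a b => s (normEntry i j y) a b)) hc ?_
    intro y hy
    simp only [Function.comp, hsec y hy]
  · intro y hy
    rw [hsec y hy]
    have h1 := (hfacW y hy).1
    induction y using Quotient.inductionOn with | h A => ?_
    have hA : A ∈ mk ⁻¹' W := hy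
    rw [hpre] at hA
    refine Quotient.sound ⟨Units.mk0 _ hA.1, ?_⟩
    change A.1 = A.1 i j • ((s (normEntry i j (mk A)))ᵀ * s (normEntry i j (mk A)))
    refine Eq.trans ?_ (congrArg (fun X => A.1 i j • X) h1.symm)
    change A.1 = A.1 i j • ((A.1 i j)⁻¹ • A.1)
    rw [smul_smul, mul_inv_cancel₀ hA.1, one_smul]

/-- The space `Δ°` of symmetric `4×4` complex matrices of rank `3` up to scaling (the space
of corank-`1` quadrics in `ℂP³`) is path-connected and simply connected: its fundamental
group at any basepoint is trivial. -/
theorem corank_one_quadrics_simply_connected :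
    PathConnectedSpace (MatQuot 4 (fun A => A.IsSymm ∧ A.rank = 3)) ∧
    ∀ q : MatQuot 4 (fun A => A.IsSymm ∧ A.rank = 3),
      Subsingleton (FundamentalGroup (MatQuot 4 (fun A => A.IsSymm ∧ A.rank = 3)) q) := by
  have h : SimplyConnectedSpace QQ := simplyConnected_of_fibers toQQ toQQ_fiber toQQ_section
  exact ⟨inferInstance, fun q => inferInstance⟩
end

section
/- For every nonzero vector p ∈ ℂ⁴, the space {A ∈ Sym₄(ℂ) : rank A = 3 and pᵀAp ≠ 0}/ℂˣ (the space Δ° of corank-1 quadrics in ℂP³ with the geometric hyperplane H_p removed) is path-connected and its fundamental group at any basepoint is isomorphic to ℤ/2ℤ. -/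
open Matrix

section Generic
open Set Topology Module unitInterval

variable {V F : Type} [NormedAddCommGroup V] [NormedSpace ℝ V] [FiniteDimensional ℝ V]
  [NormedAddCommGroup F] [NormedSpace ℝ F] [FiniteDimensional ℝ F]

/-- For a smooth curve `g` and a small cone `K`, there is a point from which the curve can be coned
off outside `K`. -/
lemma exists_cone_point_s8 (K : Set V)
    (hcone : ∀ t : ℝ, ∀ x ∈ K, t • x ∈ K) {ι : Type} [Countable ι] (φ : ι → F → V)
    (hφ : ∀ i, ContDiff ℝ 1 (φ i)) (hcov : K ⊆ ⋃ i, range (φ i))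
    (hdim : finrank ℝ F + 2 < finrank ℝ V) (g : ℝ → V) (hg : ContDiff ℝ 1 g) :
    ∃ c : V, ∀ t : ℝ, ∀ s : ℝ, s ≠ 0 → (1 - s) • g t + s • c ∉ K := by
  have hd : Dense (⋃ i, range (fun z : F × ℝ × ℝ => φ i z.1 - z.2.1 • g z.2.2))ᶜ := by
    apply dense_compl_of_dimH_lt_finrank
    rw [dimH_iUnion]
    have h1 : ∀ i, dimH (range (fun z : F × ℝ × ℝ => φ i z.1 - z.2.1 • g z.2.2)) ≤
        (finrank ℝ (F × ℝ × ℝ) : ENNReal) := by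
      intro i
      apply ContDiff.dimH_range_le
      have := hφ i
      fun_prop
    refine lt_of_le_of_lt (iSup_le h1) ?_
    simp only [finrank_prod, finrank_self]
    exact_mod_cast hdim
  obtain ⟨c, hc⟩ := hd.nonempty
  refine ⟨c, fun t s hs hK => hc ?_⟩
  have h2 := hcov (hcone s⁻¹ _ hK)
  simp only [mem_iUnion, mem_range] at h2 ⊢
  obtain ⟨i, y, hy⟩ := h2
  refine ⟨i, (y, s⁻¹ * (1 - s), t), ?_⟩
  simp only [hy, smul_add, smul_smul, inv_mul_cancel₀ hs, one_smul]
  abel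

lemma star_isSimplyConnected (K : Set V) (c : V) (hc : c ∉ K) :
    IsSimplyConnected {y : V | ∀ s : ℝ, 0 ≤ s → s ≤ 1 → (1 - s) • y + s • c ∉ K} := by
  set S := {y : V | ∀ s : ℝ, 0 ≤ s → s ≤ 1 → (1 - s) • y + s • c ∉ K}
  have hcS : c ∈ S := by
    intro s _ _
    rw [← add_smul]
    simpa using hc
  have hst : StarConvex ℝ c S := by
    intro y hy a b ha hb hab s hs0 hs1
    have : (1 - s) • (a • c + b • y) + s • c =
      (1 - ((1 - s) * a + s)) • y + ((1 - s) * a + s) • c := by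
      have : b = 1 - a := by linarith
      subst this
      module
    rw [this]
    apply hy
    · have := mul_nonneg (sub_nonneg.2 hs1) ha
      linarith
    · have : (1 - s) * a ≤ (1 - s) * 1 := mul_le_mul_of_nonneg_left (by linarith) (by linarith)
      linarith
  have := hst.contractibleSpace ⟨c, hcS⟩
  show SimplyConnectedSpace S
  infer_instance

lemma cone_compl_isSimplyConnected (K : Set V) (hK : IsClosed K)
    (hcone : ∀ t : ℝ, ∀ x ∈ K, t • x ∈ K) {ι : Type} [Countable ι] (φ : ι → F → V)
    (hφ : ∀ i, ContDiff ℝ 1 (φ i)) (hcov : K ⊆ ⋃ i, range (φ i))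
    (hdim : finrank ℝ F + 2 < finrank ℝ V) : IsSimplyConnected Kᶜ := by
  have key : ∀ g : ℝ → V, ContDiff ℝ 1 g → ∃ S : Set V, S ⊆ Kᶜ ∧ IsSimplyConnected S ∧
      ∀ t, g t ∉ K → g t ∈ S := by
    intro g hg
    obtain ⟨c, hc⟩ := exists_cone_point_s8 K hcone φ hφ hcov hdim g hg
    refine ⟨_, ?_, star_isSimplyConnected K c ?_, ?_⟩
    · intro y hy
      simpa using hy 0 le_rfl zero_le_one
    · simpa using hc 0 1 one_ne_zero
    · intro t ht s hs0 hs1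
      rcases eq_or_ne s 0 with rfl | h
      · simpa using ht
      · exact hc t s h
  rw [isSimplyConnected_iff_exists_homotopy_refl_forall_mem]
  refine ⟨?_, ?_⟩
  · rw [isPathConnected_iff]
    constructor
    · obtain ⟨S, hS, hS', -⟩ := key (fun _ => 0) contDiff_const
      exact hS'.nonempty.mono hS
    · intro x hx y hy
      obtain ⟨S, hS, hS', h⟩ := key (fun t => x + t • (y - x)) (by fun_prop)
      have h0 := h 0 (by simpa using hx)
      have h1 := h 1 (by simpa using hy)
      simp only [zero_smul, add_zero, one_smul, add_sub_cancel] at h0 h1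
      exact (hS'.isPathConnected.joinedIn _ h0 _ h1).mono hS
  · intro x γ hγ
    obtain ⟨δ, hδ, hsub⟩ := (isCompact_range γ.continuous).exists_thickening_subset_open
      hK.isOpen_compl (by rintro _ ⟨t, rfl⟩; exact hγ t)
    have hlim := bernsteinApproximation_uniform (γ : C(I, V))
    rw [Metric.tendsto_atTop] at hlim
    obtain ⟨N, hN⟩ := hlim δ hδ
    set n := N + 1 with hn
    have hn0 : n ≠ 0 := by omega
    have hdist := hN n (by omega)
    set B : C(I, V) := bernsteinApproximation n (γ : C(I, V)) with hB
    have hd : ∀ t, dist (B t) (γ t) < δ := fun t =>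
      lt_of_le_of_lt (ContinuousMap.dist_apply_le_dist t) hdist
    have hmem : ∀ t, ∀ s : I, (1 - (s : ℝ)) • γ t + (s : ℝ) • B t ∉ K := by
      intro t s
      apply hsub
      rw [Metric.mem_thickening_iff]
      refine ⟨γ t, ⟨t, rfl⟩, ?_⟩
      have h1 : (1 - (s : ℝ)) • γ t + (s : ℝ) • B t - γ t = (s : ℝ) • (B t - γ t) := by module
      rw [dist_eq_norm, h1, norm_smul, ← dist_eq_norm]
      have h2 : ‖(s : ℝ)‖ ≤ 1 := by
        rw [Real.norm_of_nonneg s.2.1]; exact s.2.2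
      calc _ ≤ 1 * dist (B t) (γ t) := by gcongr
        _ < δ := by simpa using hd t
    have hB0 : B 0 = x := by simp [hB]
    have hB1 : B 1 = x := by simp [hB, bernsteinApproximation.apply_one hn0]
    let β : Path x x := { toContinuousMap := B, source' := hB0, target' := hB1 }
    let g : ℝ → V := fun y => ∑ k : Fin (n + 1),
      ((n.choose k : ℝ) * y ^ (k : ℕ) * (1 - y) ^ (n - (k : ℕ))) • γ (bernstein.z k)
    have hg : ContDiff ℝ 1 g := by
      apply ContDiff.sum
      intro k _
      fun_prop
    have hgB : ∀ t : I, g t = B t := by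
      intro t
      simp only [g, hB, bernsteinApproximation.apply, bernstein_apply]
      rfl
    obtain ⟨S, hS, hS', h⟩ := key g hg
    rw [isSimplyConnected_iff_exists_homotopy_refl_forall_mem] at hS'
    obtain ⟨F2, hF2⟩ := hS'.2 x β (fun t => by
      have : β t = g t := (hgB t).symm
      rw [this]
      apply h
      rw [hgB]
      simpa using hmem t 1)
    let F1 : γ.Homotopy β :=
      { toFun := fun z => (1 - (z.1 : ℝ)) • γ z.2 + (z.1 : ℝ) • B z.2
        continuous_toFun := by fun_prop
        map_zero_left := by intro t; simp
        map_one_left := by intro t; simp; rfl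
        prop' := by
          intro s t ht
          rcases ht with rfl | ht
          · simp [hB0, ← add_smul]
          · rw [mem_singleton_iff] at ht
            subst ht
            simp [hB1, ← add_smul] }
    refine ⟨F1.trans F2, ?_⟩
    rintro ⟨s, t⟩
    rw [Path.Homotopy.trans_apply]
    split_ifs
    · exact hmem _ _
    · exact hS (hF2 _)

end Generic

section LiftLemma
open Set Topology unitInterval

/-- A path-lifting surjection with path-connected fibres from a simply connected space
has a simply connected target. -/
lemma simplyConnectedSpace_of_lift {W E : Type} [TopologicalSpace W] [TopologicalSpace E]
    [SimplyConnectedSpace W] (f : W → E) (hf : Continuous f) (hs : Function.Surjective f)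
    (hlift : ∀ (γ : C(I, E)) (w : W), f w = γ 0 → ∃ Γ : C(I, W), (∀ t, f (Γ t) = γ t) ∧ Γ 0 = w)
    (hfib : ∀ w w' : W, f w = f w' → ∃ δ : Path w w', ∀ t, f (δ t) = f w') :
    SimplyConnectedSpace E := by
  rw [simply_connected_iff_loops_nullhomotopic]
  refine ⟨hs.pathConnectedSpace hf, ?_⟩
  intro x γ
  obtain ⟨w, rfl⟩ := hs x
  obtain ⟨Γ, hΓ, hΓ0⟩ := hlift γ w (by simp)
  have hw1 : f (Γ 1) = f w := by rw [hΓ]; simp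
  obtain ⟨δ, hδ⟩ := hfib (Γ 1) w hw1
  let P : Path w (Γ 1) := { toContinuousMap := Γ, source' := hΓ0, target' := rfl }
  have h1 : (P.trans δ).Homotopic (Path.refl w) := SimplyConnectedSpace.paths_homotopic _ _
  have h2 := h1.map ⟨f, hf⟩
  have gen : ∀ (y : E) (hy : y = f w) (p : Path (f w) y) (q : Path y (f w)),
      (∀ t, q t = f w) → (∀ t, p t = γ t) → (p.trans q).Homotopic (Path.refl (f w)) →
      γ.Homotopic (Path.refl (f w)) := by
    intro y hy p q hq hp h
    subst hy
    have e1 : p = γ := by ext t; exact hp t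
    have e2 : q = Path.refl (f w) := by ext t; exact hq t
    subst e1 e2
    exact (Path.Homotopic.symm ⟨Path.Homotopy.transRefl p⟩).trans h
  refine gen (f (Γ 1)) hw1 (P.map hf) (δ.map hf) hδ hΓ ?_
  rw [← Path.map_trans]
  exact h2

end LiftLemma

section Spaces
open Set Topology unitInterval Module

/-- Pairs of dependent vectors (with an additional free vector). -/
def depSet : Set ((Fin 3 → ℂ) × (Fin 3 → ℂ) × (Fin 3 → ℂ)) :=
  {x | ∀ i j, x.2.1 i * x.2.2 j = x.2.1 j * x.2.2 i}

lemma depSet_cover (x : (Fin 3 → ℂ) × (Fin 3 → ℂ) × (Fin 3 → ℂ)) (hx : x ∈ depSet) :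
    (∃ z : ℂ, x.2.2 = z • x.2.1) ∨ (∃ z : ℂ, x.2.1 = z • x.2.2) := by
  by_cases h : x.2.1 = 0
  · right; exact ⟨0, by simp [h]⟩
  · left
    obtain ⟨i, hi⟩ := Function.ne_iff.1 h
    simp only [Pi.zero_apply] at hi
    refine ⟨x.2.2 i / x.2.1 i, ?_⟩
    ext j
    have := hx i j
    simp only [Pi.smul_apply, smul_eq_mul]
    field_simp
    linear_combination this

lemma depSet_compl : IsSimplyConnected (depSetᶜ) := by
  apply cone_compl_isSimplyConnected (F := (Fin 3 → ℂ) × (Fin 3 → ℂ) × ℂ) (ι := Bool) depSet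
    ?_ ?_ (fun b z => if b then (z.1, z.2.1, z.2.2 • z.2.1) else (z.1, z.2.2 • z.2.1, z.2.1))
  · intro b
    cases b
    · simp only [Bool.false_eq_true, if_false]
      fun_prop
    · simp only [if_true]
      fun_prop
  · intro x hx
    rw [mem_iUnion]
    rcases depSet_cover x hx with ⟨z, hz⟩ | ⟨z, hz⟩
    · exact ⟨true, (x.1, x.2.1, z), by simp [← hz]⟩
    · exact ⟨false, (x.1, x.2.2, z), by simp [← hz]⟩
  · simp [finrank_prod, finrank_pi_fintype, Complex.finrank_real_complex]
  · simp only [depSet, ofPred_forall]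
    refine isClosed_iInter fun i => isClosed_iInter fun j => ?_
    exact isClosed_eq (by fun_prop) (by fun_prop)
  · intro t x hx i j
    have := hx i j
    simp only [Prod.smul_fst, Prod.smul_snd, Pi.smul_apply, Complex.real_smul]
    linear_combination (t : ℂ) ^ 2 * this

/-- The rank one non-symmetric matrices (with an additional free vector). -/
abbrev Cov : Type := {x : (Fin 3 → ℂ) × Matrix (Fin 3) (Fin 3) ℂ //
  (∀ i j k l, x.2 i j * x.2 k l = x.2 i l * x.2 k j) ∧ ¬ x.2.IsSymm}

lemma compl_of_vecMulVec (x : (Fin 3 → ℂ) × (Fin 3 → ℂ) × (Fin 3 → ℂ)) :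
    x ∈ depSetᶜ ↔ ¬ (vecMulVec x.2.1 x.2.2).IsSymm := by
  rw [mem_compl_iff, not_iff_not, Matrix.IsSymm.ext_iff]
  constructor
  · intro h i j; exact h j i
  · intro h i j; exact h j i

/-- The outer product map. -/
def outer (w : (depSetᶜ : Set ((Fin 3 → ℂ) × (Fin 3 → ℂ) × (Fin 3 → ℂ)))) : Cov :=
  ⟨(w.1.1, vecMulVec w.1.2.1 w.1.2.2), fun i j k l => by simp [vecMulVec_apply]; ring,
    (compl_of_vecMulVec w.1).1 w.2⟩

lemma outer_continuous : Continuous outer := by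
  unfold outer
  refine Continuous.subtype_mk (Continuous.prodMk (by fun_prop) ?_) _
  refine continuous_matrix fun i j => ?_
  simp only [vecMulVec_apply]
  fun_prop

lemma Cov.exists_ne (L : Cov) : ∃ i j, L.1.2 i j ≠ 0 := by
  by_contra! h
  exact L.2.2 (Matrix.IsSymm.ext fun i j => by rw [h, h])

lemma outer_surjective : Function.Surjective outer := by
  intro L
  obtain ⟨i, j, h⟩ := L.exists_ne
  have e : vecMulVec (fun k => L.1.2 k j) (fun l => L.1.2 i l / L.1.2 i j) = L.1.2 := by
    ext k l
    rw [vecMulVec_apply]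
    field_simp
    linear_combination - L.2.1 i j k l
  refine ⟨⟨(L.1.1, fun k => L.1.2 k j, fun l => L.1.2 i l / L.1.2 i j), ?_⟩, ?_⟩
  · rw [compl_of_vecMulVec, e]; exact L.2.2
  · apply Subtype.ext
    exact Prod.ext rfl e

lemma outer_fib (w w' : (depSetᶜ : Set ((Fin 3 → ℂ) × (Fin 3 → ℂ) × (Fin 3 → ℂ))))
    (h : outer w = outer w') : ∃ δ : Path w w', ∀ t, outer (δ t) = outer w' := by
  obtain ⟨⟨b, u, v⟩, hw⟩ := w
  obtain ⟨⟨b', u', v'⟩, hw'⟩ := w'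
  have h1 := congrArg Subtype.val h
  simp only [outer, Prod.mk.injEq] at h1
  obtain ⟨rfl, h2⟩ := h1
  have h3 : ∀ i j, u i * v j = u' i * v' j := fun i j => by
    have := congrFun (congrFun h2 i) j
    simpa [vecMulVec_apply] using this
  obtain ⟨i, j, hij⟩ := Cov.exists_ne (outer ⟨(b, u, v), hw⟩)
  have hij1 : u i * v j ≠ 0 := by simpa [outer, vecMulVec_apply] using hij
  have hui := left_ne_zero_of_mul hij1
  have hvj := right_ne_zero_of_mul hij1
  have hij2 := hij1
  rw [h3] at hij2
  have hui' := left_ne_zero_of_mul hij2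
  have hvj' := right_ne_zero_of_mul hij2
  have hc : v' j / v j ≠ 0 := div_ne_zero hvj' hvj
  set c := v' j / v j with hcdef
  have hu : u = c • u' := by
    ext k
    have := h3 k j
    simp only [hcdef, Pi.smul_apply, smul_eq_mul]
    field_simp
    linear_combination this
  have hv : v = c⁻¹ • v' := by
    ext l
    have e1 := h3 i l
    have e2 := h3 i j
    simp only [hcdef, Pi.smul_apply, smul_eq_mul, inv_div]
    field_simp
    apply mul_left_cancel₀ hui
    linear_combination v' j * e1 - v' l * e2
  have hpc : IsPathConnected ({0}ᶜ : Set ℂ) :=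
    isPathConnected_compl_singleton_of_one_lt_rank (by simp) 0
  obtain ⟨p, hp⟩ := hpc.joinedIn c hc 1 one_ne_zero
  have hp' : ∀ t, p t ≠ 0 := fun t => hp t
  have hmem : ∀ t, vecMulVec (p t • u') ((p t)⁻¹ • v') = vecMulVec u' v' := by
    intro t
    ext k l
    have := hp' t
    simp only [vecMulVec_apply, Pi.smul_apply, smul_eq_mul]
    field_simp
  refine ⟨{ toFun := fun t => ⟨(b, p t • u', (p t)⁻¹ • v'), ?_⟩
            continuous_toFun := ?_
            source' := ?_
            target' := ?_ }, ?_⟩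
  · rw [compl_of_vecMulVec, hmem]
    exact (compl_of_vecMulVec _).1 hw'
  · have hi : Continuous fun t => (p t)⁻¹ := p.continuous.inv₀ hp'
    have hpc := p.continuous
    exact Continuous.subtype_mk (by fun_prop) _
  · apply Subtype.ext
    simp [hu, hv]
  · apply Subtype.ext
    simp
  · intro t
    apply Subtype.ext
    exact Prod.ext rfl (hmem t)

lemma outer_lift (γ : C(I, Cov)) (w : (depSetᶜ : Set ((Fin 3 → ℂ) × (Fin 3 → ℂ) × (Fin 3 → ℂ))))
    (hw : outer w = γ 0) :
    ∃ Γ : C(I, (depSetᶜ : Set ((Fin 3 → ℂ) × (Fin 3 → ℂ) × (Fin 3 → ℂ)))),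
      (∀ t, outer (Γ t) = γ t) ∧ Γ 0 = w := by
  have hent : ∀ i j, Continuous fun t => (γ t).1.2 i j := fun i j => by fun_prop
  obtain ⟨t, t_0, t_mono, ⟨n_max, h_max⟩, t_sub⟩ :=
    exists_monotone_Icc_subset_open_cover_unitInterval
      (c := fun ij : Fin 3 × Fin 3 => {t : I | (γ t).1.2 ij.1 ij.2 ≠ 0})
      (fun ij => isOpen_ne_fun (hent _ _) continuous_const)
      (fun t _ => by
        obtain ⟨i, j, h⟩ := (γ t).exists_ne
        exact mem_iUnion.2 ⟨(i, j), h⟩)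
  suffices ∀ n, ∃ Γ : I → (Fin 3 → ℂ) × (Fin 3 → ℂ), ContinuousOn Γ (Icc 0 (t n)) ∧
      (∀ s ∈ Icc 0 (t n), vecMulVec (Γ s).1 (Γ s).2 = (γ s).1.2) ∧ Γ 0 = w.1.2 by
    obtain ⟨Γ, cont, eqOn, Γ_0⟩ := this n_max
    rw [h_max _ le_rfl] at cont eqOn
    have huniv : Icc (0 : I) 1 = univ := eq_univ_iff_forall.2 fun t => ⟨bot_le, le_top⟩
    rw [huniv] at cont eqOn
    have hΓc := continuousOn_univ.1 cont
    refine ⟨⟨fun s => ⟨((γ s).1.1, Γ s), ?_⟩, ?_⟩, ?_, ?_⟩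
    · rw [compl_of_vecMulVec, eqOn s trivial]
      exact (γ s).2.2
    · exact Continuous.subtype_mk (by fun_prop) _
    · intro s
      apply Subtype.ext
      exact Prod.ext rfl (eqOn s trivial)
    · apply Subtype.ext
      refine Prod.ext ?_ Γ_0
      show (γ 0).1.1 = w.1.1
      rw [← hw]
      rfl
  intro n
  induction n with
  | zero =>
    refine ⟨fun _ => w.1.2, continuous_const.continuousOn, fun s hs => ?_, rfl⟩
    rw [t_0, Icc_self, mem_singleton_iff] at hs
    subst hs
    rw [← hw]
    rfl
  | succ n ih =>
    obtain ⟨Γ, cont, eqOn, Γ_0⟩ := ih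
    obtain ⟨⟨i, j⟩, hsub⟩ := t_sub n
    have hL : ∀ s ∈ Icc (t n) (t (n + 1)), (γ s).1.2 i j ≠ 0 := fun s hs => hsub hs
    have h0 := eqOn (t n) ⟨bot_le, le_rfl⟩
    have h0' : ∀ k l, (Γ (t n)).1 k * (Γ (t n)).2 l = (γ (t n)).1.2 k l := fun k l => by
      rw [← h0, vecMulVec_apply]
    have hne : (Γ (t n)).1 i * (Γ (t n)).2 j ≠ 0 := by
      rw [h0']; exact hL _ ⟨le_rfl, t_mono n.le_succ⟩
    have hni := left_ne_zero_of_mul hne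
    have hnj := right_ne_zero_of_mul hne
    set a := (Γ (t n)).2 j with ha
    refine ⟨fun s => if s ≤ t n then Γ s else
      (fun k => (γ s).1.2 k j / a, fun l => (γ s).1.2 i l * a / (γ s).1.2 i j),
      .if (fun s hs => ?_) (cont.mono fun _ h => ?_) ?_, fun s hs => ?_, ?_⟩
    · cases frontier_Iic_subset _ hs.2
      refine Prod.ext ?_ ?_
      · ext k
        simp only [← h0', ← ha]
        field_simp
      · ext l
        simp only [← h0', ← ha]
        field_simp
    · rw [closure_le_eq continuous_id' continuous_const] at h; exact ⟨h.1.1, h.2⟩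
    · simp_rw [not_le]
      have hcl : ∀ s ∈ Icc 0 (t (n + 1)) ∩ closure {s | t n < s}, (γ s).1.2 i j ≠ 0 := fun s h =>
        hL s ⟨closure_lt_subset_le continuous_const continuous_subtype_val h.2, h.1.2⟩
      refine ContinuousOn.prodMk ?_ ?_
      · exact (continuous_pi fun k => (hent k j).div_const a).continuousOn
      · refine continuousOn_pi.2 fun l => ?_
        exact ((hent i l).mul continuous_const).continuousOn.div (hent i j).continuousOn hcl
    · beta_reduce
      split_ifs with h
      · exact eqOn s ⟨hs.1, h⟩
      · have hs' := hL s ⟨le_of_not_ge h, hs.2⟩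
        ext k l
        rw [vecMulVec_apply]
        field_simp
        linear_combination - (γ s).2.1 i j k l
    · beta_reduce
      rwa [if_pos (t_0 ▸ t_mono n.zero_le)]

lemma cov_simplyConnected : SimplyConnectedSpace Cov := by
  have := depSet_compl.simplyConnectedSpace
  exact simplyConnectedSpace_of_lift outer outer_continuous outer_surjective outer_lift outer_fib

end Spaces

section Algebra
open Set Topology

lemma rank_add_le_aux {n : ℕ} (A B : Matrix (Fin n) (Fin n) ℂ) :
    (A + B).rank ≤ A.rank + B.rank := by
  have h := LinearMap.rank_add_le A.mulVecLin B.mulVecLin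
  rw [← Matrix.mulVecLin_add] at h
  simp only [LinearMap.rank, ← Module.finrank_eq_rank] at h
  exact_mod_cast h

/-- Extend a `3 × 3` matrix by a zero row and column. -/
def padM (B : Matrix (Fin 3) (Fin 3) ℂ) : Matrix (Fin 4) (Fin 4) ℂ :=
  Matrix.of fun i j => Fin.cases 0 (fun i' => Fin.cases 0 (fun j' => B i' j') j) i

/-- The matrix with Schur complement `B` and first column `(1, b)`. -/
def mkM (b : Fin 3 → ℂ) (B : Matrix (Fin 3) (Fin 3) ℂ) : Matrix (Fin 4) (Fin 4) ℂ :=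
  vecMulVec (Fin.cons 1 b) (Fin.cons 1 b) + padM B

/-- Normalised first column. -/
noncomputable def exb (A : Matrix (Fin 4) (Fin 4) ℂ) : Fin 3 → ℂ := fun i => A i.succ 0 / A 0 0

/-- Normalised Schur complement. -/
noncomputable def exB (A : Matrix (Fin 4) (Fin 4) ℂ) : Matrix (Fin 3) (Fin 3) ℂ :=
  Matrix.of fun i j => A i.succ j.succ / A 0 0 - exb A i * exb A j

lemma mkM_zero_zero (b B) : mkM b B 0 0 = 1 := by
  simp [mkM, padM, vecMulVec_apply]
lemma mkM_succ_zero (b B) (i : Fin 3) : mkM b B i.succ 0 = b i := by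
  simp [mkM, padM, vecMulVec_apply]
lemma mkM_zero_succ (b B) (i : Fin 3) : mkM b B 0 i.succ = b i := by
  simp [mkM, padM, vecMulVec_apply]
lemma mkM_succ_succ (b B) (i j : Fin 3) : mkM b B i.succ j.succ = b i * b j + B i j := by
  simp [mkM, padM, vecMulVec_apply]

lemma mkM_ex (A : Matrix (Fin 4) (Fin 4) ℂ) (hA : A.IsSymm) (h0 : A 0 0 ≠ 0) :
    A = A 0 0 • mkM (exb A) (exB A) := by
  ext i j
  rw [Matrix.smul_apply, smul_eq_mul]
  refine Fin.cases ?_ (fun i => ?_) i <;> refine Fin.cases ?_ (fun j => ?_) j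
  · rw [mkM_zero_zero]; ring
  · rw [mkM_zero_succ, exb, ← hA.apply]; field_simp
  · rw [mkM_succ_zero, exb]; field_simp
  · rw [mkM_succ_succ, exB, Matrix.of_apply]; field_simp; ring

lemma exb_mkM (c : ℂ) (hc : c ≠ 0) (b B) : exb (c • mkM b B) = b := by
  ext i
  simp only [exb, Matrix.smul_apply, mkM_zero_zero, mkM_succ_zero, smul_eq_mul]
  field_simp

lemma exB_mkM (c : ℂ) (hc : c ≠ 0) (b B) : exB (c • mkM b B) = B := by
  ext i j
  simp only [exB, exb_mkM c hc, Matrix.of_apply, Matrix.smul_apply, mkM_zero_zero,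
    mkM_succ_succ, smul_eq_mul]
  field_simp
  ring

lemma exb_smul (c : ℂ) (hc : c ≠ 0) (A) : exb (c • A) = exb A := by
  ext i
  simp only [exb, Matrix.smul_apply, smul_eq_mul]
  rw [mul_div_mul_left _ _ hc]

lemma exB_smul (c : ℂ) (hc : c ≠ 0) (A) : exB (c • A) = exB A := by
  ext i j
  simp only [exB, exb_smul c hc, Matrix.of_apply, Matrix.smul_apply, smul_eq_mul]
  rw [mul_div_mul_left _ _ hc]

lemma exB_symm (A : Matrix (Fin 4) (Fin 4) ℂ) (hA : A.IsSymm) : (exB A).IsSymm := by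
  refine Matrix.IsSymm.ext fun i j => ?_
  simp only [exB, Matrix.of_apply, hA.apply i.succ j.succ]
  ring

lemma mkM_symm (b) (B : Matrix (Fin 3) (Fin 3) ℂ) (hB : B.IsSymm) : (mkM b B).IsSymm := by
  refine Matrix.IsSymm.ext fun i j => ?_
  refine Fin.cases ?_ (fun i => ?_) i <;> refine Fin.cases ?_ (fun j => ?_) j
  · rfl
  · rw [mkM_zero_succ, mkM_succ_zero]
  · rw [mkM_zero_succ, mkM_succ_zero]
  · rw [mkM_succ_succ, mkM_succ_succ, hB.apply]; ring

lemma mkM_det (b B) : (mkM b B).det = B.det := by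
  rw [Matrix.det_eq_of_forall_row_eq_smul_add_const (A := mkM b B)
    (B := Matrix.of fun i j => Fin.cases (mkM b B 0 j) (fun i' => padM B i'.succ j) i)
    (Fin.cons 0 b) 0 (by simp)]
  · rw [Matrix.det_succ_column_zero, Fin.sum_univ_succ]
    simp [padM, mkM_zero_zero]
    rfl
  · intro i j
    refine Fin.cases ?_ (fun i => ?_) i <;> refine Fin.cases ?_ (fun j => ?_) j
    all_goals simp [mkM_zero_zero, mkM_zero_succ, mkM_succ_zero, mkM_succ_succ, padM]
    ring

lemma padM_vecMulVec (u v : Fin 3 → ℂ) :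
    padM (vecMulVec u v) = vecMulVec (Fin.cons 0 u) (Fin.cons 0 v) := by
  ext i j
  refine Fin.cases ?_ (fun i => ?_) i <;> refine Fin.cases ?_ (fun j => ?_) j <;>
    simp [padM, vecMulVec_apply]

lemma padM_add (B C) : padM (B + C) = padM B + padM C := by
  ext i j
  refine Fin.cases ?_ (fun i => ?_) i <;> refine Fin.cases ?_ (fun j => ?_) j <;>
    simp [padM]

lemma mkM_rank (L : Cov) : (mkM L.1.1 (L.1.2 + L.1.2ᵀ)).rank = 3 := by
  apply le_antisymm
  · obtain ⟨w, rfl⟩ := outer_surjective L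
    simp only [outer, mkM, transpose_vecMulVec, padM_add, padM_vecMulVec]
    refine (rank_add_le_aux _ _).trans ?_
    have h1 := rank_vecMulVec_le (Fin.cons 1 w.1.1 : Fin 4 → ℂ) (Fin.cons 1 w.1.1 : Fin 4 → ℂ)
    have h2 := rank_vecMulVec_le (Fin.cons 0 w.1.2.1 : Fin 4 → ℂ) (Fin.cons 0 w.1.2.2 : Fin 4 → ℂ)
    have h3 := rank_vecMulVec_le (Fin.cons 0 w.1.2.2 : Fin 4 → ℂ) (Fin.cons 0 w.1.2.1 : Fin 4 → ℂ)
    have h4 := rank_add_le_aux (vecMulVec (Fin.cons 0 w.1.2.1 : Fin 4 → ℂ) (Fin.cons 0 w.1.2.2 : Fin 4 → ℂ)) (vecMulVec (Fin.cons 0 w.1.2.2 : Fin 4 → ℂ) (Fin.cons 0 w.1.2.1 : Fin 4 → ℂ))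
    omega
  · have hns : ∃ j k, L.1.2 j k ≠ L.1.2 k j := by
      by_contra! h
      exact L.2.2 (Matrix.IsSymm.ext fun i j => h j i)
    obtain ⟨j, k, hjk⟩ := hns
    let r : Fin 3 → Fin 4 := ![0, j.succ, k.succ]
    have hdet : ((mkM L.1.1 (L.1.2 + L.1.2ᵀ)).submatrix r r).det = -(L.1.2 j k - L.1.2 k j) ^ 2 := by
      rw [det_fin_three]
      simp only [submatrix_apply, r, Matrix.cons_val, mkM_zero_zero, mkM_zero_succ, mkM_succ_zero,
        mkM_succ_succ, Matrix.add_apply, transpose_apply]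
      linear_combination 4 * L.2.1 j j k k
    have hr := rank_of_det_ne_zero (A := (mkM L.1.1 (L.1.2 + L.1.2ᵀ)).submatrix r r) (by
      rw [hdet]
      exact neg_ne_zero.2 (pow_ne_zero 2 (sub_ne_zero.2 hjk)))
    have := rank_submatrix_le (mkM L.1.1 (L.1.2 + L.1.2ᵀ)) r r
    rw [hr] at this
    simpa using this

/-- Relations between entries of the adjugate of a singular matrix. -/
lemma adj_rel (B : Matrix (Fin 3) (Fin 3) ℂ) (hB : B.IsSymm) (hd : B.det = 0) (i j k : Fin 3) :
    B.adjugate i j * B.adjugate i k = B.adjugate i i * B.adjugate j k := by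
  have h01 := hB.apply 0 1
  have h02 := hB.apply 0 2
  have h12 := hB.apply 1 2
  rw [det_fin_three] at hd
  rw [adjugate_fin_three]
  fin_cases i <;> fin_cases j <;> fin_cases k <;> simp [h01, h02, h12] at hd ⊢ <;> grind

lemma minors_of_adj (B : Matrix (Fin 3) (Fin 3) ℂ) (h : B.adjugate = 0) (i j k l : Fin 3) :
    B i j * B k l = B i l * B k j := by
  have h' : ∀ a b, B.adjugate a b = 0 := fun a b => by rw [h]; rfl
  rw [adjugate_fin_three] at h'
  have h00 := h' 0 0
  have h01 := h' 0 1
  have h02 := h' 0 2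
  have h10 := h' 1 0
  have h11 := h' 1 1
  have h12 := h' 1 2
  have h20 := h' 2 0
  have h21 := h' 2 1
  have h22 := h' 2 2
  clear h h'
  simp at h00 h01 h02 h10 h11 h12 h20 h21 h22
  fin_cases i <;> fin_cases j <;> fin_cases k <;> fin_cases l <;> simp <;> grind

lemma schur_props (b) (B : Matrix (Fin 3) (Fin 3) ℂ) (hB : B.IsSymm) (hr : (mkM b B).rank = 3) :
    B.det = 0 ∧ ∃ i, B.adjugate i i ≠ 0 := by
  have hd : B.det = 0 := by
    by_contra h
    rw [← mkM_det b B] at h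
    have := rank_of_det_ne_zero h
    rw [hr] at this
    simp at this
  refine ⟨hd, ?_⟩
  by_contra! h
  have hadj : B.adjugate = 0 := by
    ext i j
    have := adj_rel B hB hd i j j
    rw [h i, zero_mul] at this
    simpa using this
  have hm := minors_of_adj B hadj
  have h1 := rank_vecMulVec_le (Fin.cons 1 b : Fin 4 → ℂ) (Fin.cons 1 b : Fin 4 → ℂ)
  have hBv : ∃ u v, B = vecMulVec u v := by
    by_cases h0 : ∃ i j, B i j ≠ 0
    · obtain ⟨i, j, hij⟩ := h0
      refine ⟨fun k => B k j, fun l => B i l / B i j, ?_⟩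
      ext k l
      rw [vecMulVec_apply]
      field_simp
      linear_combination hm i j k l
    · push Not at h0
      exact ⟨0, 0, by ext i j; simp [h0]⟩
  obtain ⟨u, v, rfl⟩ := hBv
  have h2 := rank_vecMulVec_le (Fin.cons 0 u : Fin 4 → ℂ) (Fin.cons 0 v : Fin 4 → ℂ)
  have h3 := rank_add_le_aux (vecMulVec (Fin.cons 1 b : Fin 4 → ℂ) (Fin.cons 1 b : Fin 4 → ℂ))
    (padM (vecMulVec u v))
  rw [mkM] at hr
  rw [hr, padM_vecMulVec] at h3
  omega

/-- Cross product matrix. -/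
def crossM (m : Fin 3 → ℂ) : Matrix (Fin 3) (Fin 3) ℂ :=
  !![0, -m 2, m 1; m 2, 0, -m 0; -m 1, m 0, 0]

lemma crossM_transpose (m) : (crossM m)ᵀ = - crossM m := by
  ext i j
  fin_cases i <;> fin_cases j <;> simp [crossM]

/-- The rank one matrix with symmetric part `B / 2`. -/
noncomputable def halfM (B : Matrix (Fin 3) (Fin 3) ℂ) (i : Fin 3) (r : ℂ) :
    Matrix (Fin 3) (Fin 3) ℂ :=
  (2⁻¹ : ℂ) • (B + crossM fun j => - B.adjugate i j / r)

lemma halfM_add (B : Matrix (Fin 3) (Fin 3) ℂ) (hB : B.IsSymm) (i r) :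
    halfM B i r + (halfM B i r)ᵀ = B := by
  rw [halfM, transpose_smul, transpose_add, crossM_transpose, hB.eq, ← smul_add]
  ext a b
  simp
  ring

lemma halfM_not_symm (B : Matrix (Fin 3) (Fin 3) ℂ) (hB : B.IsSymm) (i r) (hr0 : r ≠ 0)
    (hr : r ^ 2 = - B.adjugate i i) : ¬ (halfM B i r).IsSymm := by
  intro h
  have hne : - B.adjugate i i / r ≠ 0 := by
    rw [← hr]; exact div_ne_zero (pow_ne_zero 2 hr0) hr0
  have h01 := h.apply 0 1
  have h02 := h.apply 0 2
  have h12 := h.apply 1 2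
  have g01 := hB.apply 0 1
  have g02 := hB.apply 0 2
  have g12 := hB.apply 1 2
  simp [halfM, crossM, g01, g02, g12] at h01 h02 h12
  apply hne
  fin_cases i <;> simp <;> grind

lemma cross_minors (B : Matrix (Fin 3) (Fin 3) ℂ) (hB : B.IsSymm) (m : Fin 3 → ℂ)
    (hm : ∀ j k, m j * m k = - B.adjugate j k) (hk : B *ᵥ m = 0) (i j k l : Fin 3) :
    (B + crossM m) i j * (B + crossM m) k l = (B + crossM m) i l * (B + crossM m) k j := by
  have g01 := hB.apply 0 1
  have g02 := hB.apply 0 2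
  have g12 := hB.apply 1 2
  have k0 := congrFun hk 0
  have k1 := congrFun hk 1
  have k2 := congrFun hk 2
  rw [adjugate_fin_three] at hm
  have h00 := hm 0 0
  have h01 := hm 0 1
  have h02 := hm 0 2
  have h11 := hm 1 1
  have h12 := hm 1 2
  have h22 := hm 2 2
  clear hm hk
  simp [mulVec, dotProduct, Fin.sum_univ_three, g01, g02, g12] at k0 k1 k2 h00 h01 h02 h11 h12 h22
  fin_cases i <;> fin_cases j <;> fin_cases k <;> fin_cases l <;>
    simp [crossM, g01, g02, g12] <;> grind

lemma halfM_minors (B : Matrix (Fin 3) (Fin 3) ℂ) (hB : B.IsSymm) (hd : B.det = 0) (i r)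
    (hr0 : r ≠ 0) (hr : r ^ 2 = - B.adjugate i i) (a b c d : Fin 3) :
    halfM B i r a b * halfM B i r c d = halfM B i r a d * halfM B i r c b := by
  have key := cross_minors B hB (fun j => - B.adjugate i j / r) ?_ ?_ a b c d
  · simp only [halfM, Matrix.smul_apply, smul_eq_mul]
    linear_combination (2⁻¹ : ℂ) ^ 2 * key
  · intro j k
    have := adj_rel B hB hd i j k
    field_simp
    rw [hr]
    linear_combination this
  · have hs : B.adjugate.IsSymm := hB.adjugate
    have h1 := Matrix.mul_adjugate B
    rw [hd, zero_smul] at h1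
    ext a
    have h2 := congrFun (congrFun h1 a) i
    simp only [Matrix.mul_apply, Matrix.zero_apply] at h2
    simp only [mulVec, dotProduct, Pi.zero_apply]
    have : ∀ j, B a j * (- B.adjugate i j / r) = (B a j * B.adjugate j i) * (-r⁻¹) := by
      intro j
      rw [hs.apply]
      ring
    simp only [this, ← Finset.sum_mul, h2, zero_mul]

/-- A nonsymmetric rank one matrix is determined by its symmetric part up to transposition. -/
lemma cov_eq_or (L M : Cov) (h : L.1.2 + L.1.2ᵀ = M.1.2 + M.1.2ᵀ) :
    L.1.2 = M.1.2 ∨ L.1.2 = M.1.2ᵀ := by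
  have hB : ∀ j k, L.1.2 j k + L.1.2 k j = M.1.2 j k + M.1.2 k j := fun j k => by
    simpa using congrFun (congrFun h j) k
  have prodrel : ∀ (N : Cov) (j k l m), (N.1.2 j k - N.1.2 k j) * (N.1.2 l m - N.1.2 m l) =
      (N.1.2 j m + N.1.2 m j) * (N.1.2 k l + N.1.2 l k) -
      (N.1.2 j l + N.1.2 l j) * (N.1.2 k m + N.1.2 m k) := by
    intro N j k l m
    obtain ⟨w, rfl⟩ := outer_surjective N
    simp only [outer, vecMulVec_apply]
    ring
  have hD : ∀ j k l m, (L.1.2 j k - L.1.2 k j) * (L.1.2 l m - L.1.2 m l) =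
      (M.1.2 j k - M.1.2 k j) * (M.1.2 l m - M.1.2 m l) := by
    intro j k l m
    rw [prodrel, prodrel, hB, hB, hB, hB]
  have hns : ∃ j k, L.1.2 j k ≠ L.1.2 k j := by
    by_contra! h
    exact L.2.2 (Matrix.IsSymm.ext fun i j => h j i)
  obtain ⟨j, k, hjk⟩ := hns
  have hne := sub_ne_zero.2 hjk
  rcases mul_self_eq_mul_self_iff.1 (hD j k j k) with e | e
  · left
    ext l m
    have h1 := hD j k l m
    rw [← e] at h1
    have h2 := mul_left_cancel₀ hne h1
    linear_combination (hB l m + h2) / 2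
  · right
    ext l m
    have h1 := hD j k l m
    have e' : M.1.2 j k - M.1.2 k j = -(L.1.2 j k - L.1.2 k j) := by rw [e, neg_neg]
    rw [e', neg_mul, ← mul_neg] at h1
    have h2 := mul_left_cancel₀ hne h1
    rw [transpose_apply]
    linear_combination (hB l m + h2) / 2

end Algebra

section Final
open Set Topology Filter

/-- The space of corank one quadrics not passing through `p`. -/
abbrev QX (p : Fin 4 → ℂ) : Type :=
  MatQuot 4 (fun A => A.IsSymm ∧ A.rank = 3 ∧ p ⬝ᵥ A.mulVec p ≠ 0)

lemma exists_basis (p : Fin 4 → ℂ) (hp : p ≠ 0) :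
    ∃ G H : Matrix (Fin 4) (Fin 4) ℂ, G * H = 1 ∧ H * G = 1 ∧ ∀ i, H i 0 = p i := by
  obtain ⟨e, he⟩ := SeparatingDual.exists_continuousLinearEquiv_apply_eq (R := ℂ)
    (x := (Pi.single 0 1 : Fin 4 → ℂ)) (y := p) (by simp) hp
  refine ⟨LinearMap.toMatrix' e.symm.toLinearEquiv.toLinearMap,
    LinearMap.toMatrix' e.toLinearEquiv.toLinearMap, ?_, ?_, ?_⟩
  · rw [← LinearMap.toMatrix'_comp, ← LinearMap.toMatrix'_id]
    congr 1
    ext x : 2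
    simp
  · rw [← LinearMap.toMatrix'_comp, ← LinearMap.toMatrix'_id]
    congr 1
    ext x : 2
    simp
  · intro i
    rw [LinearMap.toMatrix'_apply, ← he]
    congr 2

lemma conj_zero_zero (H A : Matrix (Fin 4) (Fin 4) ℂ) (p : Fin 4 → ℂ) (hH : ∀ i, H i 0 = p i) :
    (Hᵀ * A * H) 0 0 = p ⬝ᵥ A.mulVec p := by
  rw [Matrix.mul_assoc]
  simp only [Matrix.mul_apply, Matrix.transpose_apply, hH, dotProduct, mulVec]

lemma conj_symm (H A : Matrix (Fin 4) (Fin 4) ℂ) (hA : A.IsSymm) : (Hᵀ * A * H).IsSymm := by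
  rw [Matrix.IsSymm, transpose_mul, transpose_mul, transpose_transpose, hA.eq, Matrix.mul_assoc]

lemma conj_rank (G H A : Matrix (Fin 4) (Fin 4) ℂ) (h : G * H = 1) :
    (Hᵀ * A * H).rank = A.rank := by
  have hu : IsUnit H.det := Matrix.isUnit_det_of_left_inverse h
  rw [rank_mul_eq_left_of_isUnit_det _ _ hu, rank_mul_eq_right_of_isUnit_det]
  rwa [det_transpose]

lemma conj_conj (G H A : Matrix (Fin 4) (Fin 4) ℂ) (h : G * H = 1) :
    Hᵀ * (Gᵀ * A * G) * H = A := by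
  have h' : Hᵀ * Gᵀ = 1 := by rw [← transpose_mul, h, transpose_one]
  calc _ = (Hᵀ * Gᵀ) * A * (G * H) := by simp only [Matrix.mul_assoc]
    _ = A := by rw [h, h']; simp

/-- Coordinates on the quotient space. -/
noncomputable def exX (p : Fin 4 → ℂ) (H : Matrix (Fin 4) (Fin 4) ℂ) :
    QX p → (Fin 3 → ℂ) × Matrix (Fin 3) (Fin 3) ℂ :=
  Quotient.lift (fun A => (exb (Hᵀ * A.1 * H), exB (Hᵀ * A.1 * H))) (by
    rintro A B ⟨c, hc⟩
    simp only [hc, Matrix.mul_smul, Matrix.smul_mul, exb_smul _ c.ne_zero, exB_smul _ c.ne_zero])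

lemma exX_continuous (p : Fin 4 → ℂ) (H : Matrix (Fin 4) (Fin 4) ℂ) (hH : ∀ i, H i 0 = p i) :
    Continuous (exX p H) := by
  refine Continuous.quotient_lift ?_ _
  have hc : Continuous fun A : {A : Matrix (Fin 4) (Fin 4) ℂ //
      A.IsSymm ∧ A.rank = 3 ∧ p ⬝ᵥ A.mulVec p ≠ 0} => Hᵀ * A.1 * H := by fun_prop
  have hn : ∀ A : {A : Matrix (Fin 4) (Fin 4) ℂ //
      A.IsSymm ∧ A.rank = 3 ∧ p ⬝ᵥ A.mulVec p ≠ 0}, (Hᵀ * A.1 * H) 0 0 ≠ 0 := fun A => by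
    rw [conj_zero_zero H A.1 p hH]; exact A.2.2.2
  have hb : Continuous fun A : {A : Matrix (Fin 4) (Fin 4) ℂ //
      A.IsSymm ∧ A.rank = 3 ∧ p ⬝ᵥ A.mulVec p ≠ 0} => exb (Hᵀ * A.1 * H) :=
    continuous_pi fun i => (hc.matrix_elem _ _).div (hc.matrix_elem _ _) hn
  refine hb.prodMk ?_
  refine continuous_matrix fun i j => ?_
  exact ((hc.matrix_elem _ _).div (hc.matrix_elem _ _) hn).sub
    (((continuous_apply i).comp hb).mul ((continuous_apply j).comp hb))

/-- The covering map. -/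
noncomputable def mkX (p : Fin 4 → ℂ) (G H : Matrix (Fin 4) (Fin 4) ℂ) (hGH : G * H = 1)
    (hHG : H * G = 1) (hH : ∀ i, H i 0 = p i) (c : Cov) : QX p :=
  Quotient.mk _ ⟨Gᵀ * mkM c.1.1 (c.1.2 + c.1.2ᵀ) * G,
    conj_symm _ _ (mkM_symm _ _ (by simp [Matrix.IsSymm, add_comm])),
    by rw [conj_rank H G _ hHG, mkM_rank],
    by rw [← conj_zero_zero H _ p hH, conj_conj _ _ _ hGH, mkM_zero_zero]; exact one_ne_zero⟩

lemma mkX_continuous (p : Fin 4 → ℂ) (G H : Matrix (Fin 4) (Fin 4) ℂ) (hGH : G * H = 1)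
    (hHG : H * G = 1) (hH : ∀ i, H i 0 = p i) : Continuous (mkX p G H hGH hHG hH) := by
  refine continuous_quotient_mk'.comp (Continuous.subtype_mk ?_ _)
  have : Continuous fun c : Cov => mkM c.1.1 (c.1.2 + c.1.2ᵀ) := by
    refine continuous_matrix fun i j => ?_
    refine Fin.cases ?_ (fun i => ?_) i <;> refine Fin.cases ?_ (fun j => ?_) j
    · simp only [mkM_zero_zero]; fun_prop
    · simp only [mkM_zero_succ]; fun_prop
    · simp only [mkM_succ_zero]; fun_prop
    · simp only [mkM_succ_succ, Matrix.add_apply, transpose_apply]; fun_prop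
  fun_prop

lemma exX_mkX (p : Fin 4 → ℂ) (G H : Matrix (Fin 4) (Fin 4) ℂ) (hGH : G * H = 1)
    (hHG : H * G = 1) (hH : ∀ i, H i 0 = p i) (c : Cov) :
    exX p H (mkX p G H hGH hHG hH c) = (c.1.1, c.1.2 + c.1.2ᵀ) := by
  simp only [exX, mkX, Quotient.lift_mk, conj_conj _ _ _ hGH]
  have h1 := exb_mkM 1 one_ne_zero c.1.1 (c.1.2 + c.1.2ᵀ)
  have h2 := exB_mkM 1 one_ne_zero c.1.1 (c.1.2 + c.1.2ᵀ)
  rw [one_smul] at h1 h2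
  rw [h1, h2]

lemma mkX_of_exX (p : Fin 4 → ℂ) (G H : Matrix (Fin 4) (Fin 4) ℂ) (hGH : G * H = 1)
    (hHG : H * G = 1) (hH : ∀ i, H i 0 = p i) (c : Cov) (x : QX p)
    (h : exX p H x = (c.1.1, c.1.2 + c.1.2ᵀ)) : mkX p G H hGH hHG hH c = x := by
  induction x using Quotient.inductionOn with
  | _ A =>
  have hn : (Hᵀ * A.1 * H) 0 0 ≠ 0 := by rw [conj_zero_zero H A.1 p hH]; exact A.2.2.2
  simp only [exX, Quotient.lift_mk, Prod.mk.injEq] at h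
  refine Quotient.sound ⟨Units.mk0 _ hn, ?_⟩
  simp only [Units.val_mk0]
  have h1 := mkM_ex (Hᵀ * A.1 * H) (conj_symm _ _ A.2.1) hn
  rw [h.1, h.2] at h1
  rw [← Matrix.smul_mul, ← Matrix.mul_smul, ← h1, conj_conj _ _ _ hHG]

lemma exX_props (p : Fin 4 → ℂ) (G H : Matrix (Fin 4) (Fin 4) ℂ) (hGH : G * H = 1)
    (hH : ∀ i, H i 0 = p i) (x : QX p) :
    (exX p H x).2.IsSymm ∧ (exX p H x).2.det = 0 ∧ ∃ i, (exX p H x).2.adjugate i i ≠ 0 := by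
  induction x using Quotient.inductionOn with
  | _ A =>
  have hn : (Hᵀ * A.1 * H) 0 0 ≠ 0 := by rw [conj_zero_zero H A.1 p hH]; exact A.2.2.2
  have hs := exB_symm _ (conj_symm H _ A.2.1)
  refine ⟨hs, schur_props (exb (Hᵀ * A.1 * H)) _ hs ?_⟩
  have h1 := mkM_ex (Hᵀ * A.1 * H) (conj_symm _ _ A.2.1) hn
  have h2 := conj_rank G H A.1 hGH
  rw [h1, rank_smul_of_mem_nonZeroDivisors _ (mem_nonZeroDivisors_of_ne_zero hn), A.2.2.1] at h2
  exact h2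

/-- The local section associated with a square root. -/
noncomputable def secX (p : Fin 4 → ℂ) (H : Matrix (Fin 4) (Fin 4) ℂ) (x : QX p) (i : Fin 3)
    (r : ℂ) : (Fin 3 → ℂ) × Matrix (Fin 3) (Fin 3) ℂ :=
  ((exX p H x).1, halfM (exX p H x).2 i r)

lemma secX_mem (p : Fin 4 → ℂ) (G H : Matrix (Fin 4) (Fin 4) ℂ) (hGH : G * H = 1)
    (hH : ∀ i, H i 0 = p i) (x : QX p) (i : Fin 3) (r : ℂ) (hr0 : r ≠ 0)
    (hr : r ^ 2 = - (exX p H x).2.adjugate i i) :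
    (∀ a b c d, (secX p H x i r).2 a b * (secX p H x i r).2 c d =
      (secX p H x i r).2 a d * (secX p H x i r).2 c b) ∧ ¬ (secX p H x i r).2.IsSymm := by
  obtain ⟨hs, hd, -⟩ := exX_props p G H hGH hH x
  exact ⟨halfM_minors _ hs hd i r hr0 hr, halfM_not_symm _ hs i r hr0 hr⟩

lemma mkX_secX (p : Fin 4 → ℂ) (G H : Matrix (Fin 4) (Fin 4) ℂ) (hGH : G * H = 1)
    (hHG : H * G = 1) (hH : ∀ i, H i 0 = p i) (x : QX p) (i : Fin 3) (r : ℂ)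
    (hmem : (∀ a b c d, (secX p H x i r).2 a b * (secX p H x i r).2 c d =
      (secX p H x i r).2 a d * (secX p H x i r).2 c b) ∧ ¬ (secX p H x i r).2.IsSymm) :
    mkX p G H hGH hHG hH ⟨secX p H x i r, hmem⟩ = x := by
  obtain ⟨hs, hd, -⟩ := exX_props p G H hGH hH x
  apply mkX_of_exX
  simp only [secX]
  rw [halfM_add _ hs]

lemma mkX_surjective (p : Fin 4 → ℂ) (G H : Matrix (Fin 4) (Fin 4) ℂ) (hGH : G * H = 1)
    (hHG : H * G = 1) (hH : ∀ i, H i 0 = p i) :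
    Function.Surjective (mkX p G H hGH hHG hH) := by
  intro x
  obtain ⟨hs, hd, i, hi⟩ := exX_props p G H hGH hH x
  obtain ⟨r, hr⟩ := IsAlgClosed.exists_pow_nat_eq (- (exX p H x).2.adjugate i i) two_pos
  have hr0 : r ≠ 0 := by
    rintro rfl
    apply hi
    simpa using hr.symm
  exact ⟨_, mkX_secX p G H hGH hHG hH x i r (secX_mem p G H hGH hH x i r hr0 hr)⟩

lemma halfM_neg (B : Matrix (Fin 3) (Fin 3) ℂ) (hB : B.IsSymm) (i r) :
    halfM B i (-r) = (halfM B i r)ᵀ := by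
  rw [halfM, halfM, transpose_smul, transpose_add, crossM_transpose, hB.eq]
  congr 2
  ext a b
  fin_cases a <;> fin_cases b <;> simp [crossM, div_neg]

lemma exists_root (p : Fin 4 → ℂ) (G H : Matrix (Fin 4) (Fin 4) ℂ) (hGH : G * H = 1)
    (hHG : H * G = 1) (hH : ∀ i, H i 0 = p i) (c : Cov) :
    ∃ i r, r ≠ 0 ∧ r ^ 2 = - (exX p H (mkX p G H hGH hHG hH c)).2.adjugate i i ∧
      secX p H (mkX p G H hGH hHG hH c) i r = c.1 := by
  set x := mkX p G H hGH hHG hH c with hx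
  obtain ⟨hs, hd, i, hi⟩ := exX_props p G H hGH hH x
  obtain ⟨r, hr⟩ := IsAlgClosed.exists_pow_nat_eq (- (exX p H x).2.adjugate i i) two_pos
  have hr0 : r ≠ 0 := by
    rintro rfl
    apply hi
    simpa using hr.symm
  have hm := secX_mem p G H hGH hH x i r hr0 hr
  have hex := exX_mkX p G H hGH hHG hH c
  rw [← hx] at hex
  have h1 : (exX p H x).1 = c.1.1 := by rw [hex]
  have h2 : (exX p H x).2 = c.1.2 + c.1.2ᵀ := by rw [hex]
  rcases cov_eq_or c ⟨_, hm⟩ (by simp only [secX]; rw [halfM_add _ hs, h2]) with h | h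
  · exact ⟨i, r, hr0, hr, Prod.ext h1 h.symm⟩
  · refine ⟨i, -r, neg_ne_zero.2 hr0, by rw [neg_sq, hr], Prod.ext h1 ?_⟩
    simp only [secX] at h ⊢
    rw [halfM_neg _ hs, h]

lemma mkX_isOpenMap (p : Fin 4 → ℂ) (G H : Matrix (Fin 4) (Fin 4) ℂ) (hGH : G * H = 1)
    (hHG : H * G = 1) (hH : ∀ i, H i 0 = p i) :
    IsOpenMap (mkX p G H hGH hHG hH) := by
  rw [isOpenMap_iff_nhds_le]
  intro c U hU
  set x₀ := mkX p G H hGH hHG hH c with hx₀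
  obtain ⟨i, r, hr0, hr, hc⟩ := exists_root p G H hGH hHG hH c
  rw [← hx₀] at hr hc
  rw [mem_map, nhds_subtype_eq_comap] at hU
  obtain ⟨V, hV, hVU⟩ := hU
  have hec := exX_continuous p H hH
  have hadj : Continuous fun x : QX p => - (exX p H x).2.adjugate i i :=
    ((continuous_snd.comp hec).matrix_adjugate.matrix_elem i i).neg
  let ρ : QX p → ℂ := fun x => r * ((- (exX p H x).2.adjugate i i) / r ^ 2) ^ (2⁻¹ : ℂ)
  have hρ0 : ρ x₀ = r := by
    simp only [ρ]
    rw [← hr, div_self (pow_ne_zero 2 hr0), Complex.one_cpow, mul_one]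
  have hρc : ContinuousAt ρ x₀ := by
    refine continuousAt_const.mul (ContinuousAt.cpow (hadj.continuousAt.div_const _)
      continuousAt_const ?_)
    rw [← hr, div_self (pow_ne_zero 2 hr0)]
    exact Complex.one_mem_slitPlane
  have hρsq : ∀ x, ρ x ^ 2 = - (exX p H x).2.adjugate i i := by
    intro x
    simp only [ρ]
    have := Complex.cpow_nat_inv_pow ((- (exX p H x).2.adjugate i i) / r ^ 2) two_ne_zero
    rw [mul_pow]
    push_cast at this
    rw [this]
    field_simp
  have hρne : ∀ᶠ x in 𝓝 x₀, ρ x ≠ 0 := hρc.eventually_ne (by rw [hρ0]; exact hr0)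
  have hsec : ContinuousAt (fun x => secX p H x i (ρ x)) x₀ := by
    have hm : ContinuousAt (fun x j => - (exX p H x).2.adjugate i j / ρ x) x₀ := by
      refine continuousAt_pi.2 fun j => ContinuousAt.div ?_ hρc (by rw [hρ0]; exact hr0)
      exact ((continuous_snd.comp hec).matrix_adjugate.matrix_elem i j).neg.continuousAt
    have hcr : Continuous crossM := by
      refine continuous_matrix fun a b => ?_
      fin_cases a <;> fin_cases b <;> simp [crossM] <;> fun_prop
    have hh := (((continuous_snd.comp hec).continuousAt (x := x₀)).add
      (hcr.continuousAt.comp hm)).const_smul (2⁻¹ : ℂ)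
    have hh' : ContinuousAt (fun x => halfM (exX p H x).2 i (ρ x)) x₀ := hh
    exact (continuous_fst.comp hec).continuousAt.prodMk hh'
  have hV' : V ∈ 𝓝 (secX p H x₀ i (ρ x₀)) := by rw [hρ0, hc]; exact hV
  filter_upwards [hρne, hsec hV'] with x h1 h2
  have hm := secX_mem p G H hGH hH x i (ρ x) h1 (hρsq x)
  rw [← mkX_secX p G H hGH hHG hH x i (ρ x) hm]
  exact hVU (a := ⟨_, hm⟩) h2

/-- Transposition. -/
def trC (c : Cov) : Cov := ⟨(c.1.1, c.1.2ᵀ), fun i j k l => by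
  simp only [transpose_apply]
  linear_combination c.2.1 j i l k, fun h => c.2.2 (by
    have h' := h.transpose
    simpa using h')⟩

lemma trC_trC (c : Cov) : trC (trC c) = c := by
  apply Subtype.ext
  simp [trC]

lemma trC_ne (c : Cov) : trC c ≠ c := by
  intro h
  exact c.2.2 (congrArg (fun d : Cov => d.1.2) h)

lemma trC_continuous : Continuous trC := by
  unfold trC
  refine Continuous.subtype_mk ?_ _
  fun_prop

/-- The deck group action. -/
instance covAction : MulAction ℤˣ Cov where
  smul u c := if u = 1 then c else trC c
  one_smul c := if_pos rfl
  mul_smul u v c := by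
    change (if u * v = 1 then c else trC c) =
      if u = 1 then (if v = 1 then c else trC c) else trC (if v = 1 then c else trC c)
    rcases Int.units_eq_one_or u with rfl | rfl <;> rcases Int.units_eq_one_or v with rfl | rfl <;>
      simp [trC_trC]

lemma neg_one_smul_cov (c : Cov) : (-1 : ℤˣ) • c = trC c := if_neg (by decide)

lemma mkX_isQuotientCoveringMap (p : Fin 4 → ℂ) (G H : Matrix (Fin 4) (Fin 4) ℂ)
    (hGH : G * H = 1) (hHG : H * G = 1) (hH : ∀ i, H i 0 = p i) :
    IsQuotientCoveringMap (mkX p G H hGH hHG hH) ℤˣ where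
  toIsQuotientMap := (mkX_isOpenMap p G H hGH hHG hH).isQuotientMap
    (mkX_continuous p G H hGH hHG hH) (mkX_surjective p G H hGH hHG hH)
  continuous_const_smul u := by
    rcases Int.units_eq_one_or u with rfl | rfl
    · simp only [one_smul]; exact continuous_id
    · simpa only [neg_one_smul_cov] using trC_continuous
  apply_eq_iff_mem_orbit := by
    intro c d
    constructor
    · intro h
      have h' := congrArg (exX p H) h
      rw [exX_mkX, exX_mkX, Prod.mk.injEq] at h'
      rcases cov_eq_or c d h'.2 with e | e
      · exact ⟨1, by simp only [one_smul]; exact Subtype.ext (Prod.ext h'.1.symm e.symm)⟩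
      · exact ⟨-1, by
          simp only [neg_one_smul_cov]; exact Subtype.ext (Prod.ext h'.1.symm e.symm)⟩
    · rintro ⟨u, rfl⟩
      apply mkX_of_exX
      rw [exX_mkX]
      rcases Int.units_eq_one_or u with rfl | rfl
      · simp
      · simp [neg_one_smul_cov, trC, add_comm]
  disjoint c := by
    obtain ⟨U, V, hU, hV, hcU, hcV, hd⟩ := t2_separation (trC_ne c)
    refine ⟨V ∩ trC ⁻¹' U, inter_mem (hV.mem_nhds hcV)
      ((hU.preimage trC_continuous).mem_nhds hcU), ?_⟩
    rintro u ⟨_, ⟨d, hd', rfl⟩, h2⟩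
    rcases Int.units_eq_one_or u with rfl | rfl
    · rfl
    · exfalso
      simp only [neg_one_smul_cov] at h2
      exact Set.disjoint_left.1 hd hd'.2 h2.1

lemma final_aux (p : Fin 4 → ℂ) (hp : p ≠ 0) :
    PathConnectedSpace (QX p) ∧
    ∀ q : QX p, Nonempty (FundamentalGroup (QX p) q ≃* Multiplicative (ZMod 2)) := by
  obtain ⟨G, H, hGH, hHG, hH⟩ := exists_basis p hp
  have hsc : SimplyConnectedSpace Cov := cov_simplyConnected
  have hq := mkX_isQuotientCoveringMap p G H hGH hHG hH
  have hs := mkX_surjective p G H hGH hHG hH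
  refine ⟨hs.pathConnectedSpace hq.continuous, fun q => ?_⟩
  obtain ⟨e, he⟩ := hs q
  have e1 := hq.fundamentalGroupEquiv ⟨e, he⟩
  have : Fact (Nat.Prime 2) := ⟨Nat.prime_two⟩
  have e2 : (ℤˣ)ᵐᵒᵖ ≃* Multiplicative (ZMod 2) :=
    mulEquivOfPrimeCardEq (p := 2) (by
      rw [Nat.card_congr MulOpposite.opEquiv.symm, Nat.card_eq_fintype_card]; rfl)
      (by simp [Nat.card_eq_fintype_card])
  exact ⟨e1.trans e2⟩

end Final

/-- For a nonzero `p ∈ ℂ⁴`, the space `Δ° ∖ H_p` of corank-`1` quadrics in `ℂP³` not passing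
through `p` is path-connected with fundamental group `ℤ/2ℤ` at any basepoint. -/
theorem corank_one_quadrics_minus_hyperplane_pi1
    (p : Fin 4 → ℂ) (hp : p ≠ 0) :
    PathConnectedSpace (MatQuot 4 (fun A => A.IsSymm ∧ A.rank = 3 ∧ p ⬝ᵥ A.mulVec p ≠ 0)) ∧
    ∀ q : MatQuot 4 (fun A => A.IsSymm ∧ A.rank = 3 ∧ p ⬝ᵥ A.mulVec p ≠ 0),
      Nonempty
        (FundamentalGroup (MatQuot 4 (fun A => A.IsSymm ∧ A.rank = 3 ∧ p ⬝ᵥ A.mulVec p ≠ 0)) q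
          ≃* Multiplicative (ZMod 2)) := by
  exact final_aux p hp
end
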